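/- There exists a universal constant C > 0 such that for every n ≥ 2, every f₀ ∈ F_1, and X₁, …, X_n i.i.d. with density f₀, the log-concave maximum likelihood estimator f̂_n satisfies E_{f₀} d_X²(f̂_n, f₀) ≤ min over k ∈ {1, …, n} of [ (Ck/n) log^{5/4}(en/k) + inf_{f_k ∈ F^k} d_KL²(f₀, f_k) ], where d_X²(f̂_n, f₀) := n^{-1} Σ_{i=1}^n log( f̂_n(X_i) / f₀(X_i) ). -/

import Mathlib

open MeasureTheory Filter Set
open scoped ENNReal Topology

noncomputable section

/-- `ℝ^d` with its Euclidean norm and Lebesgue measure. -/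
abbrev Rd (d : ℕ) : Type := EuclideanSpace ℝ (Fin d)

/-- A nonnegative function is log-concave (`log f` is concave, with `log 0 := -∞`),
expressed multiplicatively via `f x ^ (1-t) * f y ^ t ≤ f ((1-t) • x + t • y)`. -/
def IsLogConcaveFn {E : Type*} [AddCommGroup E] [Module ℝ E] (f : E → ℝ) : Prop :=
  (∀ x, 0 ≤ f x) ∧
  ∀ x y : E, ∀ t : ℝ, t ∈ Set.Icc (0:ℝ) 1 →
    f x ^ (1 - t) * f y ^ t ≤ f ((1 - t) • x + t • y)

/-- A probability density with respect to the (Lebesgue) measure of a `MeasureSpace`. -/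
def IsDensity {E : Type*} [MeasureSpace E] (f : E → ℝ) : Prop :=
  (∀ x, 0 ≤ f x) ∧ Measurable f ∧ ∫⁻ x, ENNReal.ofReal (f x) = 1

/-- Membership in the class `F_d`: an upper semi-continuous log-concave probability
density. -/
def IsLCDensity {E : Type*} [MeasureSpace E] [TopologicalSpace E] [AddCommGroup E]
    [Module ℝ E] (f : E → ℝ) : Prop :=
  IsDensity f ∧ UpperSemicontinuous f ∧ IsLogConcaveFn f

/-- Membership in the class `P_d`: probability measures with finite first moment that are
not concentrated on any affine hyperplane `{x | l x = c}` (`l` a nonzero linear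
functional). -/
def MemP {E : Type*} [NormedAddCommGroup E] [NormedSpace ℝ E] [MeasureSpace E]
    (P : Measure E) : Prop :=
  IsProbabilityMeasure P ∧ Integrable (fun x => ‖x‖) P ∧
  ∀ (l : E →ₗ[ℝ] ℝ) (c : ℝ), l ≠ 0 → P {x | l x = c} < 1

/-- The log-concave projection predicate: `fs ∈ F_d` maximises `∫ log f dP` over `F_d`
(candidates whose objective is `-∞`, i.e. that vanish on a set of positive `P`-measure or
have non-integrable logarithm, are trivially dominated). -/
def IsLCProj {E : Type*} [NormedAddCommGroup E] [NormedSpace ℝ E] [MeasureSpace E]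
    (P : Measure E) (fs : E → ℝ) : Prop :=
  IsLCDensity fs ∧ (∀ᵐ x ∂P, 0 < fs x) ∧ Integrable (fun x => Real.log (fs x)) P ∧
  ∀ g : E → ℝ, IsLCDensity g → (∀ᵐ x ∂P, 0 < g x) →
    Integrable (fun x => Real.log (g x)) P →
    ∫ x, Real.log (g x) ∂P ≤ ∫ x, Real.log (fs x) ∂P

/-- `log y` with values in `[-∞, ∞)`, with the convention `log 0 := -∞`. -/
def elog (y : ℝ) : EReal := if y ≤ 0 then ⊥ else ((Real.log y : ℝ) : EReal)

/-- Positive part of an extended real number, as an `ℝ≥0∞`. -/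
def epos (a : EReal) : ℝ≥0∞ := if a = ⊤ then ⊤ else ENNReal.ofReal a.toReal

/-- `e^a` for an extended real `a`, valued in `[0,∞]`. -/
def expE (a : EReal) : ℝ≥0∞ :=
  if a = ⊥ then 0 else if a = ⊤ then ⊤ else ENNReal.ofReal (Real.exp a.toReal)

/-- Integral of an `EReal`-valued function: positive part minus negative part. -/
def erealIntegral {α : Type*} [MeasurableSpace α] (P : Measure α) (φ : α → EReal) : EReal :=
  ((∫⁻ x, epos (φ x) ∂P : ℝ≥0∞) : EReal) - ((∫⁻ x, epos (-(φ x)) ∂P : ℝ≥0∞) : EReal)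

/-- The class `Φ`: upper semi-continuous, concave functions `φ : E → [-∞, ∞)` with
`φ(x) → -∞` as `‖x‖ → ∞`. -/
def MemPhi {E : Type*} [NormedAddCommGroup E] [NormedSpace ℝ E] (φ : E → EReal) : Prop :=
  (∀ x, φ x ≠ ⊤) ∧ UpperSemicontinuous φ ∧
  (∀ x y : E, ∀ t : ℝ, t ∈ Set.Icc (0:ℝ) 1 →
    (((1 - t : ℝ)) : EReal) * φ x + ((t : ℝ) : EReal) * φ y ≤ φ ((1 - t) • x + t • y)) ∧
  Tendsto φ (Filter.comap (fun x => ‖x‖) Filter.atTop) (nhds ⊥)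

/-- The functional `L(φ, P) = ∫ φ dP - ∫ e^φ dx`. -/
def Lfun {E : Type*} [NormedAddCommGroup E] [NormedSpace ℝ E] [MeasureSpace E]
    (φ : E → EReal) (P : Measure E) : EReal :=
  erealIntegral P φ - ((∫⁻ x, expE (φ x) : ℝ≥0∞) : EReal)

/-- `L*(P) = sup_{φ ∈ Φ} L(φ, P)`. -/
def Lstar {E : Type*} [NormedAddCommGroup E] [NormedSpace ℝ E] [MeasureSpace E]
    (P : Measure E) : EReal :=
  ⨆ (φ : E → EReal) (_ : MemPhi φ), Lfun φ P

/-- Action of a matrix on a Euclidean vector. -/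
def mulVE {m d : ℕ} (A : Matrix (Fin m) (Fin d) ℝ) (x : Rd d) : Rd m :=
  (WithLp.equiv 2 (Fin m → ℝ)).symm (A.mulVec ((WithLp.equiv 2 (Fin d → ℝ)) x))

open scoped Classical

/-- `g` is a log-concave maximum likelihood estimator for the data `xs` on `ℝ`. -/
def IsMLE1 {n : ℕ} (xs : Fin n → ℝ) (g : ℝ → ℝ) : Prop :=
  IsLCDensity g ∧ ∀ h : ℝ → ℝ, IsLCDensity h →
    (∑ i, elog (h (xs i))) ≤ ∑ i, elog (g (xs i))

/-- `log f` is `k`-affine: `f` is supported on a union of `k` intervals, on each of which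
`log f` is affine. -/
def IsKAffine (k : ℕ) (f : ℝ → ℝ) : Prop :=
  ∃ I : Fin k → Set ℝ, (∀ j, (I j).OrdConnected) ∧
    (∀ x : ℝ, x ∉ ⋃ j, I j → f x = 0) ∧
    ∀ j, ∃ a b : ℝ, ∀ x ∈ I j, f x = Real.exp (a * x + b)

/-- Kullback--Leibler divergence `∫ f log(f/g)` between densities, valued in `[0, ∞]`
(`∞` unless `f ≪ g` and the integral converges). -/
def dKL (f g : ℝ → ℝ) : ℝ≥0∞ :=
  if (∀ᵐ x : ℝ, g x = 0 → f x = 0) ∧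
      Integrable (fun x => f x * Real.log (f x / g x)) then
    ENNReal.ofReal (∫ x, f x * Real.log (f x / g x))
  else ⊤

/-! ### Log-concave densities on the line -/

theorem IsLogConcaveFn.mul_le_mul_of_mem_Icc {f : ℝ → ℝ} (hf : IsLogConcaveFn f) {a b c : ℝ}
    (hac : a ≤ c) (hcb : c ≤ b) : f a * f b ≤ f c * f (a + b - c) := by
  rcases eq_or_lt_of_le (hac.trans hcb) with hab | hab
  · obtain rfl : c = a := le_antisymm (hab ▸ hcb) hac
    simp
  have hD : 0 < b - a := by linarith
  set t := (c - a) / (b - a) with ht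
  have htm : t ∈ Icc (0 : ℝ) 1 :=
    ⟨div_nonneg (by linarith) hD.le, (div_le_one hD).2 (by linarith)⟩
  have htm' : 1 - t ∈ Icc (0 : ℝ) 1 := ⟨by linarith [htm.2], by linarith [htm.1]⟩
  have e1 : (1 - t) • a + t • b = c := by
    simp only [ht, smul_eq_mul]; field_simp; ring
  have e2 : (1 - (1 - t)) • a + (1 - t) • b = a + b - c := by
    simp only [ht, smul_eq_mul]; field_simp; ring
  have h1 := hf.2 a b t htm
  have h2 := hf.2 a b (1 - t) htm'
  rw [e1] at h1
  rw [e2] at h2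
  have key : f a * f b = (f a ^ (1 - t) * f b ^ t) * (f a ^ (1 - (1 - t)) * f b ^ (1 - t)) := by
    have p : ∀ x : ℝ, x = x ^ (1 - t) * x ^ t ∨ x < 0 := by
      intro x
      rcases lt_trichotomy x 0 with h | rfl | h
      · exact Or.inr h
      · left
        rcases eq_or_ne t 0 with h | h
        · simp [h]
        · simp [Real.zero_rpow h]
      · left; rw [← Real.rpow_add h]; simp
    have pa := (p (f a)).resolve_right (not_lt.2 (hf.1 a))
    have pb := (p (f b)).resolve_right (not_lt.2 (hf.1 b))
    rw [sub_sub_cancel]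
    calc f a * f b = (f a ^ (1 - t) * f a ^ t) * (f b ^ (1 - t) * f b ^ t) := by
          rw [← pa, ← pb]
      _ = _ := by ring
  rw [key]
  have nn : ∀ x y r s : ℝ, 0 ≤ f x ^ r * f y ^ s := fun x y r s =>
    mul_nonneg (Real.rpow_nonneg (hf.1 x) _) (Real.rpow_nonneg (hf.1 y) _)
  exact mul_le_mul h1 h2 (nn _ _ _ _) (hf.1 c)

theorem IsLogConcaveFn.min_le {f : ℝ → ℝ} (hf : IsLogConcaveFn f) {a b c : ℝ}
    (hac : a ≤ c) (hcb : c ≤ b) : min (f a) (f b) ≤ f c := by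
  rcases eq_or_lt_of_le (hac.trans hcb) with hab | hab
  · obtain rfl : c = a := le_antisymm (hab ▸ hcb) hac
    exact min_le_left _ _
  have hD : 0 < b - a := by linarith
  set t := (c - a) / (b - a) with ht
  have htm : t ∈ Icc (0 : ℝ) 1 :=
    ⟨div_nonneg (by linarith) hD.le, (div_le_one hD).2 (by linarith)⟩
  have e1 : (1 - t) • a + t • b = c := by
    simp only [ht, smul_eq_mul]; field_simp; ring
  have h1 := hf.2 a b t htm
  rw [e1] at h1
  set m := min (f a) (f b)
  have hm0 : 0 ≤ m := le_min (hf.1 a) (hf.1 b)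
  rcases hm0.eq_or_lt with h | h
  · rw [← h]; exact hf.1 c
  calc m = m ^ (1 - t) * m ^ t := by rw [← Real.rpow_add h]; simp
    _ ≤ f a ^ (1 - t) * f b ^ t := by
        apply mul_le_mul (Real.rpow_le_rpow hm0 (min_le_left _ _) (by linarith [htm.2]))
          (Real.rpow_le_rpow hm0 (min_le_right _ _) htm.1) (Real.rpow_nonneg hm0 _)
          (Real.rpow_nonneg (hf.1 a) _)
    _ ≤ f c := h1

/-- Concavity of `log f`, in the form used for extrapolation beyond `y`. -/
theorem IsLogConcaveFn.log_concave {f : ℝ → ℝ} (hf : IsLogConcaveFn f) {a b : ℝ} {t : ℝ}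
    (ht : t ∈ Icc (0 : ℝ) 1) (ha : 0 < f a) (hb : 0 < f b) :
    0 < f ((1 - t) * a + t * b) ∧
    (1 - t) * Real.log (f a) + t * Real.log (f b) ≤ Real.log (f ((1 - t) * a + t * b)) := by
  have h1 := hf.2 a b t ht
  simp only [smul_eq_mul] at h1
  have hpos : 0 < f a ^ (1 - t) * f b ^ t :=
    mul_pos (Real.rpow_pos_of_pos ha _) (Real.rpow_pos_of_pos hb _)
  refine ⟨hpos.trans_le h1, ?_⟩
  have := Real.log_le_log hpos h1
  rwa [Real.log_mul (Real.rpow_pos_of_pos ha _).ne' (Real.rpow_pos_of_pos hb _).ne',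
    Real.log_rpow ha, Real.log_rpow hb] at this

theorem IsLogConcaveFn.comp_neg {f : ℝ → ℝ} (hf : IsLogConcaveFn f) :
    IsLogConcaveFn fun x => f (-x) := by
  refine ⟨fun x => hf.1 _, fun x y t ht => ?_⟩
  have := hf.2 (-x) (-y) t ht
  convert this using 2
  simp only [smul_eq_mul]; ring

theorem IsDensity.integrable {f : ℝ → ℝ} (hf : IsDensity f) : Integrable f := by
  refine ⟨hf.2.1.aestronglyMeasurable, ?_⟩
  rw [hasFiniteIntegral_iff_ofReal (ae_of_all _ hf.1), hf.2.2]
  exact ENNReal.one_lt_top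

theorem IsDensity.integral_eq_one {f : ℝ → ℝ} (hf : IsDensity f) : ∫ x, f x = 1 := by
  rw [integral_eq_lintegral_of_nonneg_ae (ae_of_all _ hf.1) hf.2.1.aestronglyMeasurable, hf.2.2]
  rfl

theorem IsDensity.setIntegral_le_one {f : ℝ → ℝ} (hf : IsDensity f) (s : Set ℝ) :
    ∫ x in s, f x ≤ 1 := by
  rw [← hf.integral_eq_one]
  exact setIntegral_le_integral hf.integrable (ae_of_all _ hf.1)

theorem IsDensity.setIntegral_nonneg {f : ℝ → ℝ} (hf : IsDensity f) (s : Set ℝ) :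
    0 ≤ ∫ x in s, f x :=
  integral_nonneg hf.1

theorem IsDensity.comp_neg {f : ℝ → ℝ} (hf : IsDensity f) : IsDensity fun x => f (-x) := by
  refine ⟨fun x => hf.1 _, hf.2.1.comp measurable_neg, ?_⟩
  rw [← hf.2.2]
  exact lintegral_neg_eq_self (μ := volume) (f := fun x => ENNReal.ofReal (f x))

theorem IsLCDensity.mul_setIntegral_Iic_le {f : ℝ → ℝ} (hf : IsDensity f)
    (hl : IsLogConcaveFn f) {x y : ℝ} (hyx : y ≤ x) :
    f x * ∫ z in Iic y, f z ≤ f y * ∫ z in Iic x, f z := by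
  have hi := hf.integrable
  have e : ∫ z in Iic x, f z = ∫ z in Iic y, f (z + (x - y)) := by
    have := (measurePreserving_add_right (volume : Measure ℝ) (x - y)).setIntegral_preimage_emb
      (MeasurableEquiv.addRight (x - y)).measurableEmbedding f (Iic x)
    rw [← this]
    congr 2
    ext z; simp
  rw [e, ← integral_const_mul, ← integral_const_mul]
  refine setIntegral_mono_on (hi.integrableOn.const_mul _)
    ((hi.comp_add_right _).integrableOn.const_mul _) measurableSet_Iic fun z hz => ?_
  have := hl.mul_le_mul_of_mem_Icc (a := z) (b := x) (c := y) hz hyx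
  rw [mul_comm, show z + (x - y) = z + x - y by ring]
  exact this

theorem IsLCDensity.mul_setIntegral_Ici_le {f : ℝ → ℝ} (hf : IsDensity f)
    (hl : IsLogConcaveFn f) {x y : ℝ} (hxy : x ≤ y) :
    f x * ∫ z in Ici y, f z ≤ f y * ∫ z in Ici x, f z := by
  have := IsLCDensity.mul_setIntegral_Iic_le hf.comp_neg hl.comp_neg (neg_le_neg hxy)
  have e : ∀ c : ℝ, ∫ z in Iic (-c), f (-z) = ∫ z in Ici c, f z := by
    intro c
    have := integral_comp_neg_Iic (-c) f
    rw [this, neg_neg, integral_Ici_eq_integral_Ioi]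
  simpa only [e, neg_neg] using this

/-- The probability measure with density `f`. -/
def densMeas (f : ℝ → ℝ) : Measure ℝ := volume.withDensity fun x => ENNReal.ofReal (f x)

/-- The distribution function of the density `f`. -/
def distFn (f : ℝ → ℝ) (x : ℝ) : ℝ := ∫ z in Iic x, f z

section density

variable {f : ℝ → ℝ}

theorem IsDensity.isProbabilityMeasure (hf : IsDensity f) : IsProbabilityMeasure (densMeas f) :=
  ⟨by rw [densMeas, withDensity_apply _ MeasurableSet.univ]; simpa using hf.2.2⟩

theorem IsDensity.real_densMeas (hf : IsDensity f) {s : Set ℝ} (hs : MeasurableSet s) :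
    (densMeas f).real s = ∫ x in s, f x := by
  rw [Measure.real, densMeas, withDensity_apply _ hs,
    integral_eq_lintegral_of_nonneg_ae (ae_of_all _ hf.1) hf.2.1.aestronglyMeasurable.restrict]

theorem IsDensity.integral_densMeas (hf : IsDensity f) (g : ℝ → ℝ) :
    ∫ x, g x ∂(densMeas f) = ∫ x, f x * g x := by
  rw [densMeas, integral_withDensity_eq_integral_toReal_smul hf.2.1.ennreal_ofReal
    (ae_of_all _ fun x => ENNReal.ofReal_lt_top)]
  simp [ENNReal.toReal_ofReal (hf.1 _)]

theorem IsDensity.integrable_densMeas_iff (hf : IsDensity f) {g : ℝ → ℝ} :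
    Integrable g (densMeas f) ↔ Integrable fun x => f x * g x := by
  rw [densMeas, integrable_withDensity_iff_integrable_smul' hf.2.1.ennreal_ofReal
    (ae_of_all _ fun x => ENNReal.ofReal_lt_top)]
  simp [ENNReal.toReal_ofReal (hf.1 _)]

theorem IsDensity.setIntegral_densMeas (hf : IsDensity f) (g : ℝ → ℝ) {s : Set ℝ}
    (hs : MeasurableSet s) :
    ∫ x in s, g x ∂(densMeas f) = ∫ x in s, f x * g x := by
  rw [← integral_indicator hs, hf.integral_densMeas, ← integral_indicator hs]
  congr 1; ext x; by_cases h : x ∈ s <;> simp [h]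

theorem IsDensity.densMeas_absolutelyContinuous : densMeas f ≪ volume :=
  withDensity_absolutelyContinuous _ _

theorem IsDensity.ae_pos (hf : IsDensity f) : ∀ᵐ x ∂(densMeas f), 0 < f x := by
  rw [densMeas, ae_withDensity_iff hf.2.1.ennreal_ofReal]
  filter_upwards with x hx
  exact ENNReal.ofReal_pos.1 (pos_iff_ne_zero.2 hx)

theorem distFn_mono (hf : IsDensity f) : Monotone (distFn f) := fun _ _ h =>
  setIntegral_mono_set hf.integrable.integrableOn (ae_of_all _ hf.1)
    (LE.le.eventuallyLE (Iic_subset_Iic.2 h))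

theorem distFn_nonneg (hf : IsDensity f) (x : ℝ) : 0 ≤ distFn f x := hf.setIntegral_nonneg _

theorem distFn_le_one (hf : IsDensity f) (x : ℝ) : distFn f x ≤ 1 := hf.setIntegral_le_one _

theorem one_sub_distFn (hf : IsDensity f) (x : ℝ) : 1 - distFn f x = ∫ z in Ici x, f z := by
  rw [integral_Ici_eq_integral_Ioi, ← hf.integral_eq_one, distFn,
    ← integral_add_compl measurableSet_Iic hf.integrable (s := Iic x), compl_Iic]
  ring

theorem distFn_continuous (hf : IsDensity f) : Continuous (distFn f) := by
  have : distFn f = fun x => distFn f 0 + ∫ z in (0 : ℝ)..x, f z := by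
    ext x
    have := intervalIntegral.integral_Iic_sub_Iic (a := 0) (b := x) (f := f) (μ := volume)
      hf.integrable.integrableOn hf.integrable.integrableOn
    rw [← this, distFn, distFn]; ring
  rw [this]
  exact continuous_const.add (intervalIntegral.continuous_primitive
    (fun a b => hf.integrable.intervalIntegrable) 0)

theorem tendsto_distFn_atTop (hf : IsDensity f) : Tendsto (distFn f) atTop (𝓝 1) := by
  rw [← hf.integral_eq_one]
  have := (aecover_Iic (μ := volume) (tendsto_id (x := (atTop : Filter ℝ))))
  exact this.integral_tendsto_of_countably_generated hf.integrable

theorem tendsto_distFn_atBot (hf : IsDensity f) : Tendsto (distFn f) atBot (𝓝 0) := by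
  have h1 : Tendsto (fun x : ℝ => ∫ z in Ici x, f z) atBot (𝓝 1) := by
    rw [← hf.integral_eq_one]
    have := (aecover_Ici (μ := volume) (tendsto_id (x := (atBot : Filter ℝ))))
    exact this.integral_tendsto_of_countably_generated hf.integrable
  have h2 : Tendsto (fun x => 1 - ∫ z in Ici x, f z) atBot (𝓝 (1 - 1)) := h1.const_sub 1
  rw [sub_self] at h2
  refine h2.congr fun x => ?_
  rw [← one_sub_distFn hf]; ring

theorem exists_distFn_eq (hf : IsDensity f) {a : ℝ} (ha : a ∈ Ioo (0 : ℝ) 1) :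
    ∃ x, distFn f x = a := by
  obtain ⟨y, hy⟩ := ((tendsto_distFn_atBot hf).eventually_lt_const ha.1).exists
  obtain ⟨z, hz⟩ := ((tendsto_distFn_atTop hf).eventually_const_lt ha.2).exists
  exact mem_range_of_exists_le_of_exists_ge (distFn_continuous hf) ⟨y, hy.le⟩ ⟨z, hz.le⟩

theorem real_densMeas_Iic (hf : IsDensity f) (x : ℝ) :
    (densMeas f).real (Iic x) = distFn f x := hf.real_densMeas measurableSet_Iic

theorem real_densMeas_distFn_le (hf : IsDensity f) {a : ℝ} (ha : a ∈ Icc (0 : ℝ) 1) :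
    (densMeas f).real (distFn f ⁻¹' Iic a) = a := by
  have := hf.isProbabilityMeasure
  have hle : ∀ b ∈ Ioo (0 : ℝ) 1, a < b → (densMeas f).real (distFn f ⁻¹' Iic a) ≤ b := by
    intro b hb hab
    obtain ⟨y, hy⟩ := exists_distFn_eq hf hb
    calc _ ≤ (densMeas f).real (Iic y) := by
          refine measureReal_mono fun x hx => ?_
          by_contra h
          have := distFn_mono hf (not_le.1 h).le
          simp only [mem_preimage, mem_Iic] at hx
          linarith
      _ = b := by rw [real_densMeas_Iic hf, hy]
  have hge : ∀ b ∈ Ioo (0 : ℝ) 1, b ≤ a → b ≤ (densMeas f).real (distFn f ⁻¹' Iic a) := by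
    intro b hb hab
    obtain ⟨y, hy⟩ := exists_distFn_eq hf hb
    calc b = (densMeas f).real (Iic y) := by rw [real_densMeas_Iic hf, hy]
      _ ≤ _ := measureReal_mono fun x hx =>
        ((distFn_mono hf (show x ≤ y from hx)).trans hy.le).trans hab
  apply le_antisymm
  · rcases ha.2.eq_or_lt with h | h
    · rw [h]; exact measureReal_le_one
    · refine le_of_forall_gt_imp_ge_of_dense fun b hb => ?_
      rcases lt_or_ge b 1 with h1 | h1
      · exact hle b ⟨ha.1.trans_lt hb, h1⟩ hb
      · exact measureReal_le_one.trans h1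
  · rcases ha.1.eq_or_lt with h | h
    · rw [← h]; exact measureReal_nonneg
    · refine le_of_forall_lt_imp_le_of_dense fun b hb => ?_
      rcases le_or_gt b 0 with h1 | h1
      · exact h1.trans measureReal_nonneg
      · exact hge b ⟨h1, hb.trans_le ha.2⟩ hb.le

theorem real_densMeas_distFn_Ioc (hf : IsDensity f) {a b : ℝ} (ha : 0 ≤ a) (hab : a ≤ b)
    (hb : b ≤ 1) : (densMeas f).real (distFn f ⁻¹' Ioc a b) = b - a := by
  have := hf.isProbabilityMeasure
  have e : distFn f ⁻¹' Ioc a b = distFn f ⁻¹' Iic b \ distFn f ⁻¹' Iic a := by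
    rw [← preimage_sdiff]; congr 1; ext x; simp [and_comm]
  rw [e, measureReal_sdiff (preimage_mono (Iic_subset_Iic.2 hab))
    ((distFn_continuous hf).measurable measurableSet_Iic),
    real_densMeas_distFn_le hf ⟨ha.trans hab, hb⟩, real_densMeas_distFn_le hf ⟨ha, hab.trans hb⟩]

end density

section height

variable {f : ℝ → ℝ}

theorem mul_distFn_le (hf : IsDensity f) (hl : IsLogConcaveFn f) {x y : ℝ} (h : y ≤ x) :
    f x * distFn f y ≤ f y * distFn f x := IsLCDensity.mul_setIntegral_Iic_le hf hl h

theorem mul_one_sub_distFn_le (hf : IsDensity f) (hl : IsLogConcaveFn f) {x y : ℝ} (h : x ≤ y) :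
    f x * (1 - distFn f y) ≤ f y * (1 - distFn f x) := by
  rw [one_sub_distFn hf, one_sub_distFn hf]
  exact IsLCDensity.mul_setIntegral_Ici_le hf hl h

theorem exists_height (hf : IsDensity f) (hl : IsLogConcaveFn f) :
    ∃ S : ℝ, 0 < S ∧ (∀ x, f x ≤ 2 * S) ∧
      ∀ x, S * min (distFn f x) (1 - distFn f x) ≤ f x := by
  obtain ⟨m, hm⟩ := exists_distFn_eq hf (a := 1 / 2) ⟨by norm_num, by norm_num⟩
  have hup : ∀ x, f x ≤ 2 * f m := by
    intro x
    rcases le_total m x with h | h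
    · have h1 := mul_distFn_le hf hl h
      rw [hm] at h1
      nlinarith [distFn_le_one hf x, hf.1 m]
    · have h1 := mul_one_sub_distFn_le hf hl h
      rw [hm] at h1
      nlinarith [distFn_nonneg hf x, hf.1 m]
  refine ⟨f m, ?_, hup, fun x => ?_⟩
  · rcases (hf.1 m).eq_or_lt with h | h
    · exfalso
      have : f = 0 := by
        ext x
        have := hup x
        rw [← h, mul_zero] at this
        exact le_antisymm this (hf.1 x)
      have h1 := hf.integral_eq_one
      rw [this] at h1
      simp at h1
    · exact h
  · rcases le_total m x with h | h
    · have h1 := mul_one_sub_distFn_le hf hl h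
      rw [hm] at h1
      have h2 : f m * min (distFn f x) (1 - distFn f x) ≤ f m * (1 - distFn f x) :=
        mul_le_mul_of_nonneg_left (min_le_right _ _) (hf.1 m)
      nlinarith [hf.1 x]
    · have h1 := mul_distFn_le hf hl h
      rw [hm] at h1
      have h2 : f m * min (distFn f x) (1 - distFn f x) ≤ f m * distFn f x :=
        mul_le_mul_of_nonneg_left (min_le_left _ _) (hf.1 m)
      nlinarith [hf.1 x]

theorem map_distFn (hf : IsDensity f) :
    (densMeas f).map (distFn f) = volume.restrict (Icc 0 1) := by
  have := hf.isProbabilityMeasure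
  have hm := (distFn_continuous hf).measurable
  have : IsProbabilityMeasure ((densMeas f).map (distFn f)) :=
    Measure.isProbabilityMeasure_map hm.aemeasurable
  refine Measure.ext_of_Iic _ _ fun a => ?_
  rw [Measure.map_apply hm measurableSet_Iic, Measure.restrict_apply measurableSet_Iic]
  rcases lt_or_ge a 0 with h | h
  · have e1 : distFn f ⁻¹' Iic a = ∅ := by
      ext x; simp only [mem_preimage, mem_Iic, mem_empty_iff_false, iff_false, not_le]
      exact h.trans_le (distFn_nonneg hf x)
    have e2 : Iic a ∩ Icc 0 1 = ∅ := by
      ext x; simp only [mem_inter_iff, mem_Iic, mem_Icc, mem_empty_iff_false, iff_false]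
      intro h'; linarith [h'.1, h'.2.1]
    simp [e1, e2]
  rcases le_or_gt a 1 with h1 | h1
  · have e2 : Iic a ∩ Icc 0 1 = Icc 0 a := by
      ext x; simp only [mem_inter_iff, mem_Iic, mem_Icc]
      constructor
      · intro h'; exact ⟨h'.2.1, h'.1⟩
      · intro h'; exact ⟨h'.2, h'.1, h'.2.trans h1⟩
    rw [e2, Real.volume_Icc, sub_zero, ← ofReal_measureReal (measure_ne_top _ _),
      real_densMeas_distFn_le hf ⟨h, h1⟩]
  · have e1 : distFn f ⁻¹' Iic a = univ := by
      ext x; simp only [mem_preimage, mem_Iic, mem_univ, iff_true]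
      exact (distFn_le_one hf x).trans h1.le
    have e2 : Iic a ∩ Icc 0 1 = Icc 0 1 := by
      rw [inter_eq_right]; intro x hx; exact hx.2.trans h1.le
    simp [e1, e2]

/-- The edge weight `F ^ (-1/2) + (1 - F) ^ (-1/2)`. -/
def edgeWeight (f : ℝ → ℝ) (x : ℝ) : ℝ :=
  distFn f x ^ (-(1 / 2) : ℝ) + (1 - distFn f x) ^ (-(1 / 2) : ℝ)

theorem edgeWeight_nonneg (hf : IsDensity f) (x : ℝ) : 0 ≤ edgeWeight f x :=
  add_nonneg (Real.rpow_nonneg (distFn_nonneg hf x) _)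
    (Real.rpow_nonneg (by linarith [distFn_le_one hf x]) _)

theorem edgeWeight_integral (hf : IsDensity f) :
    Integrable (edgeWeight f) (densMeas f) ∧ ∫ x, edgeWeight f x ∂(densMeas f) = 4 := by
  have hm := (distFn_continuous hf).measurable
  set g : ℝ → ℝ := fun u => u ^ (-(1 / 2) : ℝ) + (1 - u) ^ (-(1 / 2) : ℝ) with hg
  have hgm : Measurable g := by fun_prop
  have i1 : IntervalIntegrable (fun u : ℝ => u ^ (-(1 / 2) : ℝ)) volume 0 1 :=
    intervalIntegral.intervalIntegrable_rpow' (by norm_num)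
  have i2 : IntervalIntegrable (fun u : ℝ => (1 - u) ^ (-(1 / 2) : ℝ)) volume 0 1 := by
    have := (i1.comp_sub_left 1).symm
    simpa using this
  have gi : IntervalIntegrable g volume 0 1 := i1.add i2
  have e0 : (fun x => edgeWeight f x) = g ∘ distFn f := rfl
  constructor
  · change Integrable (g ∘ distFn f) (densMeas f)
    rw [← integrable_map_measure hgm.aestronglyMeasurable hm.aemeasurable, map_distFn hf]
    rw [intervalIntegrable_iff_integrableOn_Icc_of_le zero_le_one] at gi
    exact gi
  · have : ∫ x, g (distFn f x) ∂(densMeas f) = ∫ u in (0:ℝ)..1, g u := by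
      rw [← integral_map hm.aemeasurable hgm.aestronglyMeasurable, map_distFn hf,
        intervalIntegral.integral_of_le zero_le_one, integral_Icc_eq_integral_Ioc]
    change ∫ x, g (distFn f x) ∂(densMeas f) = 4
    rw [this, hg, intervalIntegral.integral_add i1 i2,
      intervalIntegral.integral_comp_sub_left (fun u : ℝ => u ^ (-(1 / 2) : ℝ)) 1]
    simp only [sub_self, sub_zero]
    rw [integral_rpow (Or.inl (by norm_num))]
    norm_num

/-- The interaction kernel `(S |x - y|) ^ (-1/2)`. -/
def pairKer (S x y : ℝ) : ℝ := (S * |x - y|) ^ (-(1 / 2) : ℝ)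

theorem pairKer_nonneg {S : ℝ} (hS : 0 < S) (x y : ℝ) : 0 ≤ pairKer S x y :=
  Real.rpow_nonneg (by positivity) _

theorem measurable_pairKer (S : ℝ) : Measurable fun p : ℝ × ℝ => pairKer S p.1 p.2 := by
  unfold pairKer; fun_prop

theorem lintegral_pairKer_le (hf : IsDensity f) {S : ℝ} (hS : 0 < S) (h2 : ∀ x, f x ≤ 2 * S)
    (x : ℝ) : ∫⁻ y, ENNReal.ofReal (pairKer S x y) ∂(densMeas f) ≤ 9 := by
  have := hf.isProbabilityMeasure
  set r := S⁻¹ with hr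
  have hr0 : 0 < r := inv_pos.2 hS
  have hsplit : ∀ y, ENNReal.ofReal (f y) * ENNReal.ofReal (pairKer S x y) ≤
      ENNReal.ofReal (f y) + (Icc (x - r) (x + r)).indicator
        (fun y => ENNReal.ofReal (2 * S * pairKer S x y)) y := by
    intro y
    by_cases hy : y ∈ Icc (x - r) (x + r)
    · rw [indicator_of_mem hy, ← ENNReal.ofReal_mul (hf.1 y)]
      refine le_add_left (ENNReal.ofReal_le_ofReal ?_)
      exact mul_le_mul_of_nonneg_right (h2 y) (pairKer_nonneg hS _ _)
    · rw [indicator_of_notMem hy, add_zero]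
      have : pairKer S x y ≤ 1 := by
        refine Real.rpow_le_one_of_one_le_of_nonpos ?_ (by norm_num)
        have : r ≤ |x - y| := by
          by_contra hlt
          rw [not_le, abs_lt] at hlt
          exact hy ⟨by linarith [hlt.2], by linarith [hlt.1]⟩
        calc 1 = S * r := by rw [hr]; field_simp
          _ ≤ _ := by gcongr
      calc _ ≤ ENNReal.ofReal (f y) * 1 := by
            gcongr; exact ENNReal.ofReal_le_one.2 this
        _ = _ := mul_one _
  have hmeas : Measurable fun y => ENNReal.ofReal (pairKer S x y) :=
    ((measurable_pairKer S).comp (measurable_const.prodMk measurable_id)).ennreal_ofReal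
  rw [densMeas, lintegral_withDensity_eq_lintegral_mul _ hf.2.1.ennreal_ofReal hmeas]
  refine (lintegral_mono hsplit).trans ?_
  rw [lintegral_add_left hf.2.1.ennreal_ofReal, hf.2.2, lintegral_indicator measurableSet_Icc]
  have key : ∫⁻ y in Icc (x - r) (x + r), ENNReal.ofReal (2 * S * pairKer S x y) ≤ 8 := by
    have hI : IntervalIntegrable (fun u : ℝ => |u| ^ (-(1 / 2) : ℝ)) volume 0 r := by
      refine (intervalIntegral.intervalIntegrable_rpow' (r := -(1/2)) (by norm_num)).congr ?_
      rw [uIoc_of_le hr0.le]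
      intro u hu
      simp only [abs_of_pos hu.1]
    have hI' : IntervalIntegrable (fun u : ℝ => |u| ^ (-(1 / 2) : ℝ)) volume (-r) 0 := by
      have := (hI.comp_sub_left 0).symm
      simpa using this
    have hII := hI'.trans hI
    have v1 : ∫ u in (0:ℝ)..r, |u| ^ (-(1 / 2) : ℝ) = 2 * r ^ (1 / 2 : ℝ) := by
      have : ∫ u in (0:ℝ)..r, |u| ^ (-(1 / 2) : ℝ) = ∫ u in (0:ℝ)..r, u ^ (-(1 / 2) : ℝ) := by
        refine intervalIntegral.integral_congr fun u hu => ?_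
        rw [uIcc_of_le hr0.le] at hu
        simp only [abs_of_nonneg hu.1]
      rw [this, integral_rpow (Or.inl (by norm_num))]
      norm_num
      ring
    have v2 : ∫ u in (-r)..0, |u| ^ (-(1 / 2) : ℝ) = 2 * r ^ (1 / 2 : ℝ) := by
      rw [← v1]
      have := intervalIntegral.integral_comp_neg (a := 0) (b := r)
        (fun u : ℝ => |u| ^ (-(1 / 2) : ℝ))
      simpa using this.symm
    have v : ∫ u in (-r)..r, |u| ^ (-(1 / 2) : ℝ) = 4 * r ^ (1 / 2 : ℝ) := by
      rw [← intervalIntegral.integral_add_adjacent_intervals hI' hI, v1, v2]; ring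
    have e1 : ∀ y, 2 * S * pairKer S x y =
        2 * S * S ^ (-(1 / 2) : ℝ) * |x - y| ^ (-(1 / 2) : ℝ) := by
      intro y; rw [pairKer, Real.mul_rpow hS.le (abs_nonneg _)]; ring
    have hJ : IntervalIntegrable (fun y => 2 * S * pairKer S x y) volume (x - r) (x + r) := by
      simp only [e1]
      apply IntervalIntegrable.const_mul
      have := (hII.comp_sub_left x).symm
      simpa using this
    rw [← ofReal_integral_eq_lintegral_ofReal]
    · rw [integral_Icc_eq_integral_Ioc, ← intervalIntegral.integral_of_le (by linarith)]
      simp only [e1]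
      rw [intervalIntegral.integral_const_mul,
        intervalIntegral.integral_comp_sub_left (fun u : ℝ => |u| ^ (-(1 / 2) : ℝ)) x]
      rw [show x - (x + r) = -r by ring, show x - (x - r) = r by ring, v, hr, Real.inv_rpow hS.le,
        ← Real.rpow_neg hS.le]
      have : S * S ^ (-(1 / 2) : ℝ) * S ^ (-(1 / 2) : ℝ) = 1 := by
        nth_rewrite 1 [← Real.rpow_one S]
        rw [← Real.rpow_add hS, ← Real.rpow_add hS]
        norm_num
      rw [show 2 * S * S ^ (-(1 / 2) : ℝ) * (4 * S ^ (-(1 / 2) : ℝ)) =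
        8 * (S * S ^ (-(1 / 2) : ℝ) * S ^ (-(1 / 2) : ℝ)) by ring, this]
      norm_num
    · rw [intervalIntegrable_iff_integrableOn_Icc_of_le (by linarith)] at hJ
      exact hJ
    · exact ae_of_all _ fun y => mul_nonneg (by positivity) (pairKer_nonneg hS _ _)
  calc _ ≤ 1 + (8 : ℝ≥0∞) := by gcongr
    _ = 9 := by norm_num

end height

/-! ### Empirical measures -/

section empirical

variable {n : ℕ}

/-- The empirical measure of a sample. -/
def empMeas (xs : Fin n → ℝ) : Measure ℝ :=
  ENNReal.ofReal ((n : ℝ)⁻¹) • ∑ i, Measure.dirac (xs i)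

/-- The centred empirical process. -/
def empDev (P : Measure ℝ) (A : Set ℝ) (xs : Fin n → ℝ) : ℝ := (empMeas xs).real A - P.real A

theorem integral_empMeas (xs : Fin n → ℝ) (g : ℝ → ℝ) :
    ∫ x, g x ∂(empMeas xs) = (n : ℝ)⁻¹ * ∑ i, g (xs i) := by
  rw [empMeas, integral_smul_measure, integral_finsetSum_measure]
  · simp [integral_dirac]
  · intro i _
    exact integrable_dirac (by simp)

theorem integrable_empMeas (xs : Fin n → ℝ) (g : ℝ → ℝ) : Integrable g (empMeas xs) := by
  refine Integrable.smul_measure ?_ ENNReal.ofReal_ne_top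
  exact integrable_finsetSum_measure.2 fun i _ => integrable_dirac (by simp)

theorem real_empMeas (xs : Fin n → ℝ) (A : Set ℝ) :
    (empMeas xs).real A = (n : ℝ)⁻¹ * ∑ i, A.indicator (1 : ℝ → ℝ) (xs i) := by
  have : ∀ i, (Measure.dirac (xs i)) A = ENNReal.ofReal (A.indicator (1 : ℝ → ℝ) (xs i)) := by
    intro i
    rw [Measure.dirac_apply]
    by_cases h : xs i ∈ A <;> simp [h]
  rw [empMeas, Measure.real, Measure.smul_apply, Measure.finsetSum_apply]
  simp only [this]
  rw [← ENNReal.ofReal_sum_of_nonneg (fun i _ => indicator_nonneg (by simp) _), smul_eq_mul,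
    ENNReal.toReal_mul, ENNReal.toReal_ofReal (by positivity),
    ENNReal.toReal_ofReal (Finset.sum_nonneg fun i _ => indicator_nonneg (by simp) _)]

theorem isProbabilityMeasure_empMeas (hn : 0 < n) (xs : Fin n → ℝ) :
    IsProbabilityMeasure (empMeas xs) := by
  constructor
  rw [empMeas, Measure.smul_apply, Measure.finsetSum_apply]
  have : (0 : ℝ) < n := by exact_mod_cast hn
  simp [ENNReal.ofReal_inv_of_pos this, ENNReal.inv_mul_cancel, hn.ne']

theorem setIntegral_empMeas (xs : Fin n → ℝ) (g : ℝ → ℝ) {A : Set ℝ} (hA : MeasurableSet A) :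
    ∫ x in A, g x ∂(empMeas xs) = (n : ℝ)⁻¹ * ∑ i, A.indicator g (xs i) := by
  rw [← integral_indicator hA, integral_empMeas]

theorem measurable_empDev {P : Measure ℝ} {A : Set ℝ} (hA : MeasurableSet A) :
    Measurable (empDev (n := n) P A) := by
  unfold empDev
  simp only [real_empMeas]
  have : ∀ i : Fin n, Measurable fun xs : Fin n → ℝ => A.indicator (1 : ℝ → ℝ) (xs i) := fun i =>
    (measurable_one.indicator hA).comp (measurable_pi_apply i)
  fun_prop

variable {P : Measure ℝ} [IsProbabilityMeasure P]

theorem abs_empDev_le_one (hn : 0 < n) (A : Set ℝ) (xs : Fin n → ℝ) : |empDev P A xs| ≤ 1 := by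
  have := isProbabilityMeasure_empMeas hn xs
  have h1 : (empMeas xs).real A ≤ 1 := measureReal_le_one
  have h2 : P.real A ≤ 1 := measureReal_le_one
  have h3 : 0 ≤ (empMeas xs).real A := measureReal_nonneg
  have h4 : 0 ≤ P.real A := measureReal_nonneg
  rw [empDev, abs_le]; constructor <;> linarith

theorem integrable_empDev_pow (hn : 0 < n) {A : Set ℝ} (hA : MeasurableSet A) (k : ℕ) :
    Integrable (fun xs => empDev P A xs ^ k) (Measure.pi fun _ : Fin n => P) := by
  refine Integrable.of_bound ((measurable_empDev hA).pow_const k).aestronglyMeasurable 1 ?_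
  refine ae_of_all _ fun xs => ?_
  rw [norm_pow, Real.norm_eq_abs]
  exact pow_le_one₀ (abs_nonneg _) (abs_empDev_le_one hn A xs)

theorem integral_exp_empDev_le (hn : 0 < n) {A : Set ℝ} (hA : MeasurableSet A) {s : ℝ}
    (hs : |s| ≤ 1) :
    Integrable (fun xs => Real.exp (s * (n * empDev P A xs))) (Measure.pi fun _ : Fin n => P) ∧
    ∫ xs, Real.exp (s * (n * empDev P A xs)) ∂(Measure.pi fun _ : Fin n => P) ≤
      Real.exp (n * P.real A * s ^ 2) := by
  have hn' : (n : ℝ) ≠ 0 := by exact_mod_cast hn.ne'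
  set v := P.real A with hv
  have hv1 : v ≤ 1 := measureReal_le_one
  have hv0 : 0 ≤ v := measureReal_nonneg
  have e : ∀ xs : Fin n → ℝ, Real.exp (s * (n * empDev P A xs)) =
      ∏ i, Real.exp (s * (A.indicator (1 : ℝ → ℝ) (xs i) - v)) := by
    intro xs
    rw [← Real.exp_sum, empDev, real_empMeas, ← Finset.mul_sum, Finset.sum_sub_distrib]
    congr 2
    rw [mul_sub, ← mul_assoc, mul_inv_cancel₀ hn', one_mul]
    simp [hv]
  constructor
  · refine Integrable.of_bound (C := Real.exp n)
      (Real.measurable_exp.comp (((measurable_empDev hA).const_mul _).const_mul _)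
        ).aestronglyMeasurable (ae_of_all _ fun xs => ?_)
    rw [Real.norm_eq_abs, abs_of_pos (Real.exp_pos _)]
    refine Real.exp_le_exp.2 ((le_abs_self _).trans ?_)
    rw [abs_mul, abs_mul, Nat.abs_cast]
    have := abs_empDev_le_one (P := P) hn A xs
    calc |s| * (n * |empDev P A xs|) ≤ 1 * (n * 1) := by gcongr
      _ = n := by ring
  · simp only [e]
    rw [integral_fintype_prod_eq_pow (ι := Fin n)
      (fun x : ℝ => Real.exp (s * (A.indicator (1 : ℝ → ℝ) x - v)))]
    have hInt : ∫ x, Real.exp (s * (A.indicator (1 : ℝ → ℝ) x - v)) ∂P =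
        Real.exp (-(s * v)) * (1 + v * (Real.exp s - 1)) := by
      have : ∀ x, Real.exp (s * (A.indicator (1 : ℝ → ℝ) x - v)) =
          Real.exp (-(s * v)) * (1 + A.indicator (1 : ℝ → ℝ) x * (Real.exp s - 1)) := by
        intro x
        by_cases h : x ∈ A
        · simp only [h, indicator_of_mem, Pi.one_apply]
          rw [one_mul, add_sub_cancel, ← Real.exp_add]; congr 1; ring
        · simp [h]
      simp only [this]
      have hi : Integrable (A.indicator (1 : ℝ → ℝ)) P := (integrable_const (1 : ℝ)).indicator hA
      rw [integral_const_mul, integral_add (integrable_const _) (hi.mul_const _),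
        integral_mul_const]
      simp only [integral_const, probReal_univ, smul_eq_mul, mul_one]
      rw [integral_indicator_one hA]
    rw [hInt, show Real.exp (n * v * s ^ 2) = Real.exp (v * s ^ 2) ^ (Fintype.card (Fin n)) by
      rw [← Real.exp_nat_mul]; simp; ring]
    have h1 : Real.exp s - 1 - s ≤ s ^ 2 :=
      (le_abs_self _).trans (Real.abs_exp_sub_one_sub_id_le hs)
    have h2 : 0 ≤ 1 + v * (Real.exp s - 1) := by nlinarith [Real.exp_pos s]
    refine pow_le_pow_left₀ (mul_nonneg (Real.exp_pos _).le h2) ?_ _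
    calc _ ≤ Real.exp (-(s * v)) * Real.exp (v * (Real.exp s - 1)) := by
          gcongr
          linarith [Real.add_one_le_exp (v * (Real.exp s - 1))]
      _ = Real.exp (v * (Real.exp s - 1 - s)) := by rw [← Real.exp_add]; congr 1; ring
      _ ≤ _ := by gcongr

theorem integral_empDev_pow_four_le (hn : 0 < n) {A : Set ℝ} (hA : MeasurableSet A) {v : ℝ}
    (hv : P.real A ≤ v) (hnv : 1 / 64 ≤ n * v) :
    ∫ xs, empDev P A xs ^ 4 ∂(Measure.pi fun _ : Fin n => P) ≤ 589824 * v ^ 2 / n ^ 2 := by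
  have hn' : (0 : ℝ) < n := by exact_mod_cast hn
  have hv0 : 0 < v := by
    by_contra h
    nlinarith
  set s : ℝ := 1 / √(64 * (n * v)) with hs
  have hpos : 0 < 64 * ((n : ℝ) * v) := by positivity
  have hs2 : s ^ 2 = 1 / (64 * (n * v)) := by rw [hs, div_pow, Real.sq_sqrt hpos.le]; simp
  have hs0 : 0 < s := by positivity
  have hs1 : s ≤ 1 := by
    rw [hs, div_le_one (by positivity), Real.one_le_sqrt]; linarith
  obtain ⟨i1, b1⟩ := integral_exp_empDev_le (P := P) hn hA (s := s) (by rwa [abs_of_pos hs0])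
  obtain ⟨i2, b2⟩ := integral_exp_empDev_le (P := P) hn hA (s := -s)
    (by rwa [abs_neg, abs_of_pos hs0])
  have hb : Real.exp (n * P.real A * s ^ 2) ≤ 3 := by
    have : n * P.real A * s ^ 2 ≤ 1 := by
      rw [hs2, mul_one_div, div_le_one hpos]
      have : n * P.real A ≤ n * v := by gcongr
      linarith [mul_pos hn' hv0]
    exact (Real.exp_le_exp.2 this).trans (by linarith [Real.exp_one_lt_d9])
  have hx4 : ∀ x : ℝ, x ^ 4 ≤ 24 * (Real.exp x + Real.exp (-x)) := by
    have h0 : ∀ x : ℝ, 0 ≤ x → x ^ 4 ≤ 24 * (Real.exp x + Real.exp (-x)) := by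
      intro x hx
      have := Real.pow_div_factorial_le_exp x hx 4
      have h4 : ((Nat.factorial 4 : ℕ) : ℝ) = 24 := by norm_num [Nat.factorial]
      rw [h4, div_le_iff₀ (by norm_num)] at this
      linarith [Real.exp_pos (-x)]
    intro x
    rcases le_total 0 x with h | h
    · exact h0 x h
    · have := h0 (-x) (by linarith)
      rw [neg_neg] at this
      calc x ^ 4 = (-x) ^ 4 := by ring
        _ ≤ _ := this
        _ = _ := by ring
  have key : (s * n) ^ 4 * ∫ xs, empDev P A xs ^ 4 ∂(Measure.pi fun _ : Fin n => P) ≤ 144 := by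
    rw [← integral_const_mul]
    calc _ ≤ ∫ xs, 24 * (Real.exp (s * (n * empDev P A xs)) +
          Real.exp (-s * (n * empDev P A xs))) ∂(Measure.pi fun _ : Fin n => P) := by
          refine integral_mono ((integrable_empDev_pow hn hA 4).const_mul _)
            ((i1.add i2).const_mul _) fun xs => ?_
          have := hx4 (s * (n * empDev P A xs))
          rw [neg_mul]
          calc _ = (s * (n * empDev P A xs)) ^ 4 := by ring
            _ ≤ _ := this
      _ ≤ 24 * (3 + 3) := by
          rw [integral_const_mul, integral_add i1 i2]
          rw [neg_sq] at b2
          gcongr <;> linarith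
      _ = 144 := by norm_num
  have e4 : (s * n) ^ 4 = n ^ 2 / (4096 * v ^ 2) := by
    rw [mul_pow, show s ^ 4 = (s ^ 2) ^ 2 by ring, hs2]; field_simp; norm_num
  rw [e4, div_mul_eq_mul_div, div_le_iff₀ (by positivity)] at key
  rw [le_div_iff₀ (by positivity)]
  linarith

end empirical

section layercake

theorem setIntegral_eq_layers {μ : Measure ℝ} [IsFiniteMeasure μ] {J : Set ℝ}
    (hJ : MeasurableSet J) {g : ℝ → ℝ} (hg : Measurable g) {a b : ℝ}
    (hab : ∀ x ∈ J, g x ∈ Icc a b) :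
    IntegrableOn (fun t => μ.real {x | x ∈ J ∧ a + t < g x}) (Ioc 0 (b - a)) ∧
    ∫ x in J, g x ∂μ = a * μ.real J +
      ∫ t in Ioc 0 (b - a), μ.real {x | x ∈ J ∧ a + t < g x} := by
  have hms : ∀ t, MeasurableSet {x | a + t < g x} := fun t => measurableSet_lt measurable_const hg
  have hInt : ∀ t : ℝ, Integrable (fun _ : ℝ => t) (μ.restrict J) := fun t => integrable_const _
  have hgi : Integrable g (μ.restrict J) := by
    refine Integrable.of_bound hg.aestronglyMeasurable (max |a| |b|) ?_
    refine (ae_restrict_iff' hJ).2 (ae_of_all _ fun x hx => ?_)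
    exact abs_le_max_abs_abs (hab x hx).1 (hab x hx).2
  have hfi : Integrable (fun x => g x - a) (μ.restrict J) := hgi.sub (hInt a)
  have hnn : 0 ≤ᵐ[μ.restrict J] fun x => g x - a :=
    (ae_restrict_iff' hJ).2 (ae_of_all _ fun x hx => sub_nonneg.2 (hab x hx).1)
  have key := Integrable.integral_eq_integral_meas_lt hfi hnn
  have e : ∀ t, (μ.restrict J).real {x | t < g x - a} = μ.real {x | x ∈ J ∧ a + t < g x} := by
    intro t
    have : {x | t < g x - a} = {x | a + t < g x} := by
      ext x; simp only [mem_ofPred_eq]; constructor <;> intro h <;> linarith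
    rw [this, measureReal_restrict_apply (hms t)]
    congr 1; ext x; simp [and_comm]
  have hanti : Antitone fun t => μ.real {x | x ∈ J ∧ a + t < g x} := fun s t hst =>
    measureReal_mono fun x hx => ⟨hx.1, by linarith [hx.2]⟩
  constructor
  · exact (hanti.locallyIntegrable.integrableOn_isCompact isCompact_Icc).mono_set
      Ioc_subset_Icc_self
  · rw [integral_sub hgi (hInt a)] at key
    simp only [e, integral_const, smul_eq_mul, measureReal_restrict_apply_univ] at key
    rw [← sub_eq_iff_eq_add', mul_comm a, key]
    refine setIntegral_eq_of_subset_of_forall_sdiff_eq_zero (μ := volume) measurableSet_Ioi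
      Ioc_subset_Ioi_self fun t ht => ?_
    have : {x | x ∈ J ∧ a + t < g x} = ∅ := by
      ext x
      simp only [mem_ofPred_eq, mem_empty_iff_false, iff_false, not_and, not_lt]
      intro hx
      have h2 : b - a < t := by
        by_contra h
        exact ht.2 ⟨ht.1, not_lt.1 h⟩
      linarith [(hab x hx).2]
    rw [this]; simp

theorem abs_setIntegral_sub_le {μ ν : Measure ℝ} [IsFiniteMeasure μ] [IsFiniteMeasure ν]
    {J : Set ℝ} (hJ : J.OrdConnected) {g : ℝ → ℝ} (hg : Measurable g) {a b : ℝ} (h0 : a ≤ b)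
    (hab : ∀ x ∈ J, g x ∈ Icc a b)
    (hq : ∀ x ∈ J, ∀ y ∈ J, ∀ z, x ≤ z → z ≤ y → min (g x) (g y) ≤ g z) {κ : ℝ}
    (hκ : ∀ V : Set ℝ, V.OrdConnected → V ⊆ J → |μ.real V - ν.real V| ≤ κ) :
    |∫ x in J, g x ∂μ - ∫ x in J, g x ∂ν| ≤ (|a| + (b - a)) * κ := by
  obtain ⟨i1, e1⟩ := setIntegral_eq_layers (μ := μ) hJ.measurableSet hg hab
  obtain ⟨i2, e2⟩ := setIntegral_eq_layers (μ := ν) hJ.measurableSet hg hab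
  have hlay : ∀ t, ({x | x ∈ J ∧ a + t < g x} : Set ℝ).OrdConnected := by
    refine fun t => ⟨fun x hx y hy z hz => ⟨hJ.out hx.1 hy.1 hz, ?_⟩⟩
    exact (lt_min hx.2 hy.2).trans_le (hq x hx.1 y hy.1 z hz.1 hz.2)
  rw [e1, e2, show ∀ A B C D : ℝ, a * A + B - (a * C + D) = a * (A - C) + (B - D) by intros; ring,
    ← integral_sub i1 i2, add_mul]
  refine (abs_add_le _ _).trans (add_le_add ?_ ?_)
  · rw [abs_mul]
    exact mul_le_mul_of_nonneg_left (hκ J hJ Subset.rfl) (abs_nonneg _)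
  · have := norm_setIntegral_le_of_norm_le_const (μ := volume) (s := Ioc 0 (b - a)) (C := κ)
      (f := fun t => μ.real {x | x ∈ J ∧ a + t < g x} - ν.real {x | x ∈ J ∧ a + t < g x})
      (by simp) (fun t _ => by
        rw [Real.norm_eq_abs]; exact hκ _ (hlay t) fun x hx => hx.1)
    rw [Real.norm_eq_abs, Real.volume_real_Ioc, max_eq_left (by linarith)] at this
    linarith

end layercake

/-! ### Dyadic quantile cells and chaining -/

/-- The quantile cell `F⁻¹ (j / 2 ^ l, (j + 1) / 2 ^ l]`. -/
def cell (F : ℝ → ℝ) (l : ℕ) (j : ℤ) : Set ℝ :=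
  F ⁻¹' Ioc ((j : ℝ) / 2 ^ l) (((j : ℝ) + 1) / 2 ^ l)

theorem mem_cell {F : ℝ → ℝ} {l : ℕ} {j : ℤ} {x : ℝ} :
    x ∈ cell F l j ↔ (j : ℝ) < F x * 2 ^ l ∧ F x * 2 ^ l ≤ j + 1 := by
  have : (0 : ℝ) < 2 ^ l := by positivity
  rw [cell, mem_preimage, mem_Ioc, div_lt_iff₀ this, le_div_iff₀ this]

theorem cell_ordConnected {F : ℝ → ℝ} (hF : Monotone F) (l : ℕ) (j : ℤ) :
    (cell F l j).OrdConnected := by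
  refine ⟨fun x hx y hy z hz => ⟨hx.1.trans_le (hF hz.1), (hF hz.2).trans hy.2⟩⟩

theorem cell_lt {F : ℝ → ℝ} (hF : Monotone F) {l : ℕ} {i j : ℤ} (hij : i < j) {x y : ℝ}
    (hx : x ∈ cell F l i) (hy : y ∈ cell F l j) : x < y := by
  rw [mem_cell] at hx hy
  by_contra h
  have h1 := hF (not_lt.1 h)
  have h2 : (i : ℝ) + 1 ≤ j := by exact_mod_cast hij
  have h3 : F y * 2 ^ l ≤ F x * 2 ^ l := by gcongr
  linarith [hx.2, hy.1]

theorem cell_disjoint {F : ℝ → ℝ} (hF : Monotone F) {l : ℕ} {i j : ℤ} (hij : i ≠ j) :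
    Disjoint (cell F l i) (cell F l j) := by
  rw [disjoint_left]
  intro x hx hx'
  rcases lt_or_gt_of_ne hij with h | h
  · exact lt_irrefl x (cell_lt hF h hx hx')
  · exact lt_irrefl x (cell_lt hF h hx' hx)

theorem mem_cell_succ {F : ℝ → ℝ} {l : ℕ} {j : ℤ} {x : ℝ} :
    x ∈ cell F l j ↔ x ∈ cell F (l + 1) (2 * j) ∨ x ∈ cell F (l + 1) (2 * j + 1) := by
  simp only [mem_cell, pow_succ]
  push_cast
  constructor
  · rintro ⟨h1, h2⟩
    rcases le_or_gt (F x * (2 ^ l * 2)) (2 * j + 1) with h | h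
    · exact Or.inl ⟨by linarith, h⟩
    · exact Or.inr ⟨h, by linarith⟩
  · rintro (⟨h1, h2⟩ | ⟨h1, h2⟩) <;> constructor <;> linarith

/-- A quartic bound for the empirical process over initial segments of a cell, obtained by
dyadic chaining through `d` generations. -/
def chainBound {n : ℕ} (P : Measure ℝ) (F : ℝ → ℝ) (xs : Fin n → ℝ) : ℕ → ℕ → ℤ → ℝ
  | 0, l, j => (|empDev P (cell F l j) xs| + 1 / 2 ^ l) ^ 4
  | d + 1, l, j => 1000 * empDev P (cell F (l + 1) (2 * j)) xs ^ 4 +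
      1000 / 729 * (chainBound P F xs d (l + 1) (2 * j) +
        chainBound P F xs d (l + 1) (2 * j + 1))

section chain

variable {n : ℕ} {P : Measure ℝ} [IsProbabilityMeasure P] {F : ℝ → ℝ}

theorem chainBound_nonneg (P : Measure ℝ) (F : ℝ → ℝ) (xs : Fin n → ℝ) (d l : ℕ) (j : ℤ) :
    0 ≤ chainBound P F xs d l j := by
  induction d generalizing l j with
  | zero => rw [chainBound]; positivity
  | succ d ih =>
    rw [chainBound]
    have := ih (l + 1) (2 * j)
    have := ih (l + 1) (2 * j + 1)
    positivity

theorem quartic_convex (x y : ℝ) : (x + y) ^ 4 ≤ 1000 * x ^ 4 + 1000 / 729 * y ^ 4 := by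
  have h2 : ∀ x y : ℝ, (x + y) ^ 2 ≤ 10 * x ^ 2 + 10 / 9 * y ^ 2 := by
    intro x y; nlinarith [sq_nonneg (9 * x - y)]
  have h3 : ∀ a b : ℝ, 0 ≤ a → 0 ≤ b →
      (10 * a + 10 / 9 * b) ^ 2 ≤ 1000 * a ^ 2 + 1000 / 729 * b ^ 2 := by
    intro a b _ _; nlinarith [sq_nonneg (9 * a - b / 9)]
  calc (x + y) ^ 4 = ((x + y) ^ 2) ^ 2 := by ring
    _ ≤ (10 * x ^ 2 + 10 / 9 * y ^ 2) ^ 2 := by gcongr; exact h2 x y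
    _ ≤ 1000 * (x ^ 2) ^ 2 + 1000 / 729 * (y ^ 2) ^ 2 := h3 _ _ (sq_nonneg _) (sq_nonneg _)
    _ = _ := by ring

theorem empDev_union {A B : Set ℝ} (hB : MeasurableSet B) (hd : Disjoint A B) (hn : 0 < n)
    (xs : Fin n → ℝ) : empDev P (A ∪ B) xs = empDev P A xs + empDev P B xs := by
  have := isProbabilityMeasure_empMeas hn xs
  rw [empDev, empDev, empDev, measureReal_union hd hB, measureReal_union hd hB]; ring

theorem empDev_initial_le (hn : 0 < n) (hF : Monotone F)
    (hP : ∀ l j, P.real (cell F l j) ≤ 1 / 2 ^ l) (xs : Fin n → ℝ) (d l : ℕ) (j : ℤ)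
    {A : Set ℝ} (hA : A ⊆ cell F l j)
    (hi : ∀ x ∈ A, ∀ y ∈ cell F l j, y ≤ x → y ∈ A) :
    empDev P A xs ^ 4 ≤ chainBound P F xs d l j := by
  have := isProbabilityMeasure_empMeas hn xs
  induction d generalizing l j A with
  | zero =>
    rw [chainBound, ← Even.pow_abs (by decide : Even 4)]
    refine pow_le_pow_left₀ (abs_nonneg _) ?_ 4
    have h1 : (empMeas xs).real A ≤ (empMeas xs).real (cell F l j) := measureReal_mono hA
    have h2 : P.real A ≤ P.real (cell F l j) := measureReal_mono hA
    have h3 := hP l j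
    have h4 : 0 ≤ (empMeas xs).real A := measureReal_nonneg
    have h5 : 0 ≤ P.real A := measureReal_nonneg
    have h6 := le_abs_self (empDev P (cell F l j) xs)
    have h7 := abs_nonneg (empDev P (cell F l j) xs)
    unfold empDev at *
    rw [abs_le]; constructor <;> linarith
  | succ d ih =>
    rw [chainBound]
    set E1 := cell F (l + 1) (2 * j) with hE1
    set E2 := cell F (l + 1) (2 * j + 1) with hE2
    have n1 := chainBound_nonneg P F xs d (l + 1) (2 * j)
    have n2 := chainBound_nonneg P F xs d (l + 1) (2 * j + 1)
    have s1 : E1 ⊆ cell F l j := fun x hx => mem_cell_succ.2 (Or.inl hx)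
    have s2 : E2 ⊆ cell F l j := fun x hx => mem_cell_succ.2 (Or.inr hx)
    by_cases hne : (A ∩ E2).Nonempty
    · obtain ⟨z, hzA, hz2⟩ := hne
      have e : A = E1 ∪ (A ∩ E2) := by
        ext x; constructor
        · intro hx
          rcases mem_cell_succ.1 (hA hx) with h | h
          · exact Or.inl h
          · exact Or.inr ⟨hx, h⟩
        · rintro (h | h)
          · exact hi z hzA x (s1 h) (cell_lt hF (by omega) h hz2).le
          · exact h.1
      have hOC : (A ∩ E2).OrdConnected := by
        refine ⟨fun x hx y hy z hz => ?_⟩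
        have hzE : z ∈ E2 := (cell_ordConnected hF _ _).out hx.2 hy.2 hz
        exact ⟨hi y hy.1 z (s2 hzE) hz.2, hzE⟩
      have hd : Disjoint E1 (A ∩ E2) :=
        (cell_disjoint hF (by omega)).mono_right inter_subset_right
      have h2 := ih (l + 1) (2 * j + 1) (A := A ∩ E2) inter_subset_right
        (fun x hx y hy hyx => ⟨hi x hx.1 y (s2 hy) hyx, hy⟩)
      rw [e, empDev_union hOC.measurableSet hd hn]
      refine (quartic_convex _ _).trans ?_
      linarith
    · have hA1 : A ⊆ E1 := by
        intro x hx
        rcases mem_cell_succ.1 (hA hx) with h | h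
        · exact h
        · exact absurd ⟨x, hx, h⟩ hne
      have h1 := ih (l + 1) (2 * j) hA1 (fun x hx y hy hyx => hi x hx y (s1 hy) hyx)
      have : 0 ≤ empDev P E1 xs ^ 4 := by positivity
      linarith

theorem empDev_ordConnected_le (hn : 0 < n) (hF : Monotone F)
    (hP : ∀ l j, P.real (cell F l j) ≤ 1 / 2 ^ l) (xs : Fin n → ℝ) (d l : ℕ) (j : ℤ)
    {V : Set ℝ} (hV : V ⊆ cell F l j) (hoc : V.OrdConnected) :
    empDev P V xs ^ 4 ≤ 16 * chainBound P F xs d l j := by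
  set A : Set ℝ := {x | x ∈ cell F l j ∧ ∀ v ∈ V, x < v} with hAdef
  have hd : Disjoint A V := by
    rw [disjoint_left]
    intro x hx hxV
    exact lt_irrefl x (hx.2 x hxV)
  have e := empDev_union (P := P) hoc.measurableSet hd hn xs
  have h1 := empDev_initial_le (A := A) hn hF hP xs d l j (fun x hx => hx.1)
    (fun x hx y hy hyx => ⟨hy, fun v hv => hyx.trans_lt (hx.2 v hv)⟩)
  have h2 := empDev_initial_le (A := A ∪ V) hn hF hP xs d l j
    (union_subset (fun x hx => hx.1) hV) (by
      rintro x (hx | hx) y hy hyx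
      · exact Or.inl ⟨hy, fun v hv => hyx.trans_lt (hx.2 v hv)⟩
      · by_cases hyV : y ∈ V
        · exact Or.inr hyV
        · refine Or.inl ⟨hy, fun v hv => ?_⟩
          by_contra h
          exact hyV (hoc.out hv hx ⟨not_lt.1 h, hyx⟩))
  have e2 : empDev P V xs = empDev P (A ∪ V) xs - empDev P A xs := by linarith
  rw [e2]
  have : ∀ a b : ℝ, (a - b) ^ 4 ≤ 8 * (a ^ 4 + b ^ 4) := by
    intro a b
    have h1 : (a - b) ^ 2 ≤ 2 * (a ^ 2 + b ^ 2) := by nlinarith [sq_nonneg (a + b)]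
    calc (a - b) ^ 4 = ((a - b) ^ 2) ^ 2 := by ring
      _ ≤ (2 * (a ^ 2 + b ^ 2)) ^ 2 := by gcongr
      _ ≤ _ := by nlinarith [sq_nonneg (a ^ 2 - b ^ 2)]
  refine (this _ _).trans ?_
  linarith

theorem measurableSet_cell (hF : Monotone F) (l : ℕ) (j : ℤ) : MeasurableSet (cell F l j) :=
  (cell_ordConnected hF l j).measurableSet

theorem chainBound_integral_le (hn : 0 < n) (hF : Monotone F)
    (hP : ∀ l j, P.real (cell F l j) ≤ 1 / 2 ^ l) (d l : ℕ) (j : ℤ)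
    (h1 : (2 : ℝ) ^ (l + d) ≤ 64 * n) (h2 : (n : ℝ) ≤ 2 ^ (l + d)) :
    Integrable (fun xs => chainBound P F xs d l j) (Measure.pi fun _ : Fin n => P) ∧
    ∫ xs, chainBound P F xs d l j ∂(Measure.pi fun _ : Fin n => P) ≤
      471859200 * (1 / 2 ^ l) ^ 2 / n ^ 2 := by
  have hn' : (0 : ℝ) < n := by exact_mod_cast hn
  have hq : ∀ l j, (2 : ℝ) ^ l ≤ 64 * n →
      ∫ xs, empDev P (cell F l j) xs ^ 4 ∂(Measure.pi fun _ : Fin n => P) ≤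
        589824 * (1 / 2 ^ l) ^ 2 / n ^ 2 := by
    intro l j hl
    refine integral_empDev_pow_four_le hn (measurableSet_cell hF l j) (hP l j) ?_
    rw [mul_one_div, div_le_div_iff₀ (by norm_num) (by positivity)]
    linarith
  have hi : ∀ l j, Integrable (fun xs => empDev P (cell F l j) xs ^ 4)
      (Measure.pi fun _ : Fin n => P) :=
    fun l j => integrable_empDev_pow hn (measurableSet_cell hF l j) 4
  induction d generalizing l j with
  | zero =>
    simp only [chainBound, add_zero] at *
    have hb : ∀ xs : Fin n → ℝ, (|empDev P (cell F l j) xs| + 1 / 2 ^ l) ^ 4 ≤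
        8 * (empDev P (cell F l j) xs ^ 4 + (1 / 2 ^ l) ^ 4) := by
      intro xs
      rw [← Even.pow_abs (by decide : Even 4) (empDev P (cell F l j) xs)]
      generalize |empDev P (cell F l j) xs| = a
      generalize (1 : ℝ) / 2 ^ l = b
      have h1 : (a + b) ^ 2 ≤ 2 * (a ^ 2 + b ^ 2) := by nlinarith [sq_nonneg (a - b)]
      calc (a + b) ^ 4 = ((a + b) ^ 2) ^ 2 := by ring
        _ ≤ (2 * (a ^ 2 + b ^ 2)) ^ 2 := by gcongr
        _ ≤ _ := by nlinarith [sq_nonneg (a ^ 2 - b ^ 2)]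
    have hbi : Integrable (fun xs => 8 * (empDev P (cell F l j) xs ^ 4 + (1 / 2 ^ l) ^ 4))
        (Measure.pi fun _ : Fin n => P) := ((hi l j).add (integrable_const _)).const_mul _
    have hInt : Integrable (fun xs => (|empDev P (cell F l j) xs| + 1 / 2 ^ l) ^ 4)
        (Measure.pi fun _ : Fin n => P) := by
      refine hbi.mono' ?_ (ae_of_all _ fun xs => ?_)
      · exact ((((measurable_empDev (measurableSet_cell hF l j)).abs).add_const _).pow_const
          4).aestronglyMeasurable
      · rw [Real.norm_eq_abs, abs_of_nonneg (by positivity)]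
        exact hb xs
    refine ⟨hInt, (integral_mono hInt hbi hb).trans ?_⟩
    rw [integral_const_mul, integral_add (hi l j) (integrable_const _)]
    simp only [integral_const, probReal_univ, smul_eq_mul, one_mul]
    have h3 := hq l j h1
    have h4 : ((1 : ℝ) / 2 ^ l) ^ 4 ≤ (1 / 2 ^ l) ^ 2 / n ^ 2 := by
      rw [show ((1 : ℝ) / 2 ^ l) ^ 4 = (1 / 2 ^ l) ^ 2 * (1 / 2 ^ l) ^ 2 by ring, div_eq_mul_inv _
        ((n : ℝ) ^ 2)]
      gcongr
      rw [div_pow, one_pow, one_div]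
      gcongr
    have h5 : 0 ≤ ((1 : ℝ) / 2 ^ l) ^ 2 / n ^ 2 := by positivity
    rw [mul_div_assoc] at h3 ⊢
    linarith
  | succ d ih =>
    have hl : (2 : ℝ) ^ (l + 1) ≤ 64 * n :=
      le_trans (pow_le_pow_right₀ (by norm_num) (by omega)) h1
    rw [show l + (d + 1) = l + 1 + d by ring] at h1 h2
    obtain ⟨i1, b1⟩ := ih (l + 1) (2 * j) h1 h2
    obtain ⟨i2, b2⟩ := ih (l + 1) (2 * j + 1) h1 h2
    have h3 := hq (l + 1) (2 * j) hl
    have i12 := (i1.add i2).const_mul (1000 / 729)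
    have i0 := (hi (l + 1) (2 * j)).const_mul 1000
    refine ⟨by simp only [chainBound]; exact i0.add i12, ?_⟩
    simp only [chainBound]
    rw [integral_add i0 (by exact i12), integral_const_mul, integral_const_mul, integral_add i1 i2]
    have e : ((1 : ℝ) / 2 ^ (l + 1)) ^ 2 / n ^ 2 = (1 / 4) * ((1 / 2 ^ l) ^ 2 / n ^ 2) := by
      field_simp; ring
    rw [mul_div_assoc, e] at b1 b2 h3
    rw [mul_div_assoc]
    have h5 : 0 ≤ ((1 : ℝ) / 2 ^ l) ^ 2 / n ^ 2 := by positivity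
    linarith

end chain

/-! ### Whitney decomposition away from finitely many break points -/

/-- The dyadic interval of index `j` at level `l` is admissible if it stays well away from all
break points, at its own scale. -/
def Adm (B : Finset ℝ) (l : ℕ) (j : ℤ) : Prop :=
  ∀ v ∈ B, v * 2 ^ l < j - 7 ∨ (j : ℝ) + 8 < v * 2 ^ l

/-- Index of the dyadic interval of level `l` containing `u`. -/
def dyIdx (l : ℕ) (u : ℝ) : ℤ := ⌈u * 2 ^ l⌉ - 1

/-- The maximal admissible dyadic intervals with levels between `l₀` and `L`. -/
def whitney (B : Finset ℝ) (l₀ L : ℕ) : Finset (ℕ × ℤ) :=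
  (Finset.Icc l₀ L ×ˢ Finset.Ico (0 : ℤ) (2 ^ L)).filter fun p =>
    p.2 < 2 ^ p.1 ∧ Adm B p.1 p.2 ∧ (p.1 = l₀ ∨ ¬ Adm B (p.1 - 1) (p.2 / 2))

theorem mem_cell_iff_dyIdx {F : ℝ → ℝ} {l : ℕ} {j : ℤ} {x : ℝ} :
    x ∈ cell F l j ↔ dyIdx l (F x) = j := by
  rw [mem_cell, dyIdx, sub_eq_iff_eq_add, Int.ceil_eq_iff]
  push_cast
  rw [add_sub_cancel_right]

theorem dyIdx_succ (l : ℕ) (u : ℝ) : dyIdx (l + 1) u / 2 = dyIdx l u := by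
  have h : u ∈ cell id l (dyIdx l u) := mem_cell_iff_dyIdx.2 rfl
  rcases mem_cell_succ.1 h with h | h <;> rw [mem_cell_iff_dyIdx] at h <;> simp only [id] at h <;>
    omega

theorem Adm.child {B : Finset ℝ} {l : ℕ} {j : ℤ} (h : Adm B l (j / 2)) : Adm B (l + 1) j := by
  intro v hv
  have h1 : (2 * ((j / 2 : ℤ) : ℝ)) ≤ j := by
    have : 2 * (j / 2) ≤ j := by omega
    exact_mod_cast this
  have h2 : (j : ℝ) ≤ 2 * ((j / 2 : ℤ) : ℝ) + 1 := by
    have : j ≤ 2 * (j / 2) + 1 := by omega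
    exact_mod_cast this
  rw [pow_succ]
  rcases h v hv with h | h
  · left; linarith
  · right; linarith

theorem adm_dyIdx_mono {B : Finset ℝ} {u : ℝ} {l m : ℕ} (hlm : l ≤ m)
    (h : Adm B l (dyIdx l u)) : Adm B m (dyIdx m u) := by
  induction m, hlm using Nat.le_induction with
  | base => exact h
  | succ m _ ih =>
    rw [← dyIdx_succ] at ih
    exact ih.child

theorem mem_whitney {B : Finset ℝ} {l₀ L : ℕ} {p : ℕ × ℤ} :
    p ∈ whitney B l₀ L ↔ l₀ ≤ p.1 ∧ p.1 ≤ L ∧ 0 ≤ p.2 ∧ p.2 < 2 ^ p.1 ∧ Adm B p.1 p.2 ∧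
      (p.1 = l₀ ∨ ¬ Adm B (p.1 - 1) (p.2 / 2)) := by
  simp only [whitney, Finset.mem_filter, Finset.mem_product, Finset.mem_Icc, Finset.mem_Ico]
  constructor
  · rintro ⟨⟨⟨h1, h2⟩, h3, _⟩, h5, h6, h7⟩
    exact ⟨h1, h2, h3, h5, h6, h7⟩
  · rintro ⟨h1, h2, h3, h5, h6, h7⟩
    exact ⟨⟨⟨h1, h2⟩, h3, h5.trans_le (pow_le_pow_right₀ (by norm_num) h2)⟩, h5, h6, h7⟩

theorem whitney_level_unique {B : Finset ℝ} {l₀ L : ℕ} {u : ℝ} {l m : ℕ}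
    (hl : (l, dyIdx l u) ∈ whitney B l₀ L) (hm : (m, dyIdx m u) ∈ whitney B l₀ L) : l = m := by
  have key : ∀ l m : ℕ, (l, dyIdx l u) ∈ whitney B l₀ L → (m, dyIdx m u) ∈ whitney B l₀ L →
      ¬ l < m := by
    intro l m hl hm hlt
    rw [mem_whitney] at hl hm
    rcases hm.2.2.2.2.2 with h | h
    · have := hl.1; simp only at h this; omega
    · apply h
      obtain ⟨m, rfl⟩ : ∃ k, m = k + 1 := ⟨m - 1, by omega⟩
      simp only [add_tsub_cancel_right, dyIdx_succ]
      exact adm_dyIdx_mono (by omega) hl.2.2.2.2.1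
  have := key l m hl hm
  have := key m l hm hl
  omega

theorem whitney_pairwiseDisjoint {B : Finset ℝ} {l₀ L : ℕ} (F : ℝ → ℝ) :
    (whitney B l₀ L : Set (ℕ × ℤ)).PairwiseDisjoint fun p => cell F p.1 p.2 := by
  intro p hp q hq hpq
  simp only [Function.onFun]
  rw [disjoint_left]
  intro x hx hx'
  rw [mem_cell_iff_dyIdx] at hx hx'
  apply hpq
  have h1 : p = (p.1, dyIdx p.1 (F x)) := by rw [hx]
  have h2 : q = (q.1, dyIdx q.1 (F x)) := by rw [hx']
  have h3 : p.1 = q.1 := by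
    rw [Finset.mem_coe, h1] at hp
    rw [Finset.mem_coe, h2] at hq
    exact whitney_level_unique hp hq
  rw [h1, h2, h3]

theorem dyIdx_mem_Ico {u : ℝ} (hu : u ∈ Ioc (0 : ℝ) 1) (l : ℕ) :
    dyIdx l u ∈ Ico (0 : ℤ) (2 ^ l) := by
  have h : u ∈ cell id l (dyIdx l u) := mem_cell_iff_dyIdx.2 rfl
  rw [mem_cell] at h
  simp only [id] at h
  have h2 : (0 : ℝ) < u * 2 ^ l := mul_pos hu.1 (by positivity)
  have h3 : u * 2 ^ l ≤ 2 ^ l := mul_le_of_le_one_left (by positivity) hu.2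
  constructor
  · have : (-1 : ℝ) < dyIdx l u := by linarith [h.2]
    have : (-1 : ℤ) < dyIdx l u := by exact_mod_cast this
    omega
  · have : (dyIdx l u : ℝ) < 2 ^ l := h.1.trans_le h3
    exact_mod_cast this

theorem exists_whitney_of_adm {B : Finset ℝ} {l₀ L : ℕ} (hL : l₀ ≤ L) {u : ℝ}
    (hu : u ∈ Ioc (0 : ℝ) 1) (h : Adm B L (dyIdx L u)) :
    ∃ l, (l, dyIdx l u) ∈ whitney B l₀ L := by
  have hex : ∃ l, l₀ ≤ l ∧ Adm B l (dyIdx l u) := ⟨L, hL, h⟩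
  have hs := Nat.find_spec hex
  set l := Nat.find hex with hl
  have hlL : l ≤ L := Nat.find_min' hex ⟨hL, h⟩
  have hI := dyIdx_mem_Ico hu l
  refine ⟨l, mem_whitney.2 ⟨hs.1, hlL, hI.1, hI.2, hs.2, ?_⟩⟩
  rcases hs.1.eq_or_lt with h0 | h0
  · exact Or.inl h0.symm
  · right
    intro hA
    obtain ⟨m, hm⟩ : ∃ k, l = k + 1 := ⟨l - 1, by omega⟩
    simp only [hm, add_tsub_cancel_right, dyIdx_succ] at hA
    have := Nat.find_min' hex (m := m) ⟨by omega, hA⟩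
    omega

theorem card_le_of_forall_near {B : Finset ℝ} {c : ℝ} {a b : ℝ} {N : ℕ} (hab : b + a + 1 ≤ N)
    (s : Finset ℤ) (h : ∀ j ∈ s, ∃ v ∈ B, v * c - a ≤ j ∧ (j : ℝ) ≤ v * c + b) :
    s.card ≤ N * B.card := by
  have hsub : s ⊆ B.biUnion fun v => Finset.Icc ⌈v * c - a⌉ ⌊v * c + b⌋ := by
    intro j hj
    obtain ⟨v, hv, h1, h2⟩ := h j hj
    exact Finset.mem_biUnion.2 ⟨v, hv, Finset.mem_Icc.2 ⟨Int.ceil_le.2 h1, Int.le_floor.2 h2⟩⟩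
  refine (Finset.card_le_card hsub).trans ((Finset.card_biUnion_le_card_mul _ _ N ?_).trans
    (le_of_eq (mul_comm _ _)))
  intro v _
  rw [Int.card_Icc]
  have h1 := Int.floor_le (v * c + b)
  have h2 := Int.le_ceil (v * c - a)
  have h3 : ((⌊v * c + b⌋ + 1 - ⌈v * c - a⌉ : ℤ) : ℝ) ≤ (N : ℤ) := by push_cast; linarith
  have h4 : ⌊v * c + b⌋ + 1 - ⌈v * c - a⌉ ≤ (N : ℤ) := by exact_mod_cast h3
  omega

theorem card_not_adm_le (B : Finset ℝ) (l : ℕ) (s : Finset ℤ) (h : ∀ j ∈ s, ¬ Adm B l j) :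
    s.card ≤ 16 * B.card := by
  refine card_le_of_forall_near (c := 2 ^ l) (a := 8) (b := 7) (by norm_num) s
    fun j hj => ?_
  have := h j hj
  simp only [Adm, not_forall, not_or, not_lt] at this
  obtain ⟨v, hv, h1, h2⟩ := this
  exact ⟨v, hv, by linarith, by linarith⟩

theorem exists_near_of_parent_not_adm {B : Finset ℝ} {l : ℕ} {j : ℤ}
    (h : ¬ Adm B l (j / 2)) :
    ∃ v ∈ B, v * 2 ^ (l + 1) - 16 ≤ j ∧ (j : ℝ) ≤ v * 2 ^ (l + 1) + 15 := by
  simp only [Adm, not_forall, not_or, not_lt] at h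
  obtain ⟨v, hv, h1, h2⟩ := h
  have h3 : (2 * ((j / 2 : ℤ) : ℝ)) ≤ j := by
    have : 2 * (j / 2) ≤ j := by omega
    exact_mod_cast this
  have h4 : (j : ℝ) ≤ 2 * ((j / 2 : ℤ) : ℝ) + 1 := by
    have : j ≤ 2 * (j / 2) + 1 := by omega
    exact_mod_cast this
  refine ⟨v, hv, ?_, ?_⟩ <;> rw [pow_succ] <;> linarith

theorem card_whitney_le (B : Finset ℝ) (l₀ L : ℕ) :
    (whitney B l₀ L).card ≤ 2 ^ l₀ + (L - l₀) * (32 * B.card) := by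
  have hsub : whitney B l₀ L ⊆ ((Finset.Ico (0 : ℤ) (2 ^ l₀)).image fun j => (l₀, j)) ∪
      (Finset.Ioc l₀ L).biUnion fun l => ((Finset.Ico (0 : ℤ) (2 ^ L)).filter fun j =>
        ¬ Adm B (l - 1) (j / 2)).image fun j => (l, j) := by
    intro p hp
    have hp' := hp
    rw [mem_whitney] at hp
    rw [whitney, Finset.mem_filter, Finset.mem_product] at hp'
    rcases hp.2.2.2.2.2 with h | h
    · refine Finset.mem_union_left _ (Finset.mem_image.2 ⟨p.2, Finset.mem_Ico.2 ⟨hp.2.2.1, ?_⟩, ?_⟩)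
      · rw [← h]; exact hp.2.2.2.1
      · rw [← h]
    · rcases hp.1.eq_or_lt with h0 | h0
      · refine Finset.mem_union_left _
          (Finset.mem_image.2 ⟨p.2, Finset.mem_Ico.2 ⟨hp.2.2.1, ?_⟩, ?_⟩)
        · rw [h0]; exact hp.2.2.2.1
        · rw [h0]
      · refine Finset.mem_union_right _ (Finset.mem_biUnion.2
          ⟨p.1, Finset.mem_Ioc.2 ⟨h0, hp.2.1⟩,
            Finset.mem_image.2 ⟨p.2, Finset.mem_filter.2 ⟨?_, h⟩, rfl⟩⟩)
        exact hp'.1.2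
  refine (Finset.card_le_card hsub).trans ((Finset.card_union_le _ _).trans (add_le_add ?_ ?_))
  · refine Finset.card_image_le.trans (le_of_eq ?_)
    rw [Int.card_Ico, sub_zero]
    have : ((2 : ℤ) ^ l₀) = ((2 ^ l₀ : ℕ) : ℤ) := by push_cast; rfl
    rw [this, Int.toNat_natCast]
  · refine (Finset.card_biUnion_le_card_mul _ _ (32 * B.card) ?_).trans (by rw [Nat.card_Ioc])
    intro l hl
    refine Finset.card_image_le.trans ?_
    rw [Finset.mem_Ioc] at hl
    obtain ⟨m, rfl⟩ : ∃ k, l = k + 1 := ⟨l - 1, by omega⟩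
    refine card_le_of_forall_near (c := 2 ^ (m + 1)) (a := 16) (b := 15) (by norm_num)
      _ fun j hj => ?_
    rw [Finset.mem_filter, add_tsub_cancel_right] at hj
    exact exists_near_of_parent_not_adm hj.2

theorem whitney_overlap {B : Finset ℝ} {l₀ L : ℕ} (F : ℝ → ℝ) (x : ℝ) :
    ((whitney B l₀ L ×ˢ Finset.Icc (-3 : ℤ) 3).filter
      fun q => x ∈ cell F q.1.1 (q.1.2 + q.2)).card ≤ 21 := by
  set Q := (whitney B l₀ L ×ˢ Finset.Icc (-3 : ℤ) 3).filter
    fun q => x ∈ cell F q.1.1 (q.1.2 + q.2) with hQ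
  rcases Q.eq_empty_or_nonempty with h | h
  · rw [h]; simp
  obtain ⟨q₀, hq₀, hmin⟩ := Q.exists_min_image (fun q => q.1.1) h
  have hlev : ∀ q ∈ Q, q.1.1 ≤ q₀.1.1 + 2 := by
    intro q hq
    by_contra hlt
    rw [not_le] at hlt
    rw [hQ, Finset.mem_filter, Finset.mem_product, Finset.mem_Icc, mem_whitney, mem_cell] at hq hq₀
    obtain ⟨⟨hw, hi1, hi2⟩, hc1, hc2⟩ := hq
    obtain ⟨⟨hw₀, hk1, hk2⟩, hd1, hd2⟩ := hq₀
    rcases hw.2.2.2.2.2 with h | h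
    · have := hw₀.1; omega
    · obtain ⟨m, hm⟩ : ∃ k, q.1.1 = k + 1 := ⟨q.1.1 - 1, by omega⟩
      rw [hm, add_tsub_cancel_right] at h
      obtain ⟨v, hv, h1, h2⟩ := exists_near_of_parent_not_adm h
      rw [← hm] at h1 h2
      have h3 := hw₀.2.2.2.2.1 v hv
      have hpow : (2 : ℝ) ^ q.1.1 = 2 ^ q₀.1.1 * 2 ^ (q.1.1 - q₀.1.1) := by
        rw [← pow_add]; congr 1; omega
      have h8 : (8 : ℝ) ≤ 2 ^ (q.1.1 - q₀.1.1) := by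
        calc (8 : ℝ) = 2 ^ 3 := by norm_num
          _ ≤ _ := pow_le_pow_right₀ (by norm_num) (by omega)
      have c1 : (-3 : ℝ) ≤ q.2 := by exact_mod_cast hi1
      have c2 : (q.2 : ℝ) ≤ 3 := by exact_mod_cast hi2
      have c3 : (-3 : ℝ) ≤ q₀.2 := by exact_mod_cast hk1
      have c4 : (q₀.2 : ℝ) ≤ 3 := by exact_mod_cast hk2
      push_cast at hc1 hc2 hd1 hd2
      set T := (2 : ℝ) ^ (q.1.1 - q₀.1.1)
      set a := (2 : ℝ) ^ q₀.1.1
      have e1 : (F x - v) * (2 : ℝ) ^ q.1.1 = (F x * a - v * a) * T := by rw [hpow]; ring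
      have e2 : (F x - v) * (2 : ℝ) ^ q.1.1 ≤ 20 := by linarith
      have e3 : -20 ≤ (F x - v) * (2 : ℝ) ^ q.1.1 := by linarith
      rcases h3 with h3 | h3
      · have : 4 ≤ F x * a - v * a := by linarith
        nlinarith
      · have : F x * a - v * a ≤ -4 := by linarith
        nlinarith
  have hinj : Set.InjOn (fun q : (ℕ × ℤ) × ℤ => (q.1.1, q.2)) (Q : Set ((ℕ × ℤ) × ℤ)) := by
    intro q hq q' hq' heq
    simp only [Prod.mk.injEq] at heq
    rw [Finset.mem_coe, hQ, Finset.mem_filter, mem_cell_iff_dyIdx] at hq hq'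
    have h1 := hq.2
    have h2 := hq'.2
    rw [heq.1] at h1
    have h3 : q.1.2 = q'.1.2 := by have := heq.2; omega
    exact Prod.ext (Prod.ext heq.1 h3) heq.2
  have := Finset.card_le_card_of_injOn (s := Q)
    (t := Finset.Icc q₀.1.1 (q₀.1.1 + 2) ×ˢ Finset.Icc (-3 : ℤ) 3)
    (fun q : (ℕ × ℤ) × ℤ => (q.1.1, q.2)) (by
      intro q hq
      have hq' := hq
      rw [Finset.mem_coe, hQ, Finset.mem_filter, Finset.mem_product] at hq'
      simp only [Finset.coe_product, Set.mem_prod, Finset.mem_coe]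
      exact ⟨Finset.mem_Icc.2 ⟨hmin q hq, hlev q hq⟩, hq'.1.2⟩) hinj
  refine this.trans (le_of_eq ?_)
  rw [Finset.card_product, Nat.card_Icc, Int.card_Icc]
  have : q₀.1.1 + 2 + 1 - q₀.1.1 = 3 := by omega
  rw [this]; rfl

theorem whitney_integral_overlap {B : Finset ℝ} {l₀ L : ℕ} {F : ℝ → ℝ} (hF : Monotone F)
    {ψ : ℝ → ℝ} (hψ : Integrable ψ) (h0 : 0 ≤ᵐ[volume] ψ) :
    ∑ p ∈ whitney B l₀ L, ∑ i ∈ Finset.Icc (-3 : ℤ) 3, ∫ x in cell F p.1 (p.2 + i), ψ x ≤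
      21 * ∫ x, ψ x := by
  rw [← Finset.sum_product' (whitney B l₀ L) (Finset.Icc (-3 : ℤ) 3)
    (fun p i => ∫ x in cell F p.1 (p.2 + i), ψ x)]
  have hm : ∀ q : (ℕ × ℤ) × ℤ, MeasurableSet (cell F q.1.1 (q.1.2 + q.2)) := fun q =>
    measurableSet_cell hF _ _
  have e : ∀ q : (ℕ × ℤ) × ℤ, ∫ x in cell F q.1.1 (q.1.2 + q.2), ψ x =
      ∫ x, (cell F q.1.1 (q.1.2 + q.2)).indicator ψ x := fun q => (integral_indicator (hm q)).symm
  simp only [e]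
  rw [← integral_finsetSum _ fun q _ => hψ.indicator (hm q), ← integral_const_mul]
  refine integral_mono_ae (integrable_finsetSum _ fun q _ => hψ.indicator (hm q))
    (hψ.const_mul _) ?_
  filter_upwards [h0] with x hx
  have e2 : ∑ q ∈ whitney B l₀ L ×ˢ Finset.Icc (-3 : ℤ) 3,
      (cell F q.1.1 (q.1.2 + q.2)).indicator ψ x =
      (((whitney B l₀ L ×ˢ Finset.Icc (-3 : ℤ) 3).filter
      fun q => x ∈ cell F q.1.1 (q.1.2 + q.2)).card : ℝ) * ψ x := by
    rw [← nsmul_eq_mul, ← Finset.sum_const, Finset.sum_filter]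
    rfl
  rw [e2]
  have := whitney_overlap (B := B) (l₀ := l₀) (L := L) F x
  have h3 : ((((whitney B l₀ L ×ˢ Finset.Icc (-3 : ℤ) 3).filter
      fun q => x ∈ cell F q.1.1 (q.1.2 + q.2)).card : ℕ) : ℝ) ≤ 21 := by exact_mod_cast this
  exact mul_le_mul_of_nonneg_right h3 hx

theorem real_densMeas_cell {f : ℝ → ℝ} (hf : IsDensity f) {l : ℕ} {j : ℤ} (h0 : 0 ≤ j)
    (h1 : j < 2 ^ l) : (densMeas f).real (cell (distFn f) l j) = 1 / 2 ^ l := by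
  have h1' : (j : ℝ) + 1 ≤ 2 ^ l := by exact_mod_cast h1
  have h0' : (0 : ℝ) ≤ j := by exact_mod_cast h0
  have hp : (0 : ℝ) < 2 ^ l := by positivity
  rw [cell, real_densMeas_distFn_Ioc hf (by positivity) (by gcongr; linarith)
    ((div_le_one hp).2 h1')]
  ring

theorem real_densMeas_cell_le {f : ℝ → ℝ} (hf : IsDensity f) (l : ℕ) (j : ℤ) :
    (densMeas f).real (cell (distFn f) l j) ≤ 1 / 2 ^ l := by
  have := hf.isProbabilityMeasure
  have hp : (0 : ℝ) < 2 ^ l := by positivity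
  by_cases h0 : 0 ≤ j
  · by_cases h1 : j < 2 ^ l
    · exact (real_densMeas_cell hf h0 h1).le
    · have : cell (distFn f) l j = ∅ := by
        ext x
        rw [mem_cell]
        simp only [mem_empty_iff_false, iff_false, not_and]
        intro h
        have h2 : (2 : ℝ) ^ l ≤ j := by exact_mod_cast not_lt.1 h1
        have h3 := distFn_le_one hf x
        nlinarith
      rw [this]; simp
  · have hsub : cell (distFn f) l j ⊆ distFn f ⁻¹' Iic 0 := by
      intro x hx
      rw [mem_cell] at hx
      have : (j : ℝ) + 1 ≤ 0 := by
        have : j + 1 ≤ 0 := by omega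
        exact_mod_cast this
      rw [mem_preimage, mem_Iic]
      by_contra h
      have : 0 < distFn f x * 2 ^ l := mul_pos (not_le.1 h) hp
      linarith
    have h2 := measureReal_mono (μ := densMeas f) hsub
    rw [real_densMeas_distFn_le hf ⟨le_rfl, zero_le_one⟩] at h2
    exact h2.trans (by positivity)

theorem dyIdx_eq_div {l L : ℕ} (h : l ≤ L) (u : ℝ) : dyIdx l u = dyIdx L u / 2 ^ (L - l) := by
  induction L, h using Nat.le_induction with
  | base => simp
  | succ m hm ih =>
    rw [ih, ← dyIdx_succ, Int.ediv_ediv_of_nonneg (by norm_num), Nat.succ_sub hm, pow_succ']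

/-- Indices of the cells of the finest level `L` not covered by the selected dyadic intervals. -/
def leaves (G : Finset (ℕ × ℤ)) (L : ℕ) : Finset ℤ :=
  (Finset.Ico (0 : ℤ) (2 ^ L)).filter fun e => ∀ p ∈ G, e / 2 ^ (L - p.1) ≠ p.2

theorem card_leaves_le {B : Finset ℝ} {l₀ L : ℕ} (hL : l₀ ≤ L) {G : Finset (ℕ × ℤ)} :
    ((leaves G L).card : ℝ) / 2 ^ L ≤
      16 * B.card / 2 ^ L + ∑ p ∈ whitney B l₀ L \ G, (1 : ℝ) / 2 ^ p.1 := by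
  have hsub : leaves G L ⊆ ((leaves G L).filter fun e => ¬ Adm B L e) ∪
      (whitney B l₀ L \ G).biUnion fun p =>
        Finset.Ico (p.2 * 2 ^ (L - p.1)) ((p.2 + 1) * 2 ^ (L - p.1)) := by
    intro e he
    by_cases ha : Adm B L e
    · refine Finset.mem_union_right _ (Finset.mem_biUnion.2 ?_)
      rw [leaves, Finset.mem_filter, Finset.mem_Ico] at he
      obtain ⟨⟨h0, h1⟩, h2⟩ := he
      have hp : (0 : ℝ) < 2 ^ L := by positivity
      have hu : dyIdx L (((e : ℝ) + 1) / 2 ^ L) = e := by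
        rw [dyIdx, div_mul_cancel₀ _ hp.ne']
        have : ((e : ℝ) + 1) = ((e + 1 : ℤ) : ℝ) := by push_cast; rfl
        rw [this, Int.ceil_intCast]; ring
      have h1' : (e : ℝ) + 1 ≤ 2 ^ L := by exact_mod_cast h1
      have h0' : (0 : ℝ) ≤ e := by exact_mod_cast h0
      obtain ⟨l, hl⟩ := exists_whitney_of_adm hL (B := B) (u := ((e : ℝ) + 1) / 2 ^ L)
        ⟨by positivity, (div_le_one hp).2 h1'⟩ (by rwa [hu])
      have hlL := (mem_whitney.1 hl).2.1
      have hdiv := dyIdx_eq_div hlL (((e : ℝ) + 1) / 2 ^ L)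
      rw [hu] at hdiv
      refine ⟨_, Finset.mem_sdiff.2 ⟨hl, fun h => h2 _ h hdiv.symm⟩, ?_⟩
      rw [Finset.mem_Ico, hdiv]
      have hq : (0 : ℤ) < 2 ^ (L - l) := by positivity
      exact ⟨Int.ediv_mul_le _ hq.ne', Int.lt_ediv_add_one_mul_self _ hq⟩
    · exact Finset.mem_union_left _ (Finset.mem_filter.2 ⟨he, ha⟩)
  have h1 := (Finset.card_le_card hsub).trans (Finset.card_union_le _ _)
  have h2 := card_not_adm_le B L ((leaves G L).filter fun e => ¬ Adm B L e)
    fun j hj => (Finset.mem_filter.1 hj).2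
  have h3 : ((whitney B l₀ L \ G).biUnion fun p =>
        Finset.Ico (p.2 * 2 ^ (L - p.1)) ((p.2 + 1) * 2 ^ (L - p.1))).card ≤
      ∑ p ∈ whitney B l₀ L \ G, 2 ^ (L - p.1) := by
    refine Finset.card_biUnion_le.trans (Finset.sum_le_sum fun p _ => le_of_eq ?_)
    rw [Int.card_Ico]
    have : (p.2 + 1) * 2 ^ (L - p.1) - p.2 * 2 ^ (L - p.1) = ((2 ^ (L - p.1) : ℕ) : ℤ) := by
      push_cast; ring
    rw [this, Int.toNat_natCast]
  have h4 : (leaves G L).card ≤ 16 * B.card + ∑ p ∈ whitney B l₀ L \ G, 2 ^ (L - p.1) := by omega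
  have h5 : ((leaves G L).card : ℝ) ≤
      16 * B.card + ∑ p ∈ whitney B l₀ L \ G, (2 : ℝ) ^ (L - p.1) := by exact_mod_cast h4
  have hp : (0 : ℝ) < 2 ^ L := by positivity
  calc _ ≤ (16 * B.card + ∑ p ∈ whitney B l₀ L \ G, (2 : ℝ) ^ (L - p.1)) / 2 ^ L := by gcongr
    _ = _ := by
        rw [add_div, Finset.sum_div]
        congr 1
        refine Finset.sum_congr rfl fun p hp' => ?_
        have := (mem_whitney.1 (Finset.mem_sdiff.1 hp').1).2.1
        rw [div_eq_div_iff hp.ne' (by positivity), one_mul, ← pow_add]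
        congr 1; omega

theorem sum_indicator_cells {B : Finset ℝ} {l₀ L : ℕ} {G : Finset (ℕ × ℤ)}
    (hG : G ⊆ whitney B l₀ L) {F : ℝ → ℝ} {x : ℝ} (hx : F x ∈ Ioc (0 : ℝ) 1) (g : ℝ → ℝ) :
    ∑ p ∈ G, (cell F p.1 p.2).indicator g x + ∑ e ∈ leaves G L, (cell F L e).indicator g x =
      g x := by
  have key : ∀ p ∈ G, x ∈ cell F p.1 p.2 ↔ dyIdx L (F x) / 2 ^ (L - p.1) = p.2 := by
    intro p hp
    rw [mem_cell_iff_dyIdx, dyIdx_eq_div (mem_whitney.1 (hG hp)).2.1]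
  by_cases h : ∃ p ∈ G, x ∈ cell F p.1 p.2
  · obtain ⟨p, hp, hxp⟩ := h
    rw [Finset.sum_eq_single_of_mem p hp, indicator_of_mem hxp, Finset.sum_eq_zero, add_zero]
    · intro e he
      refine indicator_of_notMem (fun hxe => ?_) _
      rw [mem_cell_iff_dyIdx] at hxe
      rw [key p hp, hxe] at hxp
      exact (Finset.mem_filter.1 he).2 p hp hxp
    · intro q hq hqp
      refine indicator_of_notMem (fun hxq => ?_) _
      exact disjoint_left.1 (whitney_pairwiseDisjoint F (hG hq) (hG hp) hqp) hxq hxp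
  · simp only [not_exists, not_and] at h
    have he : dyIdx L (F x) ∈ leaves G L := by
      rw [leaves, Finset.mem_filter, Finset.mem_Ico]
      exact ⟨dyIdx_mem_Ico hx L, fun p hp hh => h p hp ((key p hp).2 hh)⟩
    rw [Finset.sum_eq_zero fun p hp => indicator_of_notMem (h p hp) _, zero_add,
      Finset.sum_eq_single_of_mem _ he, indicator_of_mem (mem_cell_iff_dyIdx.2 rfl)]
    intro e _ hne
    refine indicator_of_notMem (fun hxe => hne ?_) _
    rw [mem_cell_iff_dyIdx] at hxe
    exact hxe.symm

/-- The values of `F` at the end points of the intervals `I r`, together with `0` and `1`. -/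
def breakPts (F : ℝ → ℝ) {k : ℕ} (I : Fin k → Set ℝ) : Finset ℝ :=
  {0, 1} ∪ (Finset.univ.image fun r => F (sInf (I r))) ∪ Finset.univ.image fun r => F (sSup (I r))

theorem card_breakPts_le (F : ℝ → ℝ) {k : ℕ} (I : Fin k → Set ℝ) :
    (breakPts F I).card ≤ 2 * k + 2 := by
  have h1 := Finset.card_union_le (({0, 1} : Finset ℝ) ∪ Finset.univ.image fun r => F (sInf (I r)))
    (Finset.univ.image fun r => F (sSup (I r)))
  have h2 := Finset.card_union_le ({0, 1} : Finset ℝ) (Finset.univ.image fun r => F (sInf (I r)))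
  have h3 : (Finset.univ.image fun r => F (sInf (I r))).card ≤ k :=
    Finset.card_image_le.trans (by simp)
  have h4 : (Finset.univ.image fun r => F (sSup (I r))).card ≤ k :=
    Finset.card_image_le.trans (by simp)
  have h5 : ({0, 1} : Finset ℝ).card ≤ 2 := Finset.card_le_two
  unfold breakPts
  omega

theorem Adm.bounds {F : ℝ → ℝ} {k : ℕ} {I : Fin k → Set ℝ} {l : ℕ} {j : ℤ}
    (h : Adm (breakPts F I) l j) (h0 : 0 ≤ j) (h1 : j < 2 ^ l) : 8 ≤ j ∧ j + 9 ≤ 2 ^ l := by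
  have h0' : (0 : ℝ) ≤ j := by exact_mod_cast h0
  have h1' : (j : ℝ) < 2 ^ l := by exact_mod_cast h1
  constructor
  · rcases h 0 (by simp [breakPts]) with h | h
    · have : (7 : ℝ) < j := by linarith
      have : (7 : ℤ) < j := by exact_mod_cast this
      omega
    · linarith
  · rcases h 1 (by simp [breakPts]) with h | h
    · linarith
    · rw [one_mul] at h
      have : j + 8 < 2 ^ l := by exact_mod_cast h
      omega

theorem Adm.subset_piece {F : ℝ → ℝ} (hF : Monotone F) {k : ℕ} {I : Fin k → Set ℝ}
    (hI : ∀ r, (I r).OrdConnected) {l : ℕ} {j : ℤ} (h : Adm (breakPts F I) l j) {r : Fin k}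
    {x y : ℝ} {i i' : ℤ} (hi : i ∈ Finset.Icc (-3 : ℤ) 3) (hi' : i' ∈ Finset.Icc (-3 : ℤ) 3)
    (hx : x ∈ cell F l (j + i)) (hxI : x ∈ I r) (hy : y ∈ cell F l (j + i')) : y ∈ I r := by
  by_contra hyI
  rw [mem_cell] at hx hy
  rw [Finset.mem_Icc] at hi hi'
  have c1 : (-3 : ℝ) ≤ i := by exact_mod_cast hi.1
  have c2 : (i : ℝ) ≤ 3 := by exact_mod_cast hi.2
  have c3 : (-3 : ℝ) ≤ i' := by exact_mod_cast hi'.1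
  have c4 : (i' : ℝ) ≤ 3 := by exact_mod_cast hi'.2
  push_cast at hx hy
  have hp : (0 : ℝ) < 2 ^ l := by positivity
  rcases lt_trichotomy y x with hlt | heq | hlt
  · have hlb : ∀ z ∈ I r, y ≤ z := fun z hz => by
      by_contra hzy
      exact hyI ((hI r).out hz hxI ⟨(not_le.1 hzy).le, hlt.le⟩)
    have h1 : y ≤ sInf (I r) := le_csInf ⟨x, hxI⟩ hlb
    have h2 : sInf (I r) ≤ x := csInf_le ⟨y, hlb⟩ hxI
    have h3 := mul_le_mul_of_nonneg_right (hF h1) hp.le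
    have h4 := mul_le_mul_of_nonneg_right (hF h2) hp.le
    rcases h (F (sInf (I r))) (by simp [breakPts]) with h | h <;> linarith
  · exact hyI (heq ▸ hxI)
  · have hub : ∀ z ∈ I r, z ≤ y := fun z hz => by
      by_contra hzy
      exact hyI ((hI r).out hxI hz ⟨hlt.le, (not_le.1 hzy).le⟩)
    have h1 : sSup (I r) ≤ y := csSup_le ⟨x, hxI⟩ hub
    have h2 : x ≤ sSup (I r) := le_csSup ⟨y, hub⟩ hxI
    have h3 := mul_le_mul_of_nonneg_right (hF h1) hp.le
    have h4 := mul_le_mul_of_nonneg_right (hF h2) hp.le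
    rcases h (F (sSup (I r))) (by simp [breakPts]) with h | h <;> linarith

/-! ### Pointwise divergence inequalities -/

/-- The integrand of the generalised Kullback--Leibler divergence. -/
def klFn (a b : ℝ) : ℝ := a * Real.log (a / b) - a + b

/-- The mixture `(b + 2 * c) / 3`. -/
def mixFn (b c : ℝ) : ℝ := (b + 2 * c) / 3

/-- The Hellinger integrand between `b` and the mixture of `b` and `c`. -/
def hellFn (b c : ℝ) : ℝ := (√(mixFn b c) - √b) ^ 2

theorem sq_sqrt_sub_le_klFn {a b : ℝ} (ha : 0 ≤ a) (hb : 0 ≤ b) (hab : b = 0 → a = 0) :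
    (√a - √b) ^ 2 ≤ klFn a b := by
  unfold klFn
  rcases hb.eq_or_lt with h | hb'
  · rw [← h, hab h.symm]; simp
  rcases ha.eq_or_lt with h | ha'
  · rw [← h]; simp [Real.sq_sqrt hb]
  have hsa := Real.sqrt_pos.2 ha'
  have hsb := Real.sqrt_pos.2 hb'
  have h1 := Real.log_le_sub_one_of_pos (div_pos hsb hsa)
  have h2 : Real.log (a / b) = -2 * Real.log (√b / √a) := by
    rw [Real.log_div hsb.ne' hsa.ne', Real.log_sqrt hb, Real.log_sqrt ha,
      Real.log_div ha'.ne' hb'.ne']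
    ring
  have h3 : a * (√b / √a) = √a * √b := by
    have : a = √a * √a := (Real.mul_self_sqrt ha).symm
    rw [mul_div_assoc', div_eq_iff hsa.ne']
    calc a * √b = (√a * √a) * √b := by rw [← this]
      _ = _ := by ring
  have h4 : a * Real.log (√b / √a) ≤ √a * √b - a := by
    calc _ ≤ a * (√b / √a - 1) := by gcongr
      _ = _ := by rw [mul_sub, h3, mul_one]
  rw [h2, sub_sq, Real.sq_sqrt ha, Real.sq_sqrt hb]
  linarith

theorem klFn_nonneg {a b : ℝ} (ha : 0 ≤ a) (hb : 0 ≤ b) (hab : b = 0 → a = 0) : 0 ≤ klFn a b :=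
  (sq_nonneg _).trans (sq_sqrt_sub_le_klFn ha hb hab)

theorem mixFn_nonneg {b c : ℝ} (hb : 0 ≤ b) (hc : 0 ≤ c) : 0 ≤ mixFn b c := by
  unfold mixFn; positivity

theorem hellFn_nonneg (b c : ℝ) : 0 ≤ hellFn b c := sq_nonneg _

theorem hellFn_le {b c : ℝ} (hb : 0 ≤ b) (hc : 0 ≤ c) : hellFn b c ≤ c + b := by
  have hm := mixFn_nonneg hb hc
  have h1 := Real.sqrt_nonneg (mixFn b c)
  have h2 := Real.sqrt_nonneg b
  have h3 := Real.sq_sqrt hm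
  have h4 := Real.sq_sqrt hb
  unfold hellFn
  rcases le_total (√(mixFn b c)) (√b) with h | h
  · nlinarith
  · have : (√(mixFn b c) - √b) ^ 2 ≤ mixFn b c := by nlinarith
    unfold mixFn at this ⊢
    linarith

theorem mixFn_div_two_sub_le {b c : ℝ} (hb : 0 ≤ b) (hc : 0 ≤ c) :
    mixFn b c / 2 - b ≤ hellFn b c := by
  have h3 := Real.sq_sqrt (mixFn_nonneg hb hc)
  have h4 := Real.sq_sqrt hb
  unfold hellFn
  nlinarith [sq_nonneg (√(mixFn b c) - 2 * √b)]

theorem le_two_mul_klFn_add {a b : ℝ} (ha : 0 ≤ a) (hb : 0 ≤ b) (hab : b = 0 → a = 0) :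
    b ≤ 2 * klFn a b + 2 * a := by
  have h1 := sq_sqrt_sub_le_klFn ha hb hab
  have h3 := Real.sq_sqrt ha
  have h4 := Real.sq_sqrt hb
  nlinarith [sq_nonneg (√b - 2 * √a)]

theorem le_hellFn_add {a b c : ℝ} (ha : 0 ≤ a) (hb : 0 ≤ b) (hc : 0 ≤ c) (hab : b = 0 → a = 0) :
    c ≤ 3 * hellFn b c + 6 * klFn a b + 6 * a := by
  have h1 := mixFn_div_two_sub_le hb hc
  have h2 := le_two_mul_klFn_add ha hb hab
  unfold mixFn at h1
  linarith

theorem mul_log_mix_sub_le {a b c : ℝ} (ha : 0 ≤ a) (hb : 0 ≤ b) (hc : 0 ≤ c)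
    (hab : b = 0 → a = 0) :
    3 / 2 * (a * Real.log (mixFn b c / b)) - a * Real.log (a / b) ≤
      3 / 4 * klFn a b - hellFn b c / 8 + c - a := by
  have hm := mixFn_nonneg hb hc
  have hk := klFn_nonneg ha hb hab
  have hh := hellFn_le hb hc
  rcases ha.eq_or_lt with h | ha'
  · have : klFn a b = b := by unfold klFn; rw [← h]; simp
    rw [← h] at this ⊢
    rw [this]
    simp only [zero_mul, mul_zero, sub_zero]
    linarith
  have hb' : 0 < b := hb.lt_of_ne fun h => ha'.ne' (hab h.symm)
  have hm' : 0 < mixFn b c := by unfold mixFn; linarith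
  have h1 := sq_sqrt_sub_le_klFn ha hb hab
  have h2 := sq_sqrt_sub_le_klFn ha hm fun h => absurd h hm'.ne'
  have h3 : klFn a b - klFn a (mixFn b c) = a * Real.log (mixFn b c / b) + b - mixFn b c := by
    unfold klFn
    rw [Real.log_div ha'.ne' hb'.ne', Real.log_div ha'.ne' hm'.ne', Real.log_div hm'.ne' hb'.ne']
    ring
  have h4 : hellFn b c ≤ 2 * klFn a (mixFn b c) + 2 * klFn a b := by
    unfold hellFn
    nlinarith [sq_nonneg (√(mixFn b c) - √a - (√a - √b))]
  have h5 : a * Real.log (a / b) = klFn a b + a - b := by unfold klFn; ring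
  have h6 : 0 ≤ klFn a (mixFn b c) := (sq_nonneg _).trans h2
  have h7 : mixFn b c = (b + 2 * c) / 3 := rfl
  linarith

theorem log_div_le_log_mix {b c : ℝ} (hb : 0 < b) (hc : 0 < c) :
    Real.log (c / b) ≤ 3 / 2 * Real.log (mixFn b c / b) := by
  have h := strictConcaveOn_log_Ioi.concaveOn.2 (mem_Ioi.2 (zero_lt_one' ℝ))
    (mem_Ioi.2 (div_pos hc hb))
    (show (0 : ℝ) ≤ 1 / 3 by norm_num) (show (0 : ℝ) ≤ 2 / 3 by norm_num) (by norm_num)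
  simp only [Real.log_one, smul_eq_mul, mul_zero, zero_add] at h
  have e : mixFn b c / b = 1 / 3 * 1 + 2 / 3 * (c / b) := by
    unfold mixFn; field_simp
  rw [e]
  linarith

theorem mix_div_eq {b c : ℝ} (hb : 0 < b) : mixFn b c / b = (1 + 2 * (c / b)) / 3 := by
  unfold mixFn; field_simp

theorem hellFn_eq_mul {b c : ℝ} (hb : 0 < b) :
    hellFn b c = b * (√(mixFn b c / b) - 1) ^ 2 := by
  have hsb := Real.sqrt_pos.2 hb
  unfold hellFn
  rw [Real.sqrt_div' _ hb.le]
  have : √(mixFn b c) - √b = √b * (√(mixFn b c) / √b - 1) := by field_simp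
  rw [this, mul_pow, Real.sq_sqrt hb.le]

theorem log_mix_div_ge {b c : ℝ} (hb : 0 < b) (hc : 0 ≤ c) :
    -Real.log 3 ≤ Real.log (mixFn b c / b) := by
  rw [← Real.log_inv, mix_div_eq hb]
  refine Real.log_le_log (by norm_num) ?_
  have : 0 ≤ c / b := by positivity
  linarith

theorem log_mix_div_le {b c M : ℝ} (hb : 0 < b) (hc : 0 ≤ c) (hM : 0 ≤ M)
    (h : c ≤ Real.exp M * b) : Real.log (mixFn b c / b) ≤ M := by
  have h0 : 0 ≤ c / b := by positivity
  have h1 : c / b ≤ Real.exp M := (div_le_iff₀ hb).2 h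
  rw [mix_div_eq hb, Real.log_le_iff_le_exp (by linarith)]
  have := Real.one_le_exp hM
  linarith

theorem exp_neg_le_of_klFn_le {a b c : ℝ} (ha : 0 < a) (hb : 0 < b) (h : klFn a b ≤ c * a) :
    Real.exp (-(c + 1)) * a ≤ b ∧ b ≤ Real.exp (2 * (c + 1)) * a := by
  unfold klFn at h
  have hab := div_pos hb ha
  set r := b / a with hr
  have hbr : b = r * a := by rw [hr, div_mul_cancel₀ _ ha.ne']
  have hlog : Real.log (a / b) = -Real.log r := by rw [hr, ← Real.log_inv, inv_div]
  rw [hlog, hbr] at h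
  have h1 : -Real.log r - 1 + r ≤ c := by
    have : a * (-Real.log r - 1 + r) ≤ a * c := by linarith
    exact le_of_mul_le_mul_left this ha
  constructor
  · rw [hbr]
    refine mul_le_mul_of_nonneg_right ?_ ha.le
    rw [← Real.le_log_iff_exp_le hab]
    linarith
  · rw [hbr]
    refine mul_le_mul_of_nonneg_right ?_ ha.le
    rw [← Real.log_le_iff_le_exp hab]
    have h2 := Real.log_le_sub_one_of_pos (half_pos hab)
    rw [Real.log_div hab.ne' two_ne_zero] at h2
    have h3 := Real.log_two_lt_d9
    linarith

theorem abs_log_le_of_abs_sqrt_sub_le {b c η : ℝ} (hb : 0 < b) (hη : η ≤ 1 / 12)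
    (h : |√(mixFn b c / b) - 1| ≤ η) (hm : 0 ≤ mixFn b c / b) :
    0 < c ∧ |Real.log (c / b)| ≤ 4 * η := by
  have h0 : 0 ≤ η := (abs_nonneg _).trans h
  rw [abs_le] at h
  set s := √(mixFn b c / b) with hs
  have hss : s ^ 2 = mixFn b c / b := Real.sq_sqrt hm
  rw [mix_div_eq hb] at hss
  have e : c / b = (3 * s ^ 2 - 1) / 2 := by linarith
  have h1 : 1 - 3 * η ≤ c / b := by rw [e]; nlinarith
  have h2 : c / b ≤ 1 + 4 * η := by rw [e]; nlinarith
  have hcb : 0 < c / b := by linarith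
  refine ⟨by rwa [lt_div_iff₀ hb, zero_mul] at hcb, abs_le.2 ⟨?_, ?_⟩⟩
  · rw [Real.le_log_iff_exp_le hcb]
    refine le_trans ?_ h1
    have h3 := Real.add_one_le_exp (4 * η)
    rw [Real.exp_neg]
    refine (inv_anti₀ (by linarith) h3).trans ?_
    rw [inv_le_iff_one_le_mul₀ (by linarith)]
    nlinarith
  · rw [Real.log_le_iff_le_exp hcb]
    have h3 := Real.add_one_le_exp (4 * η)
    linarith

/-- Averaging: a nonnegative function is dominated by `f₀` at some point of a set, up to the
ratio of the integrals. -/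
theorem exists_mul_le_of_setIntegral_le {f₀ ψ : ℝ → ℝ} {E : Set ℝ} {A w : ℝ}
    (hE : MeasurableSet E) (hf : IntegrableOn f₀ E) (hψ : IntegrableOn ψ E)
    (hf0 : ∀ x, 0 ≤ f₀ x) (hA : ∫ x in E, ψ x ≤ A) (hw : ∫ x in E, f₀ x = w) (hw0 : 0 < w)
    (hψ0 : ∀ᵐ x, 0 ≤ ψ x) :
    ∃ x ∈ E, 0 < f₀ x ∧ 0 ≤ ψ x ∧ w * ψ x ≤ A * f₀ x := by
  by_contra hcon
  push Not at hcon
  have hA0 : 0 ≤ A := (integral_nonneg_of_ae (ae_restrict_of_ae hψ0)).trans hA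
  have hg : IntegrableOn (fun x => w * ψ x - A * f₀ x) E := (hψ.const_mul w).sub (hf.const_mul A)
  have hnn : ∀ᵐ x ∂volume.restrict E, 0 ≤ w * ψ x - A * f₀ x := by
    filter_upwards [ae_restrict_mem hE, ae_restrict_of_ae hψ0] with x hx h0
    rcases (hf0 x).eq_or_lt with h | h
    · rw [← h]; simp only [mul_zero, sub_zero]; positivity
    · exact sub_nonneg.2 (hcon x hx h h0).le
  have hInt : ∫ x in E, (w * ψ x - A * f₀ x) = w * (∫ x in E, ψ x) - A * w := by
    rw [integral_sub (hψ.const_mul w) (hf.const_mul A), integral_const_mul, integral_const_mul, hw]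
  have hle : ∫ x in E, (w * ψ x - A * f₀ x) ≤ 0 := by rw [hInt]; nlinarith
  have hz := (integral_eq_zero_iff_of_nonneg_ae hnn hg).1
    (le_antisymm hle (integral_nonneg_of_ae hnn))
  have : ∫ x in E, f₀ x = 0 := by
    refine integral_eq_zero_of_ae ?_
    filter_upwards [hz, ae_restrict_mem hE, ae_restrict_of_ae hψ0] with x hx hxE h0
    by_contra h
    have := hcon x hxE ((hf0 x).lt_of_ne fun h' => h h'.symm) h0
    simp only [Pi.zero_apply] at hx
    linarith
  linarith

/-! ### Comparison of densities on a block of dyadic cells -/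

theorem IsLCDensity.le_mul_of_distFn_mem {f : ℝ → ℝ} (hf : IsDensity f) (hl : IsLogConcaveFn f)
    {s t K : ℝ} (hs : 0 < s) (ht : t < 1) (hst : t ≤ K * s) (hst' : 1 - s ≤ K * (1 - t)) {x y : ℝ}
    (hx : distFn f x ∈ Icc s t) (hy : distFn f y ∈ Icc s t) : f x ≤ K * f y := by
  have hx0 := hf.1 x
  have hy0 := hf.1 y
  rcases le_total y x with h | h
  · have h1 := mul_distFn_le hf hl h
    have h2 : f x * s ≤ f y * (K * s) :=
      calc f x * s ≤ f x * distFn f y := by gcongr; exact hy.1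
        _ ≤ f y * distFn f x := h1
        _ ≤ f y * (K * s) := by gcongr; exact hx.2.trans hst
    refine le_of_mul_le_mul_right ?_ hs
    linarith
  · have h1 := mul_one_sub_distFn_le hf hl h
    have h2 : f x * (1 - t) ≤ f y * (K * (1 - t)) :=
      calc f x * (1 - t) ≤ f x * (1 - distFn f y) := by gcongr; exact hy.2
        _ ≤ f y * (1 - distFn f x) := h1
        _ ≤ f y * (K * (1 - t)) := by gcongr; linarith [hx.1]
    refine le_of_mul_le_mul_right ?_ (sub_pos.2 ht)
    linarith

theorem setIntegral_Ici_le_of_le {f : ℝ → ℝ} (hf : IsDensity f) (hl : IsLogConcaveFn f)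
    {x y : ℝ} (hxy : x ≤ y) (hx : 0 < f x) (h : 8 * f y ≤ f x) : ∫ z in Ici y, f z ≤ 1 / 8 := by
  have h1 := IsLCDensity.mul_setIntegral_Ici_le hf hl hxy
  have h2 := hf.setIntegral_le_one (Ici x)
  have h3 : f y * ∫ z in Ici x, f z ≤ f y * 1 := mul_le_mul_of_nonneg_left h2 (hf.1 y)
  refine le_of_mul_le_mul_left ?_ hx
  linarith

theorem setIntegral_Iic_le_of_le {f : ℝ → ℝ} (hf : IsDensity f) (hl : IsLogConcaveFn f)
    {x y : ℝ} (hyx : y ≤ x) (hx : 0 < f x) (h : 8 * f y ≤ f x) : ∫ z in Iic y, f z ≤ 1 / 8 := by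
  have h1 := IsLCDensity.mul_setIntegral_Iic_le hf hl hyx
  have h2 := hf.setIntegral_le_one (Iic x)
  have h3 : f y * ∫ z in Iic x, f z ≤ f y * 1 := mul_le_mul_of_nonneg_left h2 (hf.1 y)
  refine le_of_mul_le_mul_left ?_ hx
  linarith

theorem three_quarters_le_setIntegral {f : ℝ → ℝ} (hf : IsDensity f) (hl : IsLogConcaveFn f)
    {x y z : ℝ} (hyx : y < x) (hxz : x < z) (hx : 0 < f x) (h : 8 * f y ≤ f x)
    (h' : 8 * f z ≤ f x) {S : Set ℝ} (hS : Ioo y z ⊆ S) : 3 / 4 ≤ ∫ u in S, f u := by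
  have h1 := setIntegral_Iic_le_of_le hf hl hyx.le hx h
  have h2 := setIntegral_Ici_le_of_le hf hl hxz.le hx h'
  have h3 : ∫ u in Ioo y z, f u ≤ ∫ u in S, f u :=
    setIntegral_mono_set hf.integrable.integrableOn (Eventually.of_forall hf.1)
      (LE.le.eventuallyLE hS)
  have h5 : ∫ u in Ioi y, f u = (∫ u in Ioo y z, f u) + ∫ u in Ici z, f u := by
    rw [← Ioo_union_Ici_eq_Ioi (hyx.trans hxz)]
    refine setIntegral_union ?_ measurableSet_Ici hf.integrable.integrableOn
      hf.integrable.integrableOn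
    rw [disjoint_left]
    intro u hu hu'
    exact absurd hu.2 (not_lt.2 hu')
  have h4' : (∫ u in Iic y, f u) + ∫ u in Ioi y, f u = 1 := by
    rw [← hf.integral_eq_one, ← compl_Iic]
    exact integral_add_compl measurableSet_Iic hf.integrable
  linarith

/-- The union of a dyadic cell and its two neighbours. -/
def cell3 (F : ℝ → ℝ) (l : ℕ) (j : ℤ) : Set ℝ :=
  F ⁻¹' Ioc (((j : ℝ) - 1) / 2 ^ l) (((j : ℝ) + 2) / 2 ^ l)

theorem mem_cell3 {F : ℝ → ℝ} {l : ℕ} {j : ℤ} {x : ℝ} :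
    x ∈ cell3 F l j ↔ (j : ℝ) - 1 < F x * 2 ^ l ∧ F x * 2 ^ l ≤ j + 2 := by
  have hp : (0 : ℝ) < 2 ^ l := by positivity
  rw [cell3, mem_preimage, mem_Ioc, div_lt_iff₀ hp, le_div_iff₀ hp]

theorem Ioo_subset_cell3 {F : ℝ → ℝ} (hF : Monotone F) {l : ℕ} {j : ℤ} {y z : ℝ}
    (hy : y ∈ cell F l (j + (-1))) (hz : z ∈ cell F l (j + 1)) : Ioo y z ⊆ cell3 F l j := by
  intro u hu
  have hp : (0 : ℝ) < 2 ^ l := by positivity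
  rw [mem_cell] at hy hz
  push_cast at hy hz
  have h1 := mul_le_mul_of_nonneg_right (hF hu.1.le) hp.le
  have h2 := mul_le_mul_of_nonneg_right (hF hu.2.le) hp.le
  rw [mem_cell3]
  constructor <;> linarith [hy.1, hz.2]

theorem setIntegral_cell3 {F : ℝ → ℝ} (hF : Monotone F) {ψ : ℝ → ℝ} (hψ : Integrable ψ) (l : ℕ)
    (j : ℤ) : ∫ x in cell3 F l j, ψ x = (∫ x in cell F l (j + (-1)), ψ x) +
      (∫ x in cell F l j, ψ x) + ∫ x in cell F l (j + 1), ψ x := by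
  have e : cell3 F l j = (cell F l (j + (-1)) ∪ cell F l j) ∪ cell F l (j + 1) := by
    ext x
    simp only [mem_union, mem_cell, mem_cell3]
    push_cast
    constructor
    · rintro ⟨h1, h2⟩
      rcases le_or_gt (F x * 2 ^ l) j with h | h
      · exact Or.inl (Or.inl ⟨by linarith, by linarith⟩)
      · rcases le_or_gt (F x * 2 ^ l) (j + 1) with h' | h'
        · exact Or.inl (Or.inr ⟨h, h'⟩)
        · exact Or.inr ⟨h', by linarith⟩
    · rintro ((h | h) | h) <;> constructor <;> linarith [h.1, h.2]
  have d1 : Disjoint (cell F l (j + (-1))) (cell F l j) := cell_disjoint hF (by omega)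
  have d2 : Disjoint (cell F l (j + (-1)) ∪ cell F l j) (cell F l (j + 1)) :=
    Disjoint.union_left (cell_disjoint hF (by omega)) (cell_disjoint hF (by omega))
  rw [e, setIntegral_union d2 (measurableSet_cell hF _ _) hψ.integrableOn hψ.integrableOn,
    setIntegral_union d1 (measurableSet_cell hF _ _) hψ.integrableOn hψ.integrableOn]

theorem distFn_sub {f : ℝ → ℝ} (hf : IsDensity f) (x y : ℝ) :
    distFn f y - distFn f x = ∫ z in x..y, f z :=
  intervalIntegral.integral_Iic_sub_Iic hf.integrable.integrableOn hf.integrable.integrableOn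

theorem sub_le_of_distFn_sub {f : ℝ → ℝ} (hf : IsDensity f) {x y z w : ℝ} (hzy : z ≤ y)
    (hzx : z ≤ x) (hw : 0 < w) (h1 : w ≤ distFn f y - distFn f z)
    (h2 : distFn f x - distFn f z ≤ 4 * w)
    (hy : ∀ u ∈ Icc z y, f u ≤ 3 * f z) (hx : ∀ u ∈ Icc z x, f z ≤ 3 * f u) :
    x - z ≤ 36 * (y - z) := by
  rw [distFn_sub hf] at h1 h2
  have h3 : ∫ u in z..y, f u ≤ (y - z) * (3 * f z) := by
    have := intervalIntegral.integral_mono_on hzy (hf.integrable.intervalIntegrable)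
      intervalIntegrable_const (g := fun _ => 3 * f z) hy
    rwa [intervalIntegral.integral_const, smul_eq_mul] at this
  have h4 : (x - z) * (f z / 3) ≤ ∫ u in z..x, f u := by
    have := intervalIntegral.integral_mono_on hzx intervalIntegrable_const
      (hf.integrable.intervalIntegrable) (f := fun _ => f z / 3)
      (fun u hu => by linarith [hx u hu])
    rwa [intervalIntegral.integral_const, smul_eq_mul] at this
  have hz : 0 < f z := by
    rcases (hf.1 z).eq_or_lt with h | h
    · rw [← h] at h3; linarith
    · exact h
  refine le_of_mul_le_mul_right ?_ (show 0 < f z / 3 by positivity)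
  linarith

/-- A point at which `q` and `f₀` are comparable and `f` is close to `q`. -/
def GoodPt (f₀ q f : ℝ → ℝ) (c η y : ℝ) : Prop :=
  0 < f₀ y ∧ 0 < q y ∧ q y ≤ c * f₀ y ∧ f₀ y ≤ c * q y ∧
    |√(mixFn (q y) (f y) / q y) - 1| ≤ η

theorem IsDensity.measurable_hellFn {q f : ℝ → ℝ} (hq : IsDensity q) (hf : IsDensity f) :
    Measurable fun x => hellFn (q x) (f x) := by
  have h1 := hq.2.1
  have h2 := hf.2.1
  unfold hellFn mixFn
  fun_prop

theorem IsDensity.integrable_hellFn {q f : ℝ → ℝ} (hq : IsDensity q) (hf : IsDensity f) :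
    Integrable fun x => hellFn (q x) (f x) := by
  refine (hf.integrable.add hq.integrable).mono'
    (hq.measurable_hellFn hf).aestronglyMeasurable (Eventually.of_forall fun x => ?_)
  rw [Real.norm_of_nonneg (hellFn_nonneg _ _)]
  exact hellFn_le (hq.1 x) (hf.1 x)

theorem exists_goodPt {f₀ q f : ℝ → ℝ} (hf₀ : IsDensity f₀) (hq : IsDensity q) (hf : IsDensity f)
    (hκi : Integrable fun x => klFn (f₀ x) (q x)) (hκ0 : ∀ᵐ x, 0 ≤ klFn (f₀ x) (q x))
    {E : Set ℝ} (hE : MeasurableSet E) (hqE : ∀ x ∈ E, 0 < q x) {w Λ hbar : ℝ} (hw : 0 < w)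
    (hΛ : 0 < Λ) (hh : 0 < hbar) (hwE : ∫ x in E, f₀ x = w)
    (hκ : ∫ x in E, klFn (f₀ x) (q x) ≤ Λ * w) (hhE : ∫ x in E, hellFn (q x) (f x) ≤ hbar) :
    ∃ y ∈ E, GoodPt f₀ q f (Real.exp (4 * Λ + 2))
      (√(2 * Real.exp (4 * Λ + 2) * hbar / w)) y := by
  have hhi := hq.integrable_hellFn hf
  obtain ⟨y, hyE, hy0, _, hy⟩ := exists_mul_le_of_setIntegral_le (A := 2) (w := w)
    (ψ := fun x => klFn (f₀ x) (q x) * (Λ * w)⁻¹ + hellFn (q x) (f x) * hbar⁻¹) hE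
    hf₀.integrable.integrableOn ((hκi.mul_const _).add (hhi.mul_const _)).integrableOn hf₀.1
    (by
      rw [integral_add (hκi.mul_const _).integrableOn (hhi.mul_const _).integrableOn,
        integral_mul_const, integral_mul_const]
      have h1 : (∫ x in E, klFn (f₀ x) (q x)) * (Λ * w)⁻¹ ≤ 1 := by
        rw [← div_eq_mul_inv]; exact (div_le_one (by positivity)).2 hκ
      have h2 : (∫ x in E, hellFn (q x) (f x)) * hbar⁻¹ ≤ 1 := by
        rw [← div_eq_mul_inv]; exact (div_le_one hh).2 hhE
      linarith) hwE hw
    (by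
      filter_upwards [hκ0] with x hx
      have := hellFn_nonneg (q x) (f x)
      positivity)
  have hqy := hqE y hyE
  have hk := klFn_nonneg hy0.le hqy.le fun h => absurd h hqy.ne'
  have hn := hellFn_nonneg (q y) (f y)
  have hk2 : klFn (f₀ y) (q y) ≤ 2 * Λ * f₀ y := by
    have h1 : w * (klFn (f₀ y) (q y) * (Λ * w)⁻¹) ≤ 2 * f₀ y := by
      refine le_trans ?_ hy
      have : 0 ≤ hellFn (q y) (f y) * hbar⁻¹ := by positivity
      gcongr
      linarith
    have h2 : w * (klFn (f₀ y) (q y) * (Λ * w)⁻¹) = klFn (f₀ y) (q y) / Λ := by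
      field_simp
    rw [h2, div_le_iff₀ hΛ] at h1
    linarith
  have hh2 : hellFn (q y) (f y) * w ≤ 2 * hbar * f₀ y := by
    have h1 : w * (hellFn (q y) (f y) * hbar⁻¹) ≤ 2 * f₀ y := by
      refine le_trans ?_ hy
      have : 0 ≤ klFn (f₀ y) (q y) * (Λ * w)⁻¹ := by positivity
      gcongr
      linarith
    have h2 : w * (hellFn (q y) (f y) * hbar⁻¹) = hellFn (q y) (f y) * w / hbar := by
      field_simp
    rw [h2, div_le_iff₀ hh] at h1
    linarith
  obtain ⟨h3, h4⟩ := exp_neg_le_of_klFn_le hy0 hqy hk2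
  have h5 : f₀ y ≤ Real.exp (4 * Λ + 2) * q y := by
    have : f₀ y ≤ Real.exp (2 * Λ + 1) * q y := by
      rw [Real.exp_neg, inv_mul_le_iff₀ (Real.exp_pos _)] at h3
      exact h3
    exact this.trans (mul_le_mul_of_nonneg_right (Real.exp_le_exp.2 (by linarith)) hqy.le)
  refine ⟨y, hyE, hy0, hqy, ?_, h5, ?_⟩
  · convert h4 using 3; ring
  · rw [← Real.sqrt_sq_eq_abs]
    refine Real.sqrt_le_sqrt ?_
    rw [hellFn_eq_mul hqy] at hh2
    rw [le_div_iff₀ hw]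
    refine le_of_mul_le_mul_left ?_ hqy
    calc _ ≤ 2 * hbar * f₀ y := by linarith
      _ ≤ 2 * hbar * (Real.exp (4 * Λ + 2) * q y) := by gcongr
      _ = _ := by ring

theorem min_le_exp_affine {a b x y z : ℝ} (hyx : y ≤ x) (hxz : x ≤ z) :
    min (Real.exp (a * y + b)) (Real.exp (a * z + b)) ≤ Real.exp (a * x + b) := by
  rcases le_total 0 a with h | h
  · exact (min_le_left _ _).trans (Real.exp_le_exp.2 (by nlinarith))
  · exact (min_le_right _ _).trans (Real.exp_le_exp.2 (by nlinarith))

/-- A block of seven dyadic cells, away from the end points, on which `log q` is affine. -/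
structure IsBlock (f₀ q : ℝ → ℝ) (l : ℕ) (j : ℤ) (a b : ℝ) : Prop where
  lower : 8 ≤ j
  upper : j + 9 ≤ 2 ^ l
  eq_exp : ∀ i ∈ Finset.Icc (-3 : ℤ) 3, ∀ x ∈ cell (distFn f₀) l (j + i), q x = Real.exp (a * x + b)

theorem IsBlock.le_three_mul {f₀ q : ℝ → ℝ} {l : ℕ} {j : ℤ} {a b : ℝ} (hB : IsBlock f₀ q l j a b)
    (hf₀ : IsDensity f₀) (hl₀ : IsLogConcaveFn f₀) {x y : ℝ}
    (hx : distFn f₀ x * 2 ^ l ∈ Icc ((j : ℝ) - 3) (j + 4))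
    (hy : distFn f₀ y * 2 ^ l ∈ Icc ((j : ℝ) - 3) (j + 4)) : f₀ x ≤ 3 * f₀ y := by
  have hp : (0 : ℝ) < 2 ^ l := by positivity
  have h1 : (8 : ℝ) ≤ j := by exact_mod_cast hB.lower
  have h2 : (j : ℝ) + 9 ≤ 2 ^ l := by exact_mod_cast hB.upper
  refine IsLCDensity.le_mul_of_distFn_mem hf₀ hl₀ (s := ((j : ℝ) - 3) / 2 ^ l)
    (t := ((j : ℝ) + 4) / 2 ^ l) (div_pos (by linarith) hp) ((div_lt_one hp).2 (by linarith))
    ?_ ?_ ⟨(div_le_iff₀ hp).2 hx.1, (le_div_iff₀ hp).2 hx.2⟩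
    ⟨(div_le_iff₀ hp).2 hy.1, (le_div_iff₀ hp).2 hy.2⟩
  · rw [← mul_div_assoc]; gcongr; linarith
  · have e1 : 1 - ((j : ℝ) - 3) / 2 ^ l = (2 ^ l - (j - 3)) / 2 ^ l := by field_simp
    have e2 : 1 - ((j : ℝ) + 4) / 2 ^ l = (2 ^ l - (j + 4)) / 2 ^ l := by field_simp
    rw [e1, e2, ← mul_div_assoc]; gcongr; linarith

theorem mem_cell_bounds {F : ℝ → ℝ} {l : ℕ} {j i : ℤ} {x : ℝ} (hi : i ∈ Finset.Icc (-3 : ℤ) 3)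
    (hx : x ∈ cell F l (j + i)) : F x * 2 ^ l ∈ Icc ((j : ℝ) - 3) (j + 4) := by
  rw [mem_cell] at hx
  push_cast at hx
  rw [Finset.mem_Icc] at hi
  have c1 : (-3 : ℝ) ≤ i := by exact_mod_cast hi.1
  have c2 : (i : ℝ) ≤ 3 := by exact_mod_cast hi.2
  constructor <;> linarith [hx.1, hx.2]

section Block

variable {f₀ q f : ℝ → ℝ} {l : ℕ} {j : ℤ} {a b Λ η : ℝ}

theorem IsBlock.le_mul_q (hB : IsBlock f₀ q l j a b) (hf₀ : IsDensity f₀)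
    (hl₀ : IsLogConcaveFn f₀) {x y z u c : ℝ} (hc : 0 < c)
    (hx : x ∈ cell (distFn f₀) l j) (hy : y ∈ cell (distFn f₀) l (j + (-1)))
    (hz : z ∈ cell (distFn f₀) l (j + 1)) (hu : distFn f₀ u * 2 ^ l ∈ Icc ((j : ℝ) - 3) (j + 4))
    (gy : GoodPt f₀ q f c η y) (gz : GoodPt f₀ q f c η z) : f₀ u ≤ 3 * c * q x := by
  have hF := distFn_mono hf₀
  have hyx := cell_lt hF (by omega) hy hx
  have hxz := cell_lt hF (by omega) hx hz
  have hx' : x ∈ cell (distFn f₀) l (j + 0) := by rwa [add_zero]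
  have ex := hB.eq_exp 0 (by decide) x hx'
  have ey := hB.eq_exp (-1) (by decide) y hy
  have ez := hB.eq_exp 1 (by decide) z hz
  have hmin := min_le_exp_affine (a := a) (b := b) hyx.le hxz.le
  rw [← ex, ← ey, ← ez] at hmin
  have k1 := hB.le_three_mul hf₀ hl₀ hu (mem_cell_bounds (by decide) hy)
  have k2 := hB.le_three_mul hf₀ hl₀ hu (mem_cell_bounds (by decide) hz)
  have h3 := gy.2.2.2.1
  have h4 := gz.2.2.2.1
  rcases min_le_iff.1 hmin with h | h
  · nlinarith
  · nlinarith

theorem IsBlock.abs_log_le_of_small (hB : IsBlock f₀ q l j a b) (hf₀ : IsDensity f₀)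
    (hl₀ : IsLogConcaveFn f₀) (hl : IsLogConcaveFn f) (hη : η ≤ 1 / 12) {c x y z u : ℝ}
    (hx : x ∈ cell (distFn f₀) l j) (hy : y ∈ cell (distFn f₀) l (j + (-1)))
    (hz : z ∈ cell (distFn f₀) l (j + 1)) (hu : u ∈ cell (distFn f₀) l (j + (-3)))
    (gy : GoodPt f₀ q f c η y) (gz : GoodPt f₀ q f c η z) (gu : GoodPt f₀ q f c η u) :
    |Real.log (mixFn (q x) (f x) / q x)| ≤ 288 * η := by
  have hη0 : 0 ≤ η := (abs_nonneg _).trans gy.2.2.2.2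
  have hF := distFn_mono hf₀
  have hyx := cell_lt hF (by omega) hy hx
  have hxz := cell_lt hF (by omega) hx hz
  have huy := cell_lt hF (by omega) hu hy
  have hx' : x ∈ cell (distFn f₀) l (j + 0) := by rwa [add_zero]
  have ex := hB.eq_exp 0 (by decide) x hx'
  have ey := hB.eq_exp (-1) (by decide) y hy
  have ez := hB.eq_exp 1 (by decide) z hz
  have eu := hB.eq_exp (-3) (by decide) u hu
  have hqx : 0 < q x := by rw [ex]; exact Real.exp_pos _
  have nn : ∀ {v}, GoodPt f₀ q f c η v → 0 ≤ mixFn (q v) (f v) / q v := fun {v} hv =>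
    div_nonneg (mixFn_nonneg hv.2.1.le (hl.1 v)) hv.2.1.le
  obtain ⟨fy, ly⟩ := abs_log_le_of_abs_sqrt_sub_le gy.2.1 hη gy.2.2.2.2 (nn gy)
  obtain ⟨fz, lz⟩ := abs_log_le_of_abs_sqrt_sub_le gz.2.1 hη gz.2.2.2.2 (nn gz)
  obtain ⟨fu, lu⟩ := abs_log_le_of_abs_sqrt_sub_le gu.2.1 hη gu.2.2.2.2 (nn gu)
  rw [Real.log_div fy.ne' gy.2.1.ne', ey, Real.log_exp, abs_le] at ly
  rw [Real.log_div fz.ne' gz.2.1.ne', ez, Real.log_exp, abs_le] at lz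
  rw [Real.log_div fu.ne' gu.2.1.ne', eu, Real.log_exp, abs_le] at lu
  -- lower bound by concavity between `y` and `z`
  have hzy : 0 < z - y := by linarith
  have ht : (x - y) / (z - y) ∈ Icc (0 : ℝ) 1 :=
    ⟨div_nonneg (by linarith) hzy.le, (div_le_one hzy).2 (by linarith)⟩
  have hc1 := hl.log_concave ht fy fz
  have e1 : (1 - (x - y) / (z - y)) * y + (x - y) / (z - y) * z = x := by field_simp; ring
  rw [e1] at hc1
  obtain ⟨fx, hc1⟩ := hc1
  have hlow : -(4 * η) ≤ Real.log (f x) - (a * x + b) := by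
    set t := (x - y) / (z - y)
    have h1 := mul_le_mul_of_nonneg_left ly.1 (sub_nonneg.2 ht.2)
    have h2 := mul_le_mul_of_nonneg_left lz.1 ht.1
    have h3 : (1 - t) * (a * y + b) + t * (a * z + b) = a * x + b := by
      rw [← e1]; ring
    linarith
  -- upper bound by concavity along `u < y < x`
  have hp : (0 : ℝ) < 2 ^ l := by positivity
  have hxu : 0 < x - u := by linarith
  have hby := mem_cell_bounds (by decide) hy
  have hbx := mem_cell_bounds (by decide) hx'
  have hbu := mem_cell_bounds (by decide) hu
  have hmid : ∀ v ∈ Icc u x, distFn f₀ v * 2 ^ l ∈ Icc ((j : ℝ) - 3) (j + 4) := fun v hv =>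
    ⟨hbu.1.trans (mul_le_mul_of_nonneg_right (hF hv.1) hp.le),
      (mul_le_mul_of_nonneg_right (hF hv.2) hp.le).trans hbx.2⟩
  have hdist : x - u ≤ 36 * (y - u) := by
    have hy1 := hy
    have hx1 := hx
    have hu1 := hu
    rw [mem_cell] at hy1 hx1 hu1
    push_cast at hy1 hu1
    refine sub_le_of_distFn_sub hf₀ huy.le (huy.trans hyx).le (w := 1 / 2 ^ l) (by positivity)
      ?_ ?_ ?_ ?_
    · rw [div_le_iff₀ hp]; linarith [hy1.1, hu1.2]
    · rw [← mul_div_assoc, le_div_iff₀ hp]; linarith [hx1.2, hu1.1]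
    · intro v hv
      exact hB.le_three_mul hf₀ hl₀ (hmid v ⟨hv.1, hv.2.trans hyx.le⟩) hbu
    · intro v hv
      exact hB.le_three_mul hf₀ hl₀ hbu (hmid v hv)
  have hs : (y - u) / (x - u) ∈ Icc (0 : ℝ) 1 :=
    ⟨div_nonneg (by linarith) hxu.le, (div_le_one hxu).2 (by linarith)⟩
  have hc2 := (hl.log_concave hs fu fx).2
  have e2 : (1 - (y - u) / (x - u)) * u + (y - u) / (x - u) * x = y := by field_simp; ring
  rw [e2] at hc2
  have hs36 : 1 / 36 ≤ (y - u) / (x - u) := by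
    rw [le_div_iff₀ hxu]; linarith
  have hup : Real.log (f x) - (a * x + b) ≤ 288 * η := by
    set s := (y - u) / (x - u)
    have h1 := mul_le_mul_of_nonneg_left lu.1 (sub_nonneg.2 hs.2)
    have h3 : (1 - s) * (a * u + b) + s * (a * x + b) = a * y + b := by
      rw [← e2]; ring
    have h4 : s * (Real.log (f x) - (a * x + b)) ≤ 8 * η := by nlinarith [ly.2, hs.1, hs.2]
    have h5 : 8 * η ≤ s * (288 * η) := by nlinarith
    exact le_of_mul_le_mul_left (h4.trans h5) (by linarith)
  have hlogdiv : Real.log (f x / q x) = Real.log (f x) - (a * x + b) := by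
    rw [Real.log_div fx.ne' hqx.ne', ex, Real.log_exp]
  have hmix := log_div_le_log_mix hqx fx
  rw [hlogdiv] at hmix
  refine abs_le.2 ⟨by linarith, log_mix_div_le hqx fx.le (by positivity) ?_⟩
  rw [ex, ← Real.exp_add]
  have := (Real.log_le_iff_le_exp fx).1 (le_refl (Real.log (f x)))
  exact this.trans (Real.exp_le_exp.2 (by linarith))

theorem IsBlock.abs_log_le_of_large (hB : IsBlock f₀ q l j a b) (hf₀ : IsDensity f₀)
    (hl₀ : IsLogConcaveFn f₀) (hf : IsDensity f) (hl : IsLogConcaveFn f) (hΛ : 0 ≤ Λ)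
    (hη : 1 / 12 < η) {x y z : ℝ}
    (hx : x ∈ cell (distFn f₀) l j) (hy : y ∈ cell (distFn f₀) l (j + (-1)))
    (hz : z ∈ cell (distFn f₀) l (j + 1))
    (gy : GoodPt f₀ q f (Real.exp (4 * Λ + 2)) η y)
    (gz : GoodPt f₀ q f (Real.exp (4 * Λ + 2)) η z)
    (hS : ∫ u in cell3 (distFn f₀) l j, f u < 3 / 4) :
    |Real.log (mixFn (q x) (f x) / q x)| ≤ (400 + 96 * Λ) * η := by
  have hF := distFn_mono hf₀
  have hyx := cell_lt hF (by omega) hy hx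
  have hxz := cell_lt hF (by omega) hx hz
  have hx' : x ∈ cell (distFn f₀) l (j + 0) := by rwa [add_zero]
  have ex := hB.eq_exp 0 (by decide) x hx'
  have hqx : 0 < q x := by rw [ex]; exact Real.exp_pos _
  set c := Real.exp (4 * Λ + 2) with hc
  have hc0 : 0 < c := Real.exp_pos _
  have bound : ∀ v, distFn f₀ v * 2 ^ l ∈ Icc ((j : ℝ) - 3) (j + 4) → GoodPt f₀ q f c η v →
      8 * f v ≤ 36 * c ^ 2 * (1 + η) ^ 2 * q x := by
    intro v hv gv
    have h1 := hB.le_mul_q hf₀ hl₀ hc0 hx hy hz hv gy gz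
    have hm := mixFn_nonneg gv.2.1.le (hf.1 v)
    have h2 : mixFn (q v) (f v) / q v ≤ (1 + η) ^ 2 := by
      have h3 := (abs_le.1 gv.2.2.2.2).2
      have h4 : √(mixFn (q v) (f v) / q v) ≤ 1 + η := by linarith
      rwa [Real.sqrt_le_left (by linarith)] at h4
    rw [div_le_iff₀ gv.2.1] at h2
    unfold mixFn at h2
    have h5 : f v ≤ 3 / 2 * (1 + η) ^ 2 * q v := by linarith [gv.2.1]
    calc 8 * f v ≤ 8 * (3 / 2 * (1 + η) ^ 2 * (c * (3 * c * q x))) := by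
          have h6 : q v ≤ c * (3 * c * q x) :=
            gv.2.2.1.trans (mul_le_mul_of_nonneg_left h1 hc0.le)
          have : 3 / 2 * (1 + η) ^ 2 * q v ≤ 3 / 2 * (1 + η) ^ 2 * (c * (3 * c * q x)) :=
            mul_le_mul_of_nonneg_left h6 (by positivity)
          linarith
      _ = _ := by ring
  have hby := bound y (mem_cell_bounds (by decide) hy) gy
  have hbz := bound z (mem_cell_bounds (by decide) hz) gz
  have hfx : f x ≤ 36 * c ^ 2 * (1 + η) ^ 2 * q x := by
    by_contra hcon
    rw [not_le] at hcon
    have h0 : 0 < f x := lt_of_le_of_lt (by positivity) hcon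
    exact absurd (three_quarters_le_setIntegral hf hl hyx hxz h0 (hby.trans hcon.le)
      (hbz.trans hcon.le) (Ioo_subset_cell3 hF hy hz)) (not_le.2 hS)
  have hexp : 36 * c ^ 2 * (1 + η) ^ 2 ≤ Real.exp ((400 + 96 * Λ) * η) := by
    have h1 : (1 + η) ^ 2 ≤ Real.exp (2 * η) := by
      have := Real.add_one_le_exp η
      have h2 : Real.exp (2 * η) = Real.exp η ^ 2 := by rw [← Real.exp_nat_mul]; norm_num
      rw [h2]
      gcongr
      linarith
    have h2 : (36 : ℝ) ≤ Real.exp 4 := by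
      have := Real.exp_one_gt_d9
      have h3 : Real.exp 4 = Real.exp 1 ^ 4 := by rw [← Real.exp_nat_mul]; norm_num
      rw [h3]
      calc (36 : ℝ) ≤ 2.7182818283 ^ 4 := by norm_num
        _ ≤ _ := by gcongr
    have h3 : c ^ 2 = Real.exp (2 * (4 * Λ + 2)) := by
      rw [hc, ← Real.exp_nat_mul]; norm_num
    calc 36 * c ^ 2 * (1 + η) ^ 2 ≤ Real.exp 4 * Real.exp (2 * (4 * Λ + 2)) * Real.exp (2 * η) := by
          rw [h3]; gcongr
      _ = Real.exp (4 + 2 * (4 * Λ + 2) + 2 * η) := by rw [Real.exp_add, Real.exp_add]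
      _ ≤ _ := Real.exp_le_exp.2 (by nlinarith)
  have hlow := log_mix_div_ge hqx (hf.1 x)
  have hlog3 : Real.log 3 ≤ 2 := by
    have := Real.log_le_sub_one_of_pos (show (0 : ℝ) < 3 by norm_num)
    linarith
  refine abs_le.2 ⟨by nlinarith, log_mix_div_le hqx (hf.1 x) (by nlinarith) ?_⟩
  exact hfx.trans (mul_le_mul_of_nonneg_right hexp hqx.le)

theorem IsBlock.log_mix_le (hB : IsBlock f₀ q l j a b) (hf₀ : IsDensity f₀)
    (hl₀ : IsLogConcaveFn f₀) (hf : IsDensity f) (hΛ : 0 ≤ Λ) {S M : ℝ} (hS0 : 0 < S)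
    (hS : ∀ x, S * min (distFn f₀ x) (1 - distFn f₀ x) ≤ f₀ x) (hM : 0 ≤ M)
    (hfM : ∀ x, f x ≤ S * Real.exp M) {x y z : ℝ}
    (hx : x ∈ cell (distFn f₀) l j) (hy : y ∈ cell (distFn f₀) l (j + (-1)))
    (hz : z ∈ cell (distFn f₀) l (j + 1))
    (gy : GoodPt f₀ q f (Real.exp (4 * Λ + 2)) η y)
    (gz : GoodPt f₀ q f (Real.exp (4 * Λ + 2)) η z) :
    Real.log (mixFn (q x) (f x) / q x) ≤ M + (4 * Λ + 2) + l := by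
  have hx' : x ∈ cell (distFn f₀) l (j + 0) := by rwa [add_zero]
  have ex := hB.eq_exp 0 (by decide) x hx'
  have hqx : 0 < q x := by rw [ex]; exact Real.exp_pos _
  refine log_mix_div_le hqx (hf.1 x) (by positivity) ?_
  have hp : (0 : ℝ) < 2 ^ l := by positivity
  have h1 : (8 : ℝ) ≤ j := by exact_mod_cast hB.lower
  have h2 : (j : ℝ) + 9 ≤ 2 ^ l := by exact_mod_cast hB.upper
  have hxc := hx
  rw [mem_cell] at hxc
  have h3 := hB.le_mul_q hf₀ hl₀ (Real.exp_pos _) hx hy hz (mem_cell_bounds (by decide) hx') gy gz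
  have h4 : 3 / 2 ^ l ≤ min (distFn f₀ x) (1 - distFn f₀ x) := by
    rw [le_min_iff, div_le_iff₀ hp, div_le_iff₀ hp]
    constructor <;> linarith [hxc.1, hxc.2]
  have h5 : S * (3 / 2 ^ l) ≤ 3 * Real.exp (4 * Λ + 2) * q x :=
    ((mul_le_mul_of_nonneg_left h4 hS0.le).trans (hS x)).trans h3
  have h6 : S ≤ Real.exp (4 * Λ + 2) * q x * 2 ^ l := by
    rw [← mul_div_assoc, div_le_iff₀ hp] at h5
    linarith
  have h7 : (2 : ℝ) ^ l ≤ Real.exp l := by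
    have : Real.exp (l : ℝ) = Real.exp 1 ^ l := by rw [← Real.exp_nat_mul, mul_one]
    rw [this]
    gcongr
    have := Real.add_one_le_exp (1 : ℝ)
    linarith
  calc f x ≤ S * Real.exp M := hfM x
    _ ≤ Real.exp (4 * Λ + 2) * q x * 2 ^ l * Real.exp M := by gcongr
    _ ≤ Real.exp (4 * Λ + 2) * q x * Real.exp l * Real.exp M := by gcongr
    _ = _ := by rw [Real.exp_add (M + (4 * Λ + 2)), Real.exp_add M (4 * Λ + 2)]; ring

end Block

theorem le_of_not_spike {f₀ f : ℝ → ℝ} (hf₀ : IsDensity f₀) (hl₀ : IsLogConcaveFn f₀)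
    (hf : IsDensity f) (hl : IsLogConcaveFn f) {L : ℕ} {e : ℤ} (h2 : 2 ≤ e) (h3 : e + 3 ≤ 2 ^ L)
    {b : ℝ} (hb1 : ∫ x in cell (distFn f₀) L (e + (-1)), f x ≤ b)
    (hb2 : ∫ x in cell (distFn f₀) L (e + 1), f x ≤ b)
    (hS : ∫ u in cell3 (distFn f₀) L e, f u < 3 / 4) {x : ℝ} (hx : x ∈ cell (distFn f₀) L e) :
    f x ≤ 32 * (b * 2 ^ L) * f₀ x := by
  have hF := distFn_mono hf₀
  have hp : (0 : ℝ) < 2 ^ L := by positivity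
  have h2' : (2 : ℝ) ≤ e := by exact_mod_cast h2
  have h3' : (e : ℝ) + 3 ≤ 2 ^ L := by exact_mod_cast h3
  have hb0 : 0 ≤ b := (hf.setIntegral_nonneg _).trans hb1
  by_contra hcon
  rw [not_le] at hcon
  have h0 : 0 < f x := lt_of_le_of_lt (mul_nonneg (by positivity) (hf₀.1 x)) hcon
  have key : ∀ i : ℤ, i ∈ Finset.Icc (-1 : ℤ) 1 → ∫ x in cell (distFn f₀) L (e + i), f x ≤ b →
      ∃ y ∈ cell (distFn f₀) L (e + i), 8 * f y ≤ f x := by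
    intro i hi hbi
    rw [Finset.mem_Icc] at hi
    have hw : ∫ x in cell (distFn f₀) L (e + i), f₀ x = 1 / 2 ^ L := by
      rw [← hf₀.real_densMeas (measurableSet_cell hF _ _)]
      exact real_densMeas_cell hf₀ (by omega) (by omega)
    obtain ⟨y, hy, -, -, hy2⟩ := exists_mul_le_of_setIntegral_le (measurableSet_cell hF _ _)
      hf₀.integrable.integrableOn hf.integrable.integrableOn hf₀.1 hbi hw (by positivity)
      (Eventually.of_forall hf.1)
    refine ⟨y, hy, ?_⟩
    have c1 : (-1 : ℝ) ≤ i := by exact_mod_cast hi.1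
    have c2 : (i : ℝ) ≤ 1 := by exact_mod_cast hi.2
    have hy' := hy
    have hx' := hx
    rw [mem_cell] at hy' hx'
    push_cast at hy'
    have hcmp : f₀ y ≤ 4 * f₀ x := by
      refine IsLCDensity.le_mul_of_distFn_mem hf₀ hl₀ (s := ((e : ℝ) - 1) / 2 ^ L)
        (t := ((e : ℝ) + 2) / 2 ^ L) (div_pos (by linarith) hp) ((div_lt_one hp).2 (by linarith))
        ?_ ?_ ⟨(div_le_iff₀ hp).2 (by linarith), (le_div_iff₀ hp).2 (by linarith)⟩
        ⟨(div_le_iff₀ hp).2 (by linarith), (le_div_iff₀ hp).2 (by linarith)⟩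
      · rw [← mul_div_assoc]; gcongr; linarith
      · have e1 : 1 - ((e : ℝ) - 1) / 2 ^ L = (2 ^ L - (e - 1)) / 2 ^ L := by field_simp
        have e2 : 1 - ((e : ℝ) + 2) / 2 ^ L = (2 ^ L - (e + 2)) / 2 ^ L := by field_simp
        rw [e1, e2, ← mul_div_assoc]; gcongr; linarith
    have h5 : b * f₀ y ≤ b * (4 * f₀ x) := mul_le_mul_of_nonneg_left hcmp hb0
    rw [div_mul_eq_mul_div, one_mul, div_le_iff₀ hp] at hy2
    have h6 : b * f₀ y * 2 ^ L ≤ b * (4 * f₀ x) * 2 ^ L := by gcongr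
    linarith
  obtain ⟨y, hy, hy8⟩ := key (-1) (by decide) hb1
  obtain ⟨z, hz, hz8⟩ := key 1 (by decide) hb2
  exact absurd (three_quarters_le_setIntegral hf hl (cell_lt hF (by omega) hy hx)
    (cell_lt hF (by omega) hx hz) h0 hy8 hz8 (Ioo_subset_cell3 hF hy hz)) (not_le.2 hS)

section MLE

theorem sum_elog_of_pos {ι : Type*} (s : Finset ι) {g : ι → ℝ} (h : ∀ i ∈ s, 0 < g i) :
    ∑ i ∈ s, elog (g i) = ((∑ i ∈ s, Real.log (g i) : ℝ) : EReal) := by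
  induction s using Finset.induction_on with
  | empty => simp
  | insert a s ha ih =>
    rw [Finset.sum_insert ha, Finset.sum_insert ha, EReal.coe_add,
      ih fun i hi => h i (Finset.mem_insert_of_mem hi)]
    congr 1
    simp [elog, not_le.2 (h a (Finset.mem_insert_self a s))]

variable {n : ℕ} {xs : Fin n → ℝ} {f : ℝ → ℝ}

theorem IsMLE1.pos (hf : IsMLE1 xs f) {h : ℝ → ℝ} (hh : IsLCDensity h) (hpos : ∀ i, 0 < h (xs i))
    (i : Fin n) : 0 < f (xs i) := by
  by_contra hi
  have h1 := hf.2 h hh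
  rw [sum_elog_of_pos _ fun i _ => hpos i,
    ← Finset.add_sum_erase _ (fun i => elog (f (xs i))) (Finset.mem_univ i),
    show elog (f (xs i)) = ⊥ from if_pos (not_lt.1 hi), EReal.bot_add] at h1
  exact EReal.coe_ne_bot _ (le_bot_iff.1 h1)

theorem IsMLE1.sum_log_le (hf : IsMLE1 xs f) {h : ℝ → ℝ} (hh : IsLCDensity h)
    (hpos : ∀ i, 0 < h (xs i)) : ∑ i, Real.log (h (xs i)) ≤ ∑ i, Real.log (f (xs i)) := by
  have h1 := hf.2 h hh
  rw [sum_elog_of_pos _ fun i _ => hpos i, sum_elog_of_pos _ fun i _ => hf.pos hh hpos i] at h1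
  exact_mod_cast h1

theorem IsLCDensity.spread (hf : IsLCDensity f) (m : ℝ) :
    IsLCDensity fun y => 1 / 2 * f (y * (1 / 2) + m / 2) := by
  obtain ⟨hd, hu, hl⟩ := hf
  have hc : Continuous fun y : ℝ => y * (1 / 2) + m / 2 := by fun_prop
  have hnn : ∀ x, 0 ≤ 1 / 2 * f (x * (1 / 2) + m / 2) := fun x => by
    have := hd.1 (x * (1 / 2) + m / 2); positivity
  refine ⟨⟨hnn, (hd.2.1.comp hc.measurable).const_mul _, ?_⟩, ?_, hnn, ?_⟩
  · have hi : Integrable fun x => 1 / 2 * f (x * (1 / 2) + m / 2) := by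
      have h1 : Integrable fun x => f (x + m / 2) := hd.integrable.comp_add_right (m / 2)
      exact (h1.comp_mul_right' (R := 1 / 2) (by norm_num)).const_mul _
    rw [← ofReal_integral_eq_lintegral_ofReal hi (ae_of_all _ hnn), integral_const_mul]
    have h2 := Measure.integral_comp_mul_right (fun x => f (x + m / 2)) (1 / 2)
    rw [h2, integral_add_right_eq_self (fun x => f x), hd.integral_eq_one]
    norm_num
  · have h1 : UpperSemicontinuous fun y : ℝ => f (y * (1 / 2) + m / 2) := hu.comp hc
    exact (continuous_const.mul continuous_id
      : Continuous fun y : ℝ => 1 / 2 * y).comp_upperSemicontinuous h1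
      fun a b hab => by dsimp; linarith
  · intro x y t ht
    have h1 := hl.2 (x * (1 / 2) + m / 2) (y * (1 / 2) + m / 2) t ht
    have e : ((1 - t) • x + t • y) * (1 / 2) + m / 2 =
        (1 - t) • (x * (1 / 2) + m / 2) + t • (y * (1 / 2) + m / 2) := by
      simp only [smul_eq_mul]; ring
    dsimp only
    rw [e, Real.mul_rpow (by norm_num) (hd.1 _), Real.mul_rpow (by norm_num) (hd.1 _)]
    calc _ = ((1 / 2 : ℝ) ^ (1 - t) * (1 / 2) ^ t) * (f (x * (1 / 2) + m / 2) ^ (1 - t) *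
          f (y * (1 / 2) + m / 2) ^ t) := by ring
      _ = 1 / 2 * (f (x * (1 / 2) + m / 2) ^ (1 - t) * f (y * (1 / 2) + m / 2) ^ t) := by
          rw [← Real.rpow_add (by norm_num)]; norm_num
      _ ≤ _ := by gcongr

/-- Under the maximum likelihood estimator, at least two observations carry a density comparable
to any upper bound that is attained. -/
theorem IsMLE1.exists_pair (hn : 2 ≤ n) (hf : IsMLE1 xs f) (hpos : ∀ i, 0 < f (xs i)) {m : ℝ}
    (hm : ∀ i, f (xs i) ≤ f m) :
    ∃ i j, i ≠ j ∧ f m ≤ Real.exp 3 * f (xs i) ∧ f m ≤ Real.exp 3 * f (xs j) := by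
  have : Nonempty (Fin n) := ⟨⟨0, by omega⟩⟩
  have hm0 : 0 < f m := (hpos (Classical.arbitrary _)).trans_le (hm _)
  have hmid : ∀ i, 0 < f (xs i * (1 / 2) + m / 2) ∧
      1 / 2 * Real.log (f m) + 1 / 2 * Real.log (f (xs i)) ≤
        Real.log (f (xs i * (1 / 2) + m / 2)) := fun i => by
    have := hf.1.2.2.log_concave (t := 1 / 2) (by norm_num) hm0 (hpos i)
    have e : (1 - 1 / 2) * m + 1 / 2 * xs i = xs i * (1 / 2) + m / 2 := by ring
    rw [e] at this
    norm_num at this ⊢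
    exact this
  have hsum := hf.sum_log_le (hf.1.spread m) fun i => by have := (hmid i).1; positivity
  have h1 : ∑ i, (Real.log (f m) - Real.log (f (xs i))) ≤ ∑ _i : Fin n, 2 * Real.log 2 := by
    have h2 : ∑ i, (1 / 2 * (Real.log (f m) - Real.log (f (xs i))) - Real.log 2) ≤ 0 := by
      calc _ ≤ ∑ i, (Real.log (1 / 2 * f (xs i * (1 / 2) + m / 2)) - Real.log (f (xs i))) := by
            refine Finset.sum_le_sum fun i _ => ?_
            rw [Real.log_mul (by norm_num) (hmid i).1.ne', one_div, Real.log_inv]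
            have := (hmid i).2
            linarith
        _ ≤ 0 := by rw [Finset.sum_sub_distrib]; linarith
    rw [Finset.sum_sub_distrib, ← Finset.mul_sum] at h2
    rw [← Finset.mul_sum]
    linarith
  obtain ⟨i₀, -, hi₀⟩ := Finset.exists_max_image Finset.univ (fun i => f (xs i))
    Finset.univ_nonempty
  have hi₀' : ∀ j, Real.log (f (xs j)) ≤ Real.log (f (xs i₀)) := fun j =>
    Real.log_le_log (hpos j) (hi₀ j (Finset.mem_univ j))
  have conv : ∀ i, Real.log (f m) - Real.log (f (xs i)) ≤ 3 → f m ≤ Real.exp 3 * f (xs i) := by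
    intro i hi
    rw [← Real.exp_log hm0, ← Real.exp_log (hpos i), ← Real.exp_add]
    exact Real.exp_le_exp.2 (by simpa using by linarith)
  by_contra hcon
  push Not at hcon
  have h3 : ∀ j, j ≠ i₀ → 3 < Real.log (f m) - Real.log (f (xs j)) := by
    intro j hj
    by_contra h
    push Not at h
    exact absurd (conv j h) (not_le.2 (hcon i₀ j hj.symm (conv i₀ (by linarith [hi₀' j]))))
  rw [Finset.sum_const, Finset.card_univ, Fintype.card_fin, nsmul_eq_mul,
    ← Finset.add_sum_erase _ _ (Finset.mem_univ i₀)] at h1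
  have h4 : ((n : ℝ) - 1) * 3 ≤
      ∑ i ∈ Finset.univ.erase i₀, (Real.log (f m) - Real.log (f (xs i))) := by
    have := Finset.card_nsmul_le_sum (Finset.univ.erase i₀)
      (fun i => Real.log (f m) - Real.log (f (xs i))) 3
      fun i hi => (h3 i (Finset.ne_of_mem_erase hi)).le
    rw [Finset.card_erase_of_mem (Finset.mem_univ i₀), Finset.card_univ, Fintype.card_fin,
      nsmul_eq_mul, Nat.cast_sub (by omega)] at this
    simpa using this
  have h5 : Real.log (f (xs i₀)) ≤ Real.log (f m) := Real.log_le_log (hpos _) (hm _)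
  have h6 : (2 : ℝ) ≤ n := by exact_mod_cast hn
  nlinarith [Real.log_two_lt_d9]

/-- The spacing statistic that controls the height of the maximum likelihood estimator. -/
def spacing (S : ℝ) (xs : Fin n → ℝ) : ℝ :=
  2 * ((n : ℝ) ^ 4)⁻¹ * ∑ p ∈ Finset.univ.offDiag, pairKer S (xs p.1) (xs p.2)

theorem spacing_nonneg {S : ℝ} (hS : 0 < S) (xs : Fin n → ℝ) : 0 ≤ spacing S xs :=
  mul_nonneg (by positivity) (Finset.sum_nonneg fun p _ => pairKer_nonneg hS _ _)

theorem log_le_log_add_inv_mul {a s : ℝ} (ha : 0 < a) (hs : 0 < s) :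
    Real.log s ≤ Real.log a + a⁻¹ * s := by
  have h1 := Real.log_le_sub_one_of_pos (mul_pos (inv_pos.2 ha) hs)
  rw [Real.log_mul (inv_ne_zero ha.ne') hs.ne', Real.log_inv] at h1
  linarith

theorem mul_abs_sub_le_one (hd : IsDensity f) (hl : IsLogConcaveFn f) {x y c : ℝ}
    (hx : c ≤ f x) (hy : c ≤ f y) : c * |x - y| ≤ 1 := by
  wlog hxy : x ≤ y generalizing x y
  · rw [abs_sub_comm]; exact this hy hx (le_of_not_ge hxy)
  rw [abs_sub_comm, abs_of_nonneg (by linarith)]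
  calc c * (y - x) = ∫ _z in Icc x y, c := by
        rw [setIntegral_const, Real.volume_real_Icc_of_le hxy, smul_eq_mul, mul_comm]
    _ ≤ ∫ z in Icc x y, f z := by
        refine setIntegral_mono_on (by simp) hd.integrable.integrableOn
          measurableSet_Icc fun z hz => ?_
        exact (le_min hx hy).trans (hl.min_le hz.1 hz.2)
    _ ≤ 1 := hd.setIntegral_le_one _

theorem IsMLE1.le_height (hn : 2 ≤ n) (hf : IsMLE1 xs f) (hpos : ∀ i, 0 < f (xs i))
    (hinj : Function.Injective xs) {S : ℝ} (hS : 0 < S) (x : ℝ) :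
    f x ≤ S * Real.exp (3 + 8 * Real.log n + spacing S xs) := by
  have : Nonempty (Fin n) := ⟨⟨0, by omega⟩⟩
  obtain ⟨i₀, -, hi₀⟩ := Finset.exists_max_image Finset.univ (fun i => f (xs i))
    Finset.univ_nonempty
  obtain ⟨m, hm, hxm⟩ : ∃ m, (∀ i, f (xs i) ≤ f m) ∧ f x ≤ f m := by
    rcases le_total (f x) (f (xs i₀)) with h | h
    · exact ⟨xs i₀, fun i => hi₀ i (Finset.mem_univ i), h⟩
    · exact ⟨x, fun i => (hi₀ i (Finset.mem_univ i)).trans h, le_rfl⟩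
  refine hxm.trans ?_
  obtain ⟨i, j, hij, hi, hj⟩ := hf.exists_pair hn hpos hm
  have hd : 0 < |xs i - xs j| := abs_pos.2 (sub_ne_zero.2 (hinj.ne hij))
  have hn0 : (0 : ℝ) < n := by exact_mod_cast (by omega : 0 < n)
  have he := Real.exp_pos 3
  have h1 : f m * |xs i - xs j| ≤ Real.exp 3 := by
    have := mul_abs_sub_le_one hf.1.1 hf.1.2.2 (c := f m / Real.exp 3) (x := xs i) (y := xs j)
      ((div_le_iff₀' he).2 hi) ((div_le_iff₀' he).2 hj)
    rwa [div_mul_eq_mul_div, div_le_one he] at this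
  set s := pairKer S (xs i) (xs j) with hs
  have hs0 : 0 < s := Real.rpow_pos_of_pos (by positivity) _
  have hlog : Real.log s = -(1 / 2) * Real.log (S * |xs i - xs j|) :=
    Real.log_rpow (by positivity) _
  have hle : 2 * (((n : ℝ) ^ 4)⁻¹ * s) ≤ spacing S xs := by
    rw [spacing, ← mul_assoc]
    refine mul_le_mul_of_nonneg_left ?_ (by positivity)
    exact Finset.single_le_sum (f := fun p : Fin n × Fin n => pairKer S (xs p.1) (xs p.2))
      (fun p _ => pairKer_nonneg hS _ _) (a := (i, j)) (by simp [hij])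
  have h2 := log_le_log_add_inv_mul (a := (n : ℝ) ^ 4) (by positivity) hs0
  rw [Real.log_pow] at h2
  push_cast at h2
  have h3 : f m ≤ Real.exp 3 / |xs i - xs j| := (le_div_iff₀ hd).2 h1
  calc f m ≤ Real.exp 3 / |xs i - xs j| := h3
    _ = S * Real.exp (3 - Real.log (S * |xs i - xs j|)) := by
        rw [Real.exp_sub, Real.exp_log (by positivity)]
        field_simp
    _ ≤ _ := by
        gcongr
        linarith

theorem neg_log_le_edgeWeight {f₀ : ℝ → ℝ} {S : ℝ} (hS : 0 < S) {x : ℝ}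
    (hx : S * min (distFn f₀ x) (1 - distFn f₀ x) ≤ f₀ x) (h0 : 0 < distFn f₀ x)
    (h1 : distFn f₀ x < 1) (hn : 0 < n) :
    -Real.log (f₀ x) ≤ -Real.log S + 4 * Real.log n + 2 * ((n : ℝ) ^ 2)⁻¹ * edgeWeight f₀ x := by
  have hn0 : (0 : ℝ) < n := by exact_mod_cast hn
  have h1' : 0 < 1 - distFn f₀ x := by linarith
  set v := min (distFn f₀ x) (1 - distFn f₀ x) with hv
  have hv0 : 0 < v := lt_min h0 h1'
  have h2 : Real.log S + Real.log v ≤ Real.log (f₀ x) := by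
    rw [← Real.log_mul hS.ne' hv0.ne']
    exact Real.log_le_log (by positivity) hx
  have h3 : v ^ (-(1 / 2) : ℝ) ≤ edgeWeight f₀ x := by
    have p1 := Real.rpow_nonneg h0.le (-(1 / 2) : ℝ)
    have p2 := Real.rpow_nonneg h1'.le (-(1 / 2) : ℝ)
    rw [edgeWeight]
    rcases min_choice (distFn f₀ x) (1 - distFn f₀ x) with h | h <;> rw [hv, h] <;> linarith
  have h4 := log_le_log_add_inv_mul (a := (n : ℝ) ^ 2) (s := v ^ (-(1 / 2) : ℝ)) (by positivity)
    (Real.rpow_pos_of_pos hv0 _)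
  rw [Real.log_pow, Real.log_rpow hv0] at h4
  push_cast at h4
  have h5 : ((n : ℝ) ^ 2)⁻¹ * v ^ (-(1 / 2) : ℝ) ≤ ((n : ℝ) ^ 2)⁻¹ * edgeWeight f₀ x :=
    mul_le_mul_of_nonneg_left h3 (by positivity)
  nlinarith

theorem IsMLE1.log_div_le (hn : 2 ≤ n) (hf : IsMLE1 xs f) (hpos : ∀ i, 0 < f (xs i))
    (hinj : Function.Injective xs) {S : ℝ} (hS : 0 < S) {f₀ : ℝ → ℝ}
    (h₀ : ∀ x, S * min (distFn f₀ x) (1 - distFn f₀ x) ≤ f₀ x) {x : ℝ} (hfx : 0 < f x)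
    (hfx₀ : 0 < f₀ x) (h0 : 0 < distFn f₀ x) (h1 : distFn f₀ x < 1) :
    Real.log (f x / f₀ x) ≤ 3 + 12 * Real.log n + spacing S xs +
      2 * ((n : ℝ) ^ 2)⁻¹ * edgeWeight f₀ x := by
  rw [Real.log_div hfx.ne' hfx₀.ne']
  have h2 := neg_log_le_edgeWeight hS (h₀ x) h0 h1 (by omega : 0 < n)
  have h3 := Real.log_le_log hfx (hf.le_height hn hpos hinj hS x)
  rw [Real.log_mul hS.ne' (Real.exp_pos _).ne', Real.log_exp] at h3
  linarith

end MLE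

/-! ### Deterministic control of the log-likelihood ratio -/

/-- Standing assumptions on the true density `f₀`, the approximant `q` and the estimator `f`. -/
structure IsTriple (f₀ q f : ℝ → ℝ) : Prop where
  dens₀ : IsDensity f₀
  lc₀ : IsLogConcaveFn f₀
  densq : IsDensity q
  dens : IsDensity f
  lc : IsLogConcaveFn f
  ac : ∀ᵐ x : ℝ, q x = 0 → f₀ x = 0
  int : Integrable fun x => f₀ x * Real.log (f₀ x / q x)

section Triple

variable {f₀ q f : ℝ → ℝ}

theorem IsTriple.integrable_klFn (h : IsTriple f₀ q f) : Integrable fun x => klFn (f₀ x) (q x) :=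
  (h.int.sub h.dens₀.integrable).add h.densq.integrable

theorem IsTriple.klFn_nonneg (h : IsTriple f₀ q f) : ∀ᵐ x : ℝ, 0 ≤ klFn (f₀ x) (q x) := by
  filter_upwards [h.ac] with x hx
  exact _root_.klFn_nonneg (h.dens₀.1 x) (h.densq.1 x) hx

theorem IsTriple.integral_klFn (h : IsTriple f₀ q f) :
    ∫ x, klFn (f₀ x) (q x) = ∫ x, f₀ x * Real.log (f₀ x / q x) := by
  have : ∫ x, klFn (f₀ x) (q x) = ∫ x, (f₀ x * Real.log (f₀ x / q x) - f₀ x + q x) := rfl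
  have hi : Integrable fun x => f₀ x * Real.log (f₀ x / q x) - f₀ x :=
    h.int.sub h.dens₀.integrable
  rw [this, integral_add hi h.densq.integrable,
    integral_sub h.int h.dens₀.integrable, h.dens₀.integral_eq_one, h.densq.integral_eq_one]
  ring

theorem IsTriple.integrable_hellFn (h : IsTriple f₀ q f) :
    Integrable fun x => hellFn (q x) (f x) := h.densq.integrable_hellFn h.dens

theorem IsTriple.measurable_log_mix (h : IsTriple f₀ q f) :
    Measurable fun x => Real.log (mixFn (q x) (f x) / q x) := by
  have h1 := h.densq.2.1
  have h2 := h.dens.2.1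
  unfold mixFn
  fun_prop

/-- A block on which `q` is moreover close to `f₀` in relative entropy. -/
structure IsTameBlock (f₀ q : ℝ → ℝ) (Λ : ℝ) (l : ℕ) (j : ℤ) (a b : ℝ) : Prop
    extends IsBlock f₀ q l j a b where
  kl_le : ∀ i ∈ Finset.Icc (-3 : ℤ) 3,
    ∫ x in cell (distFn f₀) l (j + i), klFn (f₀ x) (q x) ≤ Λ * (1 / 2 ^ l)

variable {l : ℕ} {j : ℤ} {a b Λ : ℝ}

theorem IsTameBlock.exists_goodPt (hB : IsTameBlock f₀ q Λ l j a b) (h : IsTriple f₀ q f)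
    (hΛ : 0 < Λ) {hbar : ℝ} (hh : 0 < hbar) {i : ℤ} (hi : i ∈ Finset.Icc (-3 : ℤ) 3)
    (hle : ∫ x in cell (distFn f₀) l (j + i), hellFn (q x) (f x) ≤ hbar) :
    ∃ y ∈ cell (distFn f₀) l (j + i), GoodPt f₀ q f (Real.exp (4 * Λ + 2))
      (√(2 * Real.exp (4 * Λ + 2) * hbar / (1 / 2 ^ l))) y := by
  have hF := distFn_mono h.dens₀
  have hm := measurableSet_cell hF l (j + i)
  have hlow := hB.lower
  have hup := hB.upper
  have hi' := Finset.mem_Icc.1 hi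
  refine _root_.exists_goodPt h.dens₀ h.densq h.dens h.integrable_klFn h.klFn_nonneg hm ?_
    (by positivity) hΛ hh ?_ (hB.kl_le i hi) hle
  · intro x hx
    rw [hB.eq_exp i hi x hx]
    exact Real.exp_pos _
  · rw [← h.dens₀.real_densMeas hm, real_densMeas_cell h.dens₀ (by omega) (by omega)]

theorem IsBlock.quasiconcave (hB : IsBlock f₀ q l j a b) (h : IsTriple f₀ q f) :
    ∀ x ∈ cell (distFn f₀) l j, ∀ y ∈ cell (distFn f₀) l j, ∀ z, x ≤ z → z ≤ y →
      min (Real.log (mixFn (q x) (f x) / q x)) (Real.log (mixFn (q y) (f y) / q y)) ≤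
        Real.log (mixFn (q z) (f z) / q z) := by
  intro x hx y hy z hxz hzy
  have hz := (cell_ordConnected (distFn_mono h.dens₀) l j).out hx hy ⟨hxz, hzy⟩
  have eq : ∀ u ∈ cell (distFn f₀) l j, q u = Real.exp (a * u + b) := fun u hu =>
    hB.eq_exp 0 (by decide) u (by rwa [add_zero])
  have pos : ∀ u ∈ cell (distFn f₀) l j, 0 < q u := fun u hu => by
    rw [eq u hu]; exact Real.exp_pos _
  have key : min (f x / q x) (f y / q y) ≤ f z / q z := by
    have hlc : IsLogConcaveFn fun u => f u * Real.exp (-(a * u + b)) := by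
      refine ⟨fun u => mul_nonneg (h.lc.1 u) (Real.exp_pos _).le, fun u v t ht => ?_⟩
      have h1 := h.lc.2 u v t ht
      rw [Real.mul_rpow (h.lc.1 u) (Real.exp_pos _).le,
        Real.mul_rpow (h.lc.1 v) (Real.exp_pos _).le,
        ← Real.exp_mul, ← Real.exp_mul]
      have e : Real.exp (-(a * ((1 - t) • u + t • v) + b)) =
          Real.exp (-(a * u + b) * (1 - t)) * Real.exp (-(a * v + b) * t) := by
        rw [← Real.exp_add]; congr 1; simp only [smul_eq_mul]; ring
      dsimp only
      rw [e]
      calc _ = f u ^ (1 - t) * f v ^ t *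
            (Real.exp (-(a * u + b) * (1 - t)) * Real.exp (-(a * v + b) * t)) := by ring
        _ ≤ _ := by gcongr
    have h2 := hlc.min_le hxz hzy
    simp only [Real.exp_neg] at h2
    rwa [← eq x hx, ← eq y hy, ← eq z hz, ← div_eq_mul_inv, ← div_eq_mul_inv, ← div_eq_mul_inv]
      at h2
  have mono : ∀ u ∈ cell (distFn f₀) l j, f u / q u ≤ f z / q z →
      Real.log (mixFn (q u) (f u) / q u) ≤ Real.log (mixFn (q z) (f z) / q z) := by
    intro u hu hle
    rw [mix_div_eq (pos u hu), mix_div_eq (pos z hz)]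
    have := div_nonneg (h.lc.1 u) (pos u hu).le
    exact Real.log_le_log (by positivity) (by linarith)
  rcases min_le_iff.1 key with hle | hle
  · exact (min_le_left _ _).trans (mono x hx hle)
  · exact (min_le_right _ _).trans (mono y hy hle)

/-- Total Hellinger mass of the seven cells around cell `j`. -/
def hellAround (f₀ q f : ℝ → ℝ) (l : ℕ) (j : ℤ) : ℝ :=
  ∑ i ∈ Finset.Icc (-3 : ℤ) 3, ∫ x in cell (distFn f₀) l (j + i), hellFn (q x) (f x)

theorem hellAround_nonneg (f₀ q f : ℝ → ℝ) (l : ℕ) (j : ℤ) : 0 ≤ hellAround f₀ q f l j :=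
  Finset.sum_nonneg fun _ _ => integral_nonneg fun _ => hellFn_nonneg _ _

theorem cell_le_hellAround {i : ℤ} (hi : i ∈ Finset.Icc (-3 : ℤ) 3) :
    ∫ x in cell (distFn f₀) l (j + i), hellFn (q x) (f x) ≤ hellAround f₀ q f l j :=
  Finset.single_le_sum (f := fun i => ∫ x in cell (distFn f₀) l (j + i), hellFn (q x) (f x))
    (fun _ _ => integral_nonneg fun _ => hellFn_nonneg _ _) hi

theorem IsTameBlock.abs_log_le (hB : IsTameBlock f₀ q Λ l j a b) (h : IsTriple f₀ q f)
    (hΛ : 0 < Λ) {hbar : ℝ} (hh : 0 < hbar) (hle : hellAround f₀ q f l j ≤ hbar)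
    (hS : ∫ u in cell3 (distFn f₀) l j, f u < 3 / 4) {x : ℝ} (hx : x ∈ cell (distFn f₀) l j) :
    |Real.log (mixFn (q x) (f x) / q x)| ≤
      (400 + 96 * Λ) * √(2 * Real.exp (4 * Λ + 2) * hbar / (1 / 2 ^ l)) := by
  have gp := fun i (hi : i ∈ Finset.Icc (-3 : ℤ) 3) =>
    hB.exists_goodPt h hΛ hh hi ((cell_le_hellAround hi).trans hle)
  obtain ⟨y, hy, gy⟩ := gp (-1) (by decide)
  obtain ⟨z, hz, gz⟩ := gp 1 (by decide)
  obtain ⟨u, hu, gu⟩ := gp (-3) (by decide)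
  set η := √(2 * Real.exp (4 * Λ + 2) * hbar / (1 / 2 ^ l)) with hη
  have hη0 : 0 ≤ η := Real.sqrt_nonneg _
  rcases le_or_gt η (1 / 12) with hs | hs
  · refine (hB.toIsBlock.abs_log_le_of_small h.dens₀ h.lc₀ h.lc hs hx hy hz hu gy gz gu).trans ?_
    gcongr
    linarith
  · exact hB.toIsBlock.abs_log_le_of_large h.dens₀ h.lc₀ h.dens h.lc hΛ.le hs hx hy hz gy gz hS

theorem IsTameBlock.log_mem_Icc (hB : IsTameBlock f₀ q Λ l j a b) (h : IsTriple f₀ q f)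
    (hΛ : 0 < Λ) {S M : ℝ} (hS0 : 0 < S)
    (hS : ∀ x, S * min (distFn f₀ x) (1 - distFn f₀ x) ≤ f₀ x) (hM : 0 ≤ M)
    (hfM : ∀ x, f x ≤ S * Real.exp M) {x : ℝ} (hx : x ∈ cell (distFn f₀) l j) :
    Real.log (mixFn (q x) (f x) / q x) ∈ Icc (-Real.log 3) (M + (4 * Λ + 2) + l) := by
  have hpos : 0 < hellAround f₀ q f l j + 1 := by linarith [hellAround_nonneg f₀ q f l j]
  have gp := fun i (hi : i ∈ Finset.Icc (-3 : ℤ) 3) =>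
    hB.exists_goodPt h hΛ hpos hi ((cell_le_hellAround hi).trans (by linarith))
  obtain ⟨y, hy, gy⟩ := gp (-1) (by decide)
  obtain ⟨z, hz, gz⟩ := gp 1 (by decide)
  have hq : 0 < q x := by
    rw [hB.eq_exp 0 (by decide) x (by rwa [add_zero])]; exact Real.exp_pos _
  exact ⟨log_mix_div_ge hq (h.lc.1 x),
    hB.toIsBlock.log_mix_le h.dens₀ h.lc₀ h.dens hΛ.le hS0 hS hM hfM hx hy hz gy gz⟩

end Triple

/-- Normalised fourth-power fluctuation of the empirical process on a dyadic cell. -/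
def fluct {n : ℕ} (P : Measure ℝ) (F : ℝ → ℝ) (xs : Fin n → ℝ) (L l : ℕ) (j : ℤ) : ℝ :=
  1 / n + n * (2 ^ l) ^ 2 * chainBound P F xs (L - l) l j

theorem fluct_nonneg {n : ℕ} (P : Measure ℝ) (F : ℝ → ℝ) (xs : Fin n → ℝ) (L l : ℕ) (j : ℤ) :
    0 ≤ fluct P F xs L l j := by
  have := chainBound_nonneg P F xs (L - l) l j
  unfold fluct
  positivity

theorem sq_mul_le_fluct {n : ℕ} (hn : 0 < n) {P : Measure ℝ} {F : ℝ → ℝ} {xs : Fin n → ℝ} {L l : ℕ}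
    {j : ℤ} {s c : ℝ} (hc : 1 ≤ c) (hs : s ^ 4 ≤ c * chainBound P F xs (L - l) l j) :
    s ^ 2 * 2 ^ l ≤ c * fluct P F xs L l j := by
  have hn0 : (0 : ℝ) < n := by exact_mod_cast hn
  have hz := chainBound_nonneg P F xs (L - l) l j
  set z := chainBound P F xs (L - l) l j
  set W : ℝ := 2 ^ l
  have hW : 0 < W := by positivity
  have h1 : s ^ 2 * W ≤ 1 / n + n * W ^ 2 * s ^ 4 := by
    have h2 : 0 ≤ (1 - n * W * s ^ 2) ^ 2 + n * W * s ^ 2 := by positivity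
    have : (1 - n * W * s ^ 2) ^ 2 + n * W * s ^ 2 =
        n * (1 / n + n * W ^ 2 * s ^ 4 - s ^ 2 * W) := by
      field_simp; ring
    rw [this] at h2
    linarith [nonneg_of_mul_nonneg_right h2 hn0]
  have h3 : n * W ^ 2 * s ^ 4 ≤ n * W ^ 2 * (c * z) := by gcongr
  have h4 : 1 / (n : ℝ) ≤ c * (1 / n) := le_mul_of_one_le_left (by positivity) hc
  unfold fluct
  linarith

theorem pow_four_mul_le_fluct {n : ℕ} {P : Measure ℝ} {F : ℝ → ℝ} {xs : Fin n → ℝ}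
    {L l : ℕ} {j : ℤ} {s c : ℝ} (hc : 0 ≤ c) (hs : s ^ 4 ≤ c * chainBound P F xs (L - l) l j) :
    n * s ^ 4 ≤ c * fluct P F xs L l j := by
  have hz := chainBound_nonneg P F xs (L - l) l j
  have h1 : (1 : ℝ) ≤ (2 ^ l) ^ 2 := one_le_pow₀ (one_le_pow₀ (by norm_num))
  unfold fluct
  calc (n : ℝ) * s ^ 4 ≤ n * (c * chainBound P F xs (L - l) l j) := by gcongr
    _ ≤ c * (n * 1 * chainBound P F xs (L - l) l j) := by linarith
    _ ≤ c * (n * (2 ^ l) ^ 2 * chainBound P F xs (L - l) l j) := by gcongr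
    _ ≤ _ := by
        rw [mul_add]
        have : 0 ≤ c * (1 / (n : ℝ)) := by positivity
        linarith

theorem affine_log_pow_four_le {α β x : ℝ} (hα : 0 ≤ α) (hβ : 0 ≤ β) (hx : 1 ≤ x) :
    (α * Real.log x + β) ^ 4 ≤ (4 * α + β) ^ 4 * x := by
  have h0 : 0 ≤ x := by linarith
  have h1 := Real.log_le_rpow_div h0 (ε := 1 / 4) (by norm_num)
  have h2 : 1 ≤ x ^ (1 / 4 : ℝ) := Real.one_le_rpow hx (by norm_num)
  have h3 : (x ^ (1 / 4 : ℝ)) ^ 4 = x := by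
    rw [← Real.rpow_natCast, ← Real.rpow_mul h0]; norm_num
  have hl := Real.log_nonneg hx
  calc (α * Real.log x + β) ^ 4 ≤ ((4 * α + β) * x ^ (1 / 4 : ℝ)) ^ 4 := by
        gcongr
        have : Real.log x ≤ 4 * x ^ (1 / 4 : ℝ) := by linarith
        nlinarith [mul_le_mul_of_nonneg_left this hα]
    _ = _ := by rw [mul_pow, h3]

theorem le_add_pow_four_div {x c : ℝ} (hx : 0 ≤ x) (hc : 0 < c) : x ≤ c + x ^ 4 / c ^ 3 := by
  rcases le_total x c with h | h
  · have : 0 ≤ x ^ 4 / c ^ 3 := by positivity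
    linarith
  · have : x ≤ x ^ 4 / c ^ 3 := by
      rw [le_div_iff₀ (by positivity)]
      have := pow_le_pow_left₀ hc.le h 3
      nlinarith
    linarith

theorem level_le_log {n L l : ℕ} (hn : 0 < n) (hl : l ≤ L) (hL : (2 : ℝ) ^ L ≤ 64 * n) :
    (l : ℝ) ≤ 2 * Real.log n + 7 := by
  have hn1 : (1 : ℝ) ≤ n := by exact_mod_cast hn
  have h1 : (2 : ℝ) ^ l ≤ 2 ^ 6 * n :=
    (pow_le_pow_right₀ (by norm_num) hl).trans (by linarith)
  have h2 := Real.log_le_log (by positivity) h1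
  rw [Real.log_mul (by norm_num) (by positivity), Real.log_pow, Real.log_pow] at h2
  push_cast at h2
  have h3 := Real.log_nonneg hn1
  have h4 := Real.log_two_gt_d9
  have h5 := Real.log_two_lt_d9
  by_contra h
  push Not at h
  nlinarith

theorem exists_dev_bound {n : ℕ} (hn : 0 < n) {f₀ : ℝ → ℝ} (hf : IsDensity f₀) (xs : Fin n → ℝ)
    (d l : ℕ) (j : ℤ) :
    ∃ s, 0 ≤ s ∧ s ≤ 1 ∧ s ^ 4 ≤ 16 * chainBound (densMeas f₀) (distFn f₀) xs d l j ∧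
      ∀ V : Set ℝ, V.OrdConnected → V ⊆ cell (distFn f₀) l j →
        |(empMeas xs).real V - (densMeas f₀).real V| ≤ s := by
  have := hf.isProbabilityMeasure
  have hz := chainBound_nonneg (densMeas f₀) (distFn f₀) xs d l j
  set Z := 16 * chainBound (densMeas f₀) (distFn f₀) xs d l j with hZ
  have hZ0 : 0 ≤ Z := by positivity
  refine ⟨min 1 √√Z, le_min zero_le_one (Real.sqrt_nonneg _), min_le_left _ _,
    ?_, fun V hV hVJ => ?_⟩
  · calc (min 1 √√Z) ^ 4 ≤ √√Z ^ 4 := by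
          gcongr
          exact min_le_right _ _
      _ = (√√Z ^ 2) ^ 2 := by ring
      _ = Z := by rw [Real.sq_sqrt (Real.sqrt_nonneg _), Real.sq_sqrt hZ0]
  · refine le_min (abs_empDev_le_one hn V xs) ?_
    have h1 := empDev_ordConnected_le hn (distFn_mono hf) (real_densMeas_cell_le hf) xs d l j hVJ hV
    refine Real.le_sqrt_of_sq_le (Real.le_sqrt_of_sq_le ?_)
    have : |(empMeas xs).real V - (densMeas f₀).real V| = |empDev (densMeas f₀) V xs| := rfl
    rw [this, ← pow_mul, Even.pow_abs (by decide)]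
    exact h1

theorem exists_block_const {Λ : ℝ} (hΛ : 0 < Λ) : ∃ D : ℝ, 0 ≤ D ∧
    ∀ {n : ℕ}, 2 ≤ n → ∀ {f₀ q f : ℝ → ℝ} {L l : ℕ} {j : ℤ} {a b S ζ : ℝ} (xs : Fin n → ℝ),
      IsTameBlock f₀ q Λ l j a b → IsTriple f₀ q f → 0 < S → 0 ≤ ζ →
      (∀ x, S * min (distFn f₀ x) (1 - distFn f₀ x) ≤ f₀ x) →
      (∀ x, f x ≤ S * Real.exp (3 + 8 * Real.log n + ζ)) → l ≤ L → (2 : ℝ) ^ L ≤ 64 * n →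
      3 / 2 * (∫ x in cell (distFn f₀) l j, Real.log (mixFn (q x) (f x) / q x) ∂(empMeas xs) -
        ∫ x in cell (distFn f₀) l j, Real.log (mixFn (q x) (f x) / q x) ∂(densMeas f₀)) ≤
      1 / 672 * (1 / n + hellAround f₀ q f l j) + D * fluct (densMeas f₀) (distFn f₀) xs L l j +
        if 3 / 4 ≤ ∫ u in cell3 (distFn f₀) l j, f u then 1 / 8192 + 3 / 2 * ζ else 0 := by
  set D₁ : ℝ := 54432 * (400 + 96 * Λ) ^ 2 * (2 * Real.exp (4 * Λ + 2)) with hD₁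
  set D₂ : ℝ := 81 * (4 * 10 + (4 * Λ + 15)) ^ 4 * 8192 ^ 3 with hD₂
  have hD₁0 : 0 ≤ D₁ := by positivity
  have hD₂0 : 0 ≤ D₂ := by positivity
  refine ⟨D₁ + D₂, by positivity, ?_⟩
  intro n hn f₀ q f L l j a b S ζ xs hB h hS0 hζ hS hfM hlL hL
  have hn0 : 0 < n := by omega
  have hn1 : (1 : ℝ) ≤ n := by exact_mod_cast hn0
  have hlog := Real.log_nonneg hn1
  have hP1 := h.dens₀.isProbabilityMeasure
  have hP2 := isProbabilityMeasure_empMeas hn0 xs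
  obtain ⟨s, hs0, hs1, hs4, hsV⟩ := exists_dev_bound hn0 h.dens₀ xs (L - l) l j
  have hsq := sq_mul_le_fluct hn0 (by norm_num) hs4
  have hs4' := pow_four_mul_le_fluct (by norm_num) hs4
  have hT := fluct_nonneg (densMeas f₀) (distFn f₀) xs L l j
  have hH := hellAround_nonneg f₀ q f l j
  set T := fluct (densMeas f₀) (distFn f₀) xs L l j
  have hoc := cell_ordConnected (distFn_mono h.dens₀) l j
  have dev := fun (a b : ℝ) (hab : a ≤ b) (hg : ∀ x ∈ cell (distFn f₀) l j,
      Real.log (mixFn (q x) (f x) / q x) ∈ Icc a b) =>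
    (le_abs_self _).trans (abs_setIntegral_sub_le (μ := empMeas xs) (ν := densMeas f₀) hoc
      h.measurable_log_mix hab hg (hB.toIsBlock.quasiconcave h) hsV)
  split_ifs with hsp
  · have hl2 := level_le_log hn0 hlL hL
    have h3 : Real.log 3 ≤ 2 * Real.log 2 := by
      rw [← Real.log_rpow (by norm_num)]
      exact Real.log_le_log (by norm_num) (by norm_num)
    have h3' := Real.log_two_lt_d9
    have h30 : 0 ≤ Real.log 3 := Real.log_nonneg (by norm_num)
    have hd := dev _ _ (by have : (0 : ℝ) ≤ l := by positivity
                           linarith)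
      (fun x hx => hB.log_mem_Icc h hΛ hS0 hS (by positivity) hfM hx)
    rw [abs_neg, abs_of_nonneg h30] at hd
    set A := 10 * Real.log n + (4 * Λ + 15) with hA
    have hA0 : 0 ≤ A := by positivity
    have e1 : Real.log 3 + (3 + 8 * Real.log n + ζ + (4 * Λ + 2) + l - -Real.log 3) ≤ A + ζ := by
      linarith
    have e2 := mul_le_mul_of_nonneg_right e1 hs0
    have e3 : ζ * s ≤ ζ := mul_le_of_le_one_right hζ hs1
    have e4 := le_add_pow_four_div (x := 3 / 2 * (A * s)) (c := 1 / 8192)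
      (by positivity) (by norm_num)
    have e5 : (3 / 2 * (A * s)) ^ 4 / (1 / 8192) ^ 3 ≤ D₂ * T := by
      have := affine_log_pow_four_le (α := 10) (β := 4 * Λ + 15) (by norm_num) (by positivity) hn1
      calc (3 / 2 * (A * s)) ^ 4 / (1 / 8192) ^ 3 = 81 / 16 * 8192 ^ 3 * (A ^ 4 * s ^ 4) := by ring
        _ ≤ 81 / 16 * 8192 ^ 3 * (((4 * 10 + (4 * Λ + 15)) ^ 4 * n) * s ^ 4) := by gcongr
        _ = 81 / 16 * 8192 ^ 3 * (4 * 10 + (4 * Λ + 15)) ^ 4 * (n * s ^ 4) := by ring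
        _ ≤ 81 / 16 * 8192 ^ 3 * (4 * 10 + (4 * Λ + 15)) ^ 4 * (16 * T) := by gcongr
        _ = _ := by rw [hD₂]; ring
    have e6 : 0 ≤ D₁ * T := by positivity
    have e7 : 0 ≤ 1 / 672 * (1 / n + hellAround f₀ q f l j) := by positivity
    rw [add_mul D₁]
    linarith
  · have hbar : 0 < 1 / (n : ℝ) + hellAround f₀ q f l j := by positivity
    have hg := fun x hx => hB.abs_log_le h hΛ hbar
      (by linarith [show 0 ≤ 1 / (n : ℝ) by positivity])
      (not_le.1 hsp) (x := x) hx
    set h₁ := 1 / (n : ℝ) + hellAround f₀ q f l j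
    set η := √(2 * Real.exp (4 * Λ + 2) * h₁ / (1 / 2 ^ l)) with hη
    set A := 400 + 96 * Λ
    have hA : 0 ≤ A := by positivity
    have hη0 : 0 ≤ η := Real.sqrt_nonneg _
    have hd := dev (-(A * η)) (A * η) (by have : 0 ≤ A * η := by positivity
                                          linarith)
      (fun x hx => abs_le.1 (hg x hx))
    rw [abs_neg, abs_of_nonneg (by positivity)] at hd
    have hη2 : η ^ 2 = 2 * Real.exp (4 * Λ + 2) * 2 ^ l * h₁ := by
      rw [hη, Real.sq_sqrt (by positivity)]; field_simp
    set t := 2 * Real.exp (4 * Λ + 2) * 2 ^ l with ht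
    have ht0 : 0 < t := by positivity
    have amgm : η * (9 / 2 * A * s) ≤ η ^ 2 / (672 * t) + 168 * t * (9 / 2 * A * s) ^ 2 := by
      have h0 : 0 ≤ (η / t - 336 * (9 / 2 * A * s)) ^ 2 * t / 672 := by positivity
      have e : (η / t - 336 * (9 / 2 * A * s)) ^ 2 * t / 672 =
          η ^ 2 / (672 * t) + 168 * t * (9 / 2 * A * s) ^ 2 - η * (9 / 2 * A * s) := by
        field_simp; ring
      linarith
    have e1 : η ^ 2 / (672 * t) = 1 / 672 * h₁ := by rw [hη2]; field_simp
    have e2 : 168 * t * (9 / 2 * A * s) ^ 2 ≤ D₁ * T := by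
      calc 168 * t * (9 / 2 * A * s) ^ 2 =
            3402 * A ^ 2 * (2 * Real.exp (4 * Λ + 2)) * (s ^ 2 * 2 ^ l) := by rw [ht]; ring
        _ ≤ 3402 * A ^ 2 * (2 * Real.exp (4 * Λ + 2)) * (16 * T) := by gcongr
        _ = _ := by rw [hD₁]; ring
    have e6 : 0 ≤ D₂ * T := by positivity
    rw [add_mul D₁]
    linarith

theorem setIntegral_empMeas_mono {n : ℕ} (xs : Fin n → ℝ) {A : Set ℝ} (hA : MeasurableSet A)
    {u v : ℝ → ℝ} (h : ∀ i, xs i ∈ A → u (xs i) ≤ v (xs i)) :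
    ∫ x in A, u x ∂(empMeas xs) ≤ ∫ x in A, v x ∂(empMeas xs) := by
  rw [setIntegral_empMeas xs u hA, setIntegral_empMeas xs v hA]
  refine mul_le_mul_of_nonneg_left (Finset.sum_le_sum fun i _ => ?_) (by positivity)
  by_cases hi : xs i ∈ A
  · rw [indicator_of_mem hi, indicator_of_mem hi]; exact h i hi
  · rw [indicator_of_notMem hi, indicator_of_notMem hi]

theorem setIntegral_empMeas_le_const_add {n : ℕ} (hn : 0 < n) (xs : Fin n → ℝ) {A : Set ℝ}
    (hA : MeasurableSet A) {u v : ℝ → ℝ} {c : ℝ} (h : ∀ i, xs i ∈ A → u (xs i) ≤ c + v (xs i)) :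
    ∫ x in A, u x ∂(empMeas xs) ≤ c * (empMeas xs).real A + ∫ x in A, v x ∂(empMeas xs) := by
  have := isProbabilityMeasure_empMeas hn xs
  refine (setIntegral_empMeas_mono xs hA (v := fun x => c + v x) h).trans ?_
  rw [integral_add (integrable_const _) (integrable_empMeas xs v).integrableOn, setIntegral_const,
    smul_eq_mul, mul_comm]

/-- Summands of the bound on the contribution of one leaf cell. -/
theorem exists_leaf_const : ∃ D : ℝ, 0 ≤ D ∧
    ∀ {n : ℕ}, 2 ≤ n → ∀ {f₀ f : ℝ → ℝ} {L : ℕ} {e : ℤ} {ζ : ℝ} (xs : Fin n → ℝ),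
      IsDensity f₀ → IsLogConcaveFn f₀ → IsDensity f → IsLogConcaveFn f → 0 ≤ ζ →
      (∀ i, 0 < f₀ (xs i)) → (∀ i, 0 < f (xs i)) →
      (∀ i, Real.log (f (xs i) / f₀ (xs i)) ≤ 3 + 12 * Real.log n + ζ +
        2 * ((n : ℝ) ^ 2)⁻¹ * edgeWeight f₀ (xs i)) →
      2 ≤ e → e + 3 ≤ 2 ^ L →
      ∫ x in cell (distFn f₀) L e, Real.log (f x / f₀ x) ∂(empMeas xs) ≤
      1 / 640 * ((∫ x in cell (distFn f₀) L (e + (-1)), f x) +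
          ∫ x in cell (distFn f₀) L (e + 1), f x) +
        D * fluct (densMeas f₀) (distFn f₀) xs L L e +
        (if 3 / 4 ≤ ∫ u in cell3 (distFn f₀) L e, f u then 1 / 8192 + ζ else 0) +
        2 * ((n : ℝ) ^ 2)⁻¹ * ∫ x in cell (distFn f₀) L e, edgeWeight f₀ x ∂(empMeas xs) := by
  set D₁ : ℝ := 20480 with hD₁
  set D₂ : ℝ := (4 * 12 + 3) ^ 4 * 8192 ^ 3 with hD₂
  refine ⟨D₁ + D₂, by positivity, ?_⟩
  intro n hn f₀ f L e ζ xs hf₀ hl₀ hf hl hζ hpos₀ hpos hbd h2 h3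
  have hn0 : 0 < n := by omega
  have hn1 : (1 : ℝ) ≤ n := by exact_mod_cast hn0
  have hlog := Real.log_nonneg hn1
  have hP1 := hf₀.isProbabilityMeasure
  have hP2 := isProbabilityMeasure_empMeas hn0 xs
  have hm := measurableSet_cell (distFn_mono hf₀) L e
  set p := (empMeas xs).real (cell (distFn f₀) L e) with hp
  have hp0 : 0 ≤ p := measureReal_nonneg
  have hp1 : p ≤ 1 := measureReal_le_one
  have hp4 : p ^ 4 ≤ 1 * chainBound (densMeas f₀) (distFn f₀) xs (L - L) L e := by
    rw [Nat.sub_self, chainBound, one_mul]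
    refine pow_le_pow_left₀ hp0 ?_ 4
    have h4 : p = empDev (densMeas f₀) (cell (distFn f₀) L e) xs +
        (densMeas f₀).real (cell (distFn f₀) L e) := by rw [empDev]; ring
    have h5 := real_densMeas_cell_le hf₀ L e
    rw [h4]
    exact add_le_add (le_abs_self _) h5
  have hsq := sq_mul_le_fluct hn0 le_rfl hp4
  have hp4' := pow_four_mul_le_fluct zero_le_one hp4
  have hT := fluct_nonneg (densMeas f₀) (distFn f₀) xs L L e
  set T := fluct (densMeas f₀) (distFn f₀) xs L L e
  rw [one_mul] at hsq hp4'
  set b₁ := ∫ x in cell (distFn f₀) L (e + (-1)), f x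
  set b₂ := ∫ x in cell (distFn f₀) L (e + 1), f x
  have hb₁ : 0 ≤ b₁ := hf.setIntegral_nonneg _
  have hb₂ : 0 ≤ b₂ := hf.setIntegral_nonneg _
  have hE : 0 ≤ 2 * ((n : ℝ) ^ 2)⁻¹ * ∫ x in cell (distFn f₀) L e, edgeWeight f₀ x ∂(empMeas xs) :=
    mul_nonneg (by positivity) (integral_nonneg fun x => edgeWeight_nonneg hf₀ x)
  split_ifs with hsp
  · have h6 := setIntegral_empMeas_le_const_add hn0 xs hm
      (u := fun x => Real.log (f x / f₀ x)) (c := 3 + 12 * Real.log n + ζ)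
      (v := fun x => 2 * ((n : ℝ) ^ 2)⁻¹ * edgeWeight f₀ x) (fun i _ => hbd i)
    rw [integral_const_mul] at h6
    have e3 : ζ * p ≤ ζ := mul_le_of_le_one_right hζ hp1
    set A := 12 * Real.log n + 3 with hA
    have hA0 : 0 ≤ A := by positivity
    have e4 := le_add_pow_four_div (x := A * p) (c := 1 / 8192) (by positivity) (by norm_num)
    have e5 : (A * p) ^ 4 / (1 / 8192) ^ 3 ≤ D₂ * T := by
      have := affine_log_pow_four_le (α := 12) (β := 3) (by norm_num) (by norm_num) hn1
      calc (A * p) ^ 4 / (1 / 8192) ^ 3 = 8192 ^ 3 * (A ^ 4 * p ^ 4) := by ring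
        _ ≤ 8192 ^ 3 * (((4 * 12 + 3) ^ 4 * n) * p ^ 4) := by gcongr
        _ = 8192 ^ 3 * (4 * 12 + 3) ^ 4 * (n * p ^ 4) := by ring
        _ ≤ 8192 ^ 3 * (4 * 12 + 3) ^ 4 * T := by gcongr
        _ = _ := by rw [hD₂]; ring
    have e6 : 0 ≤ D₁ * T := by positivity
    have e7 : 0 ≤ 1 / 640 * (b₁ + b₂) := by positivity
    rw [add_mul D₁]
    linarith
  · set s := b₁ + b₂ with hs
    have hs0 : 0 ≤ s := by positivity
    have hfx : ∀ i, xs i ∈ cell (distFn f₀) L e →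
        Real.log (f (xs i) / f₀ (xs i)) ≤ 2 * √(32 * (s * 2 ^ L)) + 0 := by
      intro i hi
      have h6 := le_of_not_spike hf₀ hl₀ hf hl h2 h3 (b := s) (by linarith) (by linarith)
        (not_le.1 hsp) hi
      have h7 : f (xs i) / f₀ (xs i) ≤ 32 * (s * 2 ^ L) := (div_le_iff₀ (hpos₀ i)).2 h6
      have h8 : 0 < f (xs i) / f₀ (xs i) := div_pos (hpos i) (hpos₀ i)
      have h9 : 0 < √(32 * (s * 2 ^ L)) := Real.sqrt_pos.2 (h8.trans_le h7)
      calc Real.log (f (xs i) / f₀ (xs i)) ≤ Real.log (32 * (s * 2 ^ L)) := Real.log_le_log h8 h7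
        _ = 2 * Real.log √(32 * (s * 2 ^ L)) := by
            rw [Real.log_sqrt (h8.trans_le h7).le]; ring
        _ ≤ _ := by linarith [Real.log_le_sub_one_of_pos h9]
    have h6 := setIntegral_empMeas_le_const_add hn0 xs hm
      (u := fun x => Real.log (f x / f₀ x)) (v := fun _ => 0) hfx
    rw [integral_zero, add_zero] at h6
    set r := √(32 * (s * 2 ^ L)) with hr
    have hr2 : r ^ 2 = 32 * (s * 2 ^ L) := Real.sq_sqrt (by positivity)
    have hw : (0 : ℝ) < 2 ^ L := by positivity
    have amgm : 2 * r * p ≤ 1 / 640 * s + D₁ * (p ^ 2 * 2 ^ L) := by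
      have h0 : 0 ≤ (r / 2 ^ L - 20480 * p) ^ 2 * 2 ^ L / 20480 := by positivity
      have e : (r / 2 ^ L - 20480 * p) ^ 2 * 2 ^ L / 20480 =
          r ^ 2 / (20480 * 2 ^ L) - 2 * r * p + 20480 * (p ^ 2 * 2 ^ L) := by
        field_simp
        ring
      have e' : r ^ 2 / (20480 * 2 ^ L) = 1 / 640 * s := by rw [hr2]; field_simp; ring
      rw [e, e'] at h0
      linarith
    have e6 : 0 ≤ D₂ * T := by positivity
    have e7 : D₁ * (p ^ 2 * 2 ^ L) ≤ D₁ * T := by gcongr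
    rw [add_mul D₁]
    linarith

theorem leaf_le_of_edge {n : ℕ} (hn : 0 < n) {f₀ f : ℝ → ℝ} {A : Set ℝ} (hA : MeasurableSet A)
    {ζ : ℝ} (xs : Fin n → ℝ) (hζ : 0 ≤ ζ)
    (hbd : ∀ i, Real.log (f (xs i) / f₀ (xs i)) ≤ 3 + 12 * Real.log n + ζ +
        2 * ((n : ℝ) ^ 2)⁻¹ * edgeWeight f₀ (xs i)) :
    ∫ x in A, Real.log (f x / f₀ x) ∂(empMeas xs) ≤
      (3 + 12 * Real.log n) * (empMeas xs).real A + ζ +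
        2 * ((n : ℝ) ^ 2)⁻¹ * ∫ x in A, edgeWeight f₀ x ∂(empMeas xs) := by
  have := isProbabilityMeasure_empMeas hn xs
  have h6 := setIntegral_empMeas_le_const_add hn xs hA
    (u := fun x => Real.log (f x / f₀ x)) (c := 3 + 12 * Real.log n + ζ)
    (v := fun x => 2 * ((n : ℝ) ^ 2)⁻¹ * edgeWeight f₀ x) (fun i _ => hbd i)
  rw [integral_const_mul] at h6
  have e3 : ζ * (empMeas xs).real A ≤ ζ := mul_le_of_le_one_right hζ measureReal_le_one
  linarith

/-! ### Assembling the deterministic bound -/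

theorem distFn_mem_Ioo_ae {f : ℝ → ℝ} (hf : IsDensity f) :
    ∀ᵐ x ∂(densMeas f), distFn f x ∈ Ioo (0 : ℝ) 1 := by
  have h : ∀ᵐ u ∂((densMeas f).map (distFn f)), u ∈ Ioo (0 : ℝ) 1 := by
    rw [map_distFn hf, ← Measure.restrict_congr_set
      (Ioo_ae_eq_Icc (μ := volume) (a := (0 : ℝ)) (b := 1))]
    exact ae_restrict_mem measurableSet_Ioo
  exact ae_of_ae_map (distFn_continuous hf).measurable.aemeasurable h

theorem sum_setIntegral_le {ι : Type*} {t : Finset ι} {s : ι → Set ℝ} {ψ : ℝ → ℝ} {μ : Measure ℝ}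
    (hs : ∀ i ∈ t, MeasurableSet (s i)) (hd : (t : Set ι).PairwiseDisjoint s)
    (hψ : Integrable ψ μ) (h0 : 0 ≤ᵐ[μ] ψ) : ∑ i ∈ t, ∫ x in s i, ψ x ∂μ ≤ ∫ x, ψ x ∂μ := by
  rw [← integral_biUnion_finset t hs hd fun i _ => hψ.integrableOn]
  exact setIntegral_le_integral hψ h0

theorem sum_leaves_shift_le {F : ℝ → ℝ} (hF : Monotone F) {ψ : ℝ → ℝ} {μ : Measure ℝ}
    (hψ : Integrable ψ μ) (h0 : 0 ≤ᵐ[μ] ψ) (t : Finset ℤ) (L : ℕ) (i : ℤ) :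
    ∑ e ∈ t, ∫ x in cell F L (e + i), ψ x ∂μ ≤ ∫ x, ψ x ∂μ :=
  sum_setIntegral_le (fun _ _ => measurableSet_cell hF L _)
    (fun _ _ _ _ hne => cell_disjoint hF fun h => hne (by linarith)) hψ h0

theorem measurableSet_biUnion_cell {F : ℝ → ℝ} (hF : Monotone F) (G : Finset (ℕ × ℤ)) :
    MeasurableSet (⋃ p ∈ G, cell F p.1 p.2) :=
  G.measurableSet_biUnion fun _ _ => measurableSet_cell hF _ _

theorem sum_level_add_card_leaves {B : Finset ℝ} {l₀ L : ℕ} {G : Finset (ℕ × ℤ)}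
    (hG : G ⊆ whitney B l₀ L) {f : ℝ → ℝ} (hf : IsDensity f) :
    ∑ p ∈ G, (1 : ℝ) / 2 ^ p.1 + (leaves G L).card / 2 ^ L = 1 := by
  have hP := hf.isProbabilityMeasure
  have hF := distFn_mono hf
  have key : ∀ᵐ x ∂(densMeas f),
      ∑ p ∈ G, (cell (distFn f) p.1 p.2).indicator (fun _ => (1 : ℝ)) x +
        ∑ e ∈ leaves G L, (cell (distFn f) L e).indicator (fun _ => (1 : ℝ)) x = 1 := by
    filter_upwards [distFn_mem_Ioo_ae hf] with x hx
    exact sum_indicator_cells hG ⟨hx.1, hx.2.le⟩ fun _ => 1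
  have hi : ∀ l j, Integrable ((cell (distFn f) l j).indicator fun _ => (1 : ℝ)) (densMeas f) :=
    fun l j => (integrable_const _).indicator (measurableSet_cell hF l j)
  have h1 := integral_congr_ae key
  rw [integral_add (integrable_finsetSum _ fun p _ => hi _ _)
    (integrable_finsetSum _ fun e _ => hi _ _), integral_finsetSum _ fun p _ => hi _ _,
    integral_finsetSum _ fun e _ => hi _ _] at h1
  simp only [integral_indicator (measurableSet_cell hF _ _), integral_const, smul_eq_mul,
    mul_one, probReal_univ, measureReal_restrict_apply_univ] at h1
  refine Eq.trans ?_ h1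
  congr 1
  · refine Finset.sum_congr rfl fun p hp => ?_
    have := mem_whitney.1 (hG hp)
    rw [real_densMeas_cell hf this.2.2.1 this.2.2.2.1]
  · rw [Finset.sum_congr rfl (g := fun _ => (1 : ℝ) / 2 ^ L)]
    · rw [Finset.sum_const, nsmul_eq_mul, mul_one_div]
    · intro e he
      have := Finset.mem_Ico.1 (Finset.mem_filter.1 he).1
      rw [real_densMeas_cell hf this.1 this.2]

section Assembly

variable {f₀ q f : ℝ → ℝ}

theorem IsTriple.hell_nonneg (q f : ℝ → ℝ) : 0 ≤ᵐ[volume] fun x => hellFn (q x) (f x) :=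
  ae_of_all _ fun _ => hellFn_nonneg _ _

theorem IsTriple.sum_good_integral_le (h : IsTriple f₀ q f) {B : Finset ℝ} {l₀ L : ℕ}
    {G : Finset (ℕ × ℤ)} (hG : G ⊆ whitney B l₀ L)
    (hInt : ∀ p ∈ G, IntegrableOn (fun x => f₀ x * Real.log (mixFn (q x) (f x) / q x))
      (cell (distFn f₀) p.1 p.2)) :
    ∑ p ∈ G, (3 / 2 * (∫ x in cell (distFn f₀) p.1 p.2, Real.log (mixFn (q x) (f x) / q x)
          ∂(densMeas f₀)) -
        ∫ x in cell (distFn f₀) p.1 p.2, Real.log (f₀ x / q x) ∂(densMeas f₀)) ≤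
      3 / 4 * (∫ x, klFn (f₀ x) (q x)) - (∫ x, hellFn (q x) (f x)) / 8 +
        5 / 4 * ((leaves G L).card / 2 ^ L) := by
  have hF := distFn_mono h.dens₀
  have hm : ∀ p ∈ G, MeasurableSet (cell (distFn f₀) p.1 p.2) :=
    fun p _ => measurableSet_cell hF _ _
  have hd : (G : Set (ℕ × ℤ)).PairwiseDisjoint fun p => cell (distFn f₀) p.1 p.2 :=
    (whitney_pairwiseDisjoint (distFn f₀)).subset (Finset.coe_subset.2 hG)
  set W := ⋃ p ∈ G, cell (distFn f₀) p.1 p.2 with hW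
  have hWm : MeasurableSet W := measurableSet_biUnion_cell hF G
  have hgW : IntegrableOn (fun x => f₀ x * Real.log (mixFn (q x) (f x) / q x)) W :=
    integrableOn_finset_iUnion.2 hInt
  have hcard := sum_level_add_card_leaves hG h.dens₀
  have hf₀W : ∫ x in W, f₀ x = ∑ p ∈ G, (1 : ℝ) / 2 ^ p.1 := by
    rw [hW, integral_biUnion_finset G hm hd fun _ _ => h.dens₀.integrable.integrableOn]
    refine Finset.sum_congr rfl fun p hp => ?_
    have := mem_whitney.1 (hG hp)
    rw [← h.dens₀.real_densMeas (hm p hp), real_densMeas_cell h.dens₀ this.2.2.1 this.2.2.2.1]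
  have e1 : ∑ p ∈ G, (3 / 2 * (∫ x in cell (distFn f₀) p.1 p.2,
        Real.log (mixFn (q x) (f x) / q x) ∂(densMeas f₀)) -
        ∫ x in cell (distFn f₀) p.1 p.2, Real.log (f₀ x / q x) ∂(densMeas f₀)) =
      ∫ x in W, (3 / 2 * (f₀ x * Real.log (mixFn (q x) (f x) / q x)) -
        f₀ x * Real.log (f₀ x / q x)) := by
    rw [integral_sub (hgW.const_mul _) h.int.integrableOn, integral_const_mul, hW,
      integral_biUnion_finset G hm hd hInt,
      integral_biUnion_finset G hm hd fun _ _ => h.int.integrableOn, Finset.sum_sub_distrib,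
      Finset.mul_sum]
    congr 1 <;> refine Finset.sum_congr rfl fun p hp => ?_ <;>
      rw [h.dens₀.setIntegral_densMeas _ (hm p hp)]
  have i1 : Integrable fun x => 3 / 4 * klFn (f₀ x) (q x) - hellFn (q x) (f x) / 8 :=
    (h.integrable_klFn.const_mul _).sub (h.integrable_hellFn.div_const _)
  have i2 : Integrable fun x => 3 / 4 * klFn (f₀ x) (q x) - hellFn (q x) (f x) / 8 + f x :=
    i1.add h.dens.integrable
  have e2 : ∫ x in W, (3 / 2 * (f₀ x * Real.log (mixFn (q x) (f x) / q x)) -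
        f₀ x * Real.log (f₀ x / q x)) ≤
      ∫ x in W, (3 / 4 * klFn (f₀ x) (q x) - hellFn (q x) (f x) / 8 + f x - f₀ x) := by
    refine setIntegral_mono_ae ((hgW.const_mul _).sub h.int.integrableOn)
      (i2.sub h.dens₀.integrable).integrableOn ?_
    filter_upwards [h.ac] with x hx
    exact mul_log_mix_sub_le (h.dens₀.1 x) (h.densq.1 x) (h.dens.1 x) hx
  have e3 : ∫ x in W, (3 / 4 * klFn (f₀ x) (q x) - hellFn (q x) (f x) / 8 + f x - f₀ x) =
      3 / 4 * (∫ x in W, klFn (f₀ x) (q x)) - (∫ x in W, hellFn (q x) (f x)) / 8 +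
        (∫ x in W, f x) - ∫ x in W, f₀ x := by
    rw [integral_sub i2.integrableOn h.dens₀.integrable.integrableOn,
      integral_add i1.integrableOn h.dens.integrable.integrableOn,
      integral_sub (h.integrable_klFn.const_mul _).integrableOn
        (h.integrable_hellFn.div_const _).integrableOn, integral_const_mul, integral_div]
  have c1 := integral_add_compl hWm h.integrable_klFn
  have c2 := integral_add_compl hWm h.integrable_hellFn
  have c3 := integral_add_compl hWm h.dens.integrable
  have c4 := integral_add_compl hWm h.dens₀.integrable
  rw [h.dens.integral_eq_one] at c3
  rw [h.dens₀.integral_eq_one] at c4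
  have e4 : ∫ x in Wᶜ, hellFn (q x) (f x) ≤ (∫ x in Wᶜ, f x) + (2 * (∫ x in Wᶜ, klFn (f₀ x) (q x))
      + 2 * ∫ x in Wᶜ, f₀ x) := by
    have i3 : Integrable fun x => 2 * klFn (f₀ x) (q x) + 2 * f₀ x :=
      (h.integrable_klFn.const_mul _).add (h.dens₀.integrable.const_mul _)
    have i4 : Integrable fun x => f x + (2 * klFn (f₀ x) (q x) + 2 * f₀ x) :=
      h.dens.integrable.add i3
    rw [← integral_const_mul, ← integral_const_mul,
      ← integral_add (h.integrable_klFn.const_mul _).integrableOn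
        (h.dens₀.integrable.const_mul _).integrableOn,
      ← integral_add h.dens.integrable.integrableOn i3.integrableOn]
    refine setIntegral_mono_ae h.integrable_hellFn.integrableOn i4.integrableOn ?_
    filter_upwards [h.ac] with x hx
    have := hellFn_le (h.densq.1 x) (h.dens.1 x)
    have := le_two_mul_klFn_add (h.dens₀.1 x) (h.densq.1 x) hx
    linarith
  have hK : 0 ≤ ∫ x in Wᶜ, klFn (f₀ x) (q x) :=
    integral_nonneg_of_ae (ae_restrict_of_ae h.klFn_nonneg)
  have hfW : 0 ≤ ∫ x in Wᶜ, f x := h.dens.setIntegral_nonneg _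
  rw [e1]
  refine e2.trans ?_
  rw [e3]
  linarith

theorem IsTriple.setIntegral_cell_le (h : IsTriple f₀ q f) (l : ℕ) (j : ℤ) :
    ∫ x in cell (distFn f₀) l j, f x ≤
      3 * (∫ x in cell (distFn f₀) l j, hellFn (q x) (f x)) +
        6 * (∫ x in cell (distFn f₀) l j, klFn (f₀ x) (q x)) + 6 * (1 / 2 ^ l) := by
  have i1 : Integrable fun x => 3 * hellFn (q x) (f x) + 6 * klFn (f₀ x) (q x) :=
    (h.integrable_hellFn.const_mul _).add (h.integrable_klFn.const_mul _)
  have i2 : Integrable fun x => 3 * hellFn (q x) (f x) + 6 * klFn (f₀ x) (q x) + 6 * f₀ x :=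
    i1.add (h.dens₀.integrable.const_mul _)
  have hm := measurableSet_cell (distFn_mono h.dens₀) l j
  have h1 := real_densMeas_cell_le h.dens₀ l j
  rw [h.dens₀.real_densMeas hm] at h1
  calc _ ≤ ∫ x in cell (distFn f₀) l j,
        (3 * hellFn (q x) (f x) + 6 * klFn (f₀ x) (q x) + 6 * f₀ x) := by
        refine setIntegral_mono_ae h.dens.integrable.integrableOn i2.integrableOn ?_
        filter_upwards [h.ac] with x hx
        exact le_hellFn_add (h.dens₀.1 x) (h.densq.1 x) (h.dens.1 x) hx
    _ = 3 * (∫ x in cell (distFn f₀) l j, hellFn (q x) (f x)) +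
        6 * (∫ x in cell (distFn f₀) l j, klFn (f₀ x) (q x)) +
        6 * ∫ x in cell (distFn f₀) l j, f₀ x := by
        rw [integral_add i1.integrableOn (h.dens₀.integrable.const_mul _).integrableOn,
          integral_add (h.integrable_hellFn.const_mul _).integrableOn
            (h.integrable_klFn.const_mul _).integrableOn, integral_const_mul, integral_const_mul,
          integral_const_mul]
    _ ≤ _ := by linarith

theorem IsTriple.sum_shift_le (h : IsTriple f₀ q f) (t : Finset ℤ) (L : ℕ) (i : ℤ) :
    ∑ e ∈ t, ∫ x in cell (distFn f₀) L (e + i), f x ≤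
      3 * (∫ x, hellFn (q x) (f x)) + 6 * (∫ x, klFn (f₀ x) (q x)) + 6 * (t.card / 2 ^ L) := by
  have hF := distFn_mono h.dens₀
  have h1 := sum_leaves_shift_le hF h.integrable_hellFn (hell_nonneg q f) t L i
  have h2 := sum_leaves_shift_le hF h.integrable_klFn h.klFn_nonneg t L i
  calc _ ≤ ∑ e ∈ t, (3 * (∫ x in cell (distFn f₀) L (e + i), hellFn (q x) (f x)) +
        6 * (∫ x in cell (distFn f₀) L (e + i), klFn (f₀ x) (q x)) + 6 * (1 / 2 ^ L)) :=
        Finset.sum_le_sum fun e _ => h.setIntegral_cell_le L _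
    _ = 3 * (∑ e ∈ t, ∫ x in cell (distFn f₀) L (e + i), hellFn (q x) (f x)) +
        6 * (∑ e ∈ t, ∫ x in cell (distFn f₀) L (e + i), klFn (f₀ x) (q x)) +
        6 * (t.card / 2 ^ L) := by
        rw [Finset.sum_add_distrib, Finset.sum_add_distrib, Finset.mul_sum, Finset.mul_sum,
          Finset.sum_const, nsmul_eq_mul]
        ring
    _ ≤ _ := by linarith

/-- If the estimator puts mass `3/4` on a triple of cells, it is far from `q` or `q` is far
from `f₀`. -/
theorem IsTriple.one_le_of_spike (h : IsTriple f₀ q f) {l : ℕ} (hl : 6 ≤ l) {j : ℤ}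
    (hs : 3 / 4 ≤ ∫ u in cell3 (distFn f₀) l j, f u) :
    1 ≤ 8 * ((∫ x, hellFn (q x) (f x)) + 2 * ∫ x, klFn (f₀ x) (q x)) := by
  have hF := distFn_mono h.dens₀
  have hp : (1 : ℝ) / 2 ^ l ≤ 1 / 64 := by
    rw [show (64 : ℝ) = 2 ^ 6 by norm_num]
    exact one_div_le_one_div_of_le (by positivity) (pow_le_pow_right₀ (by norm_num) hl)
  have a1 := h.setIntegral_cell_le l (j + (-1))
  have a2 := h.setIntegral_cell_le l j
  have a3 := h.setIntegral_cell_le l (j + 1)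
  have b1 := setIntegral_cell3 hF h.integrable_hellFn l j
  have b2 := setIntegral_cell3 hF h.integrable_klFn l j
  have b3 := setIntegral_cell3 hF h.dens.integrable l j
  have c1 := setIntegral_le_integral (s := cell3 (distFn f₀) l j) h.integrable_hellFn
    (hell_nonneg q f)
  have c2 := setIntegral_le_integral (s := cell3 (distFn f₀) l j) h.integrable_klFn h.klFn_nonneg
  linarith

theorem IsTriple.spike_term_le (h : IsTriple f₀ q f) {l : ℕ} (hl : 6 ≤ l) (j : ℤ) {ζ c : ℝ}
    (hζ : 0 ≤ ζ) (hc : 0 ≤ c) (hc' : c ≤ 3 / 2) :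
    (if 3 / 4 ≤ ∫ u in cell3 (distFn f₀) l j, f u then 1 / 8192 + c * ζ else 0) ≤
      4 / 3 * (((∫ x, hellFn (q x) (f x)) + 2 * ∫ x, klFn (f₀ x) (q x)) / 1024 + 3 / 2 * ζ) *
        ∫ u in cell3 (distFn f₀) l j, f u := by
  have h1 : 0 ≤ ∫ x, hellFn (q x) (f x) := integral_nonneg fun _ => hellFn_nonneg _ _
  have h2 : 0 ≤ ∫ x, klFn (f₀ x) (q x) := integral_nonneg_of_ae h.klFn_nonneg
  have h3 : 0 ≤ ∫ u in cell3 (distFn f₀) l j, f u := h.dens.setIntegral_nonneg _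
  split_ifs with hs
  · have h4 := h.one_le_of_spike hl hs
    set X := ((∫ x, hellFn (q x) (f x)) + 2 * ∫ x, klFn (f₀ x) (q x)) / 1024 + 3 / 2 * ζ with hX
    have h5 : 1 / 8192 + c * ζ ≤ X := by
      have : c * ζ ≤ 3 / 2 * ζ := by gcongr
      rw [hX]; linarith
    have hX0 : 0 ≤ X := le_trans (by positivity) h5
    nlinarith
  · positivity

theorem IsTriple.sum_cell3_good_le (h : IsTriple f₀ q f) {B : Finset ℝ} {l₀ L : ℕ}
    {G : Finset (ℕ × ℤ)} (hG : G ⊆ whitney B l₀ L) :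
    ∑ p ∈ G, ∫ u in cell3 (distFn f₀) p.1 p.2, f u ≤ 21 := by
  have hF := distFn_mono h.dens₀
  have h0 : ∀ p : ℕ × ℤ, ∀ i ∈ Finset.Icc (-3 : ℤ) 3,
      0 ≤ ∫ x in cell (distFn f₀) p.1 (p.2 + i), f x :=
    fun p i _ => h.dens.setIntegral_nonneg _
  have h1 : ∀ p : ℕ × ℤ, ∫ u in cell3 (distFn f₀) p.1 p.2, f u ≤
      ∑ i ∈ Finset.Icc (-3 : ℤ) 3, ∫ x in cell (distFn f₀) p.1 (p.2 + i), f x := by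
    intro p
    have h2 : ∑ i ∈ ({-1, 0, 1} : Finset ℤ), ∫ x in cell (distFn f₀) p.1 (p.2 + i), f x ≤
        ∑ i ∈ Finset.Icc (-3 : ℤ) 3, ∫ x in cell (distFn f₀) p.1 (p.2 + i), f x :=
      Finset.sum_le_sum_of_subset_of_nonneg (by decide) fun i hi _ => h0 p i hi
    refine le_trans (le_of_eq ?_) h2
    rw [setIntegral_cell3 hF h.dens.integrable, Finset.sum_insert (by decide),
      Finset.sum_insert (by decide), Finset.sum_singleton, add_zero, add_assoc]
  have h2 := whitney_integral_overlap (B := B) (l₀ := l₀) (L := L) hF h.dens.integrable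
    (ae_of_all _ h.dens.1)
  rw [h.dens.integral_eq_one, mul_one] at h2
  calc _ ≤ ∑ p ∈ G, ∑ i ∈ Finset.Icc (-3 : ℤ) 3, ∫ x in cell (distFn f₀) p.1 (p.2 + i), f x :=
        Finset.sum_le_sum fun p _ => h1 p
    _ ≤ _ := Finset.sum_le_sum_of_subset_of_nonneg hG fun p _ _ => Finset.sum_nonneg (h0 p)
    _ ≤ 21 := h2

theorem IsTriple.sum_cell3_leaves_le (h : IsTriple f₀ q f) (t : Finset ℤ) (L : ℕ) :
    ∑ e ∈ t, ∫ u in cell3 (distFn f₀) L e, f u ≤ 3 := by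
  have hF := distFn_mono h.dens₀
  have h1 : ∀ i : ℤ, ∑ e ∈ t, ∫ x in cell (distFn f₀) L (e + i), f x ≤ 1 := fun i =>
    (sum_leaves_shift_le hF h.dens.integrable (ae_of_all _ h.dens.1) t L i).trans
      h.dens.integral_eq_one.le
  simp only [setIntegral_cell3 hF h.dens.integrable]
  rw [Finset.sum_add_distrib, Finset.sum_add_distrib]
  have := h1 (-1)
  have := h1 0
  have := h1 1
  simp only [add_zero] at *
  linarith

theorem IsTriple.sum_hellAround_le (h : IsTriple f₀ q f) {B : Finset ℝ} {l₀ L : ℕ}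
    {G : Finset (ℕ × ℤ)} (hG : G ⊆ whitney B l₀ L) :
    ∑ p ∈ G, hellAround f₀ q f p.1 p.2 ≤ 21 * ∫ x, hellFn (q x) (f x) :=
  (Finset.sum_le_sum_of_subset_of_nonneg hG fun _ _ _ => hellAround_nonneg _ _ _ _ _).trans
    (whitney_integral_overlap (distFn_mono h.dens₀) h.integrable_hellFn (hell_nonneg q f))

end Assembly

/-- Around the cell `p` the relative entropy of `f₀` with respect to `q` is small. -/
def IsTameCell (f₀ q : ℝ → ℝ) (Λ : ℝ) (p : ℕ × ℤ) : Prop :=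
  ∀ i ∈ Finset.Icc (-3 : ℤ) 3,
    ∫ x in cell (distFn f₀) p.1 (p.2 + i), klFn (f₀ x) (q x) ≤ Λ * (1 / 2 ^ p.1)

/-- The maximal admissible cells around which `q` is close to `f₀` in relative entropy. -/
def goodCells (f₀ q : ℝ → ℝ) (Λ : ℝ) (B : Finset ℝ) (l₀ L : ℕ) : Finset (ℕ × ℤ) :=
  (whitney B l₀ L).filter (IsTameCell f₀ q Λ)

theorem goodCells_subset (f₀ q : ℝ → ℝ) (Λ : ℝ) (B : Finset ℝ) (l₀ L : ℕ) :
    goodCells f₀ q Λ B l₀ L ⊆ whitney B l₀ L := Finset.filter_subset _ _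

section Majorant

variable {f₀ q f : ℝ → ℝ} {Λ : ℝ}

theorem IsTriple.sum_not_good_le (h : IsTriple f₀ q f) (hΛ : 0 < Λ) (B : Finset ℝ) (l₀ L : ℕ) :
    ∑ p ∈ whitney B l₀ L \ goodCells f₀ q Λ B l₀ L, (1 : ℝ) / 2 ^ p.1 ≤
      21 * (∫ x, klFn (f₀ x) (q x)) / Λ := by
  have hnn : ∀ p : ℕ × ℤ, ∀ i ∈ Finset.Icc (-3 : ℤ) 3,
      0 ≤ ∫ x in cell (distFn f₀) p.1 (p.2 + i), klFn (f₀ x) (q x) := fun p i _ =>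
    integral_nonneg_of_ae (ae_restrict_of_ae h.klFn_nonneg)
  rw [le_div_iff₀' hΛ, Finset.mul_sum]
  refine le_trans ?_ (whitney_integral_overlap (B := B) (l₀ := l₀) (L := L)
    (distFn_mono h.dens₀) h.integrable_klFn h.klFn_nonneg)
  refine le_trans (Finset.sum_le_sum (g := fun p : ℕ × ℤ => ∑ i ∈ Finset.Icc (-3 : ℤ) 3,
    ∫ x in cell (distFn f₀) p.1 (p.2 + i), klFn (f₀ x) (q x)) fun p hp => ?_)
    (Finset.sum_le_sum_of_subset_of_nonneg Finset.sdiff_subset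
      fun p _ _ => Finset.sum_nonneg (hnn p))
  rw [Finset.mem_sdiff, goodCells, Finset.mem_filter, not_and] at hp
  obtain ⟨i, hi, hlt⟩ : ∃ i ∈ Finset.Icc (-3 : ℤ) 3, Λ * (1 / 2 ^ p.1) <
      ∫ x in cell (distFn f₀) p.1 (p.2 + i), klFn (f₀ x) (q x) := by
    have := hp.2 hp.1
    rw [IsTameCell] at this
    push Not at this
    exact this
  exact hlt.le.trans (Finset.single_le_sum (hnn p) hi)

theorem IsTriple.card_leaves_good_le (h : IsTriple f₀ q f) (hΛ : 0 < Λ) {F : ℝ → ℝ} {k : ℕ}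
    (hk : 1 ≤ k) (I : Fin k → Set ℝ) {l₀ L : ℕ} (hL : l₀ ≤ L) :
    ((leaves (goodCells f₀ q Λ (breakPts F I) l₀ L) L).card : ℝ) / 2 ^ L ≤
      64 * k / 2 ^ L + 21 * (∫ x, klFn (f₀ x) (q x)) / Λ := by
  refine (card_leaves_le (B := breakPts F I) hL).trans ?_
  have h1 := h.sum_not_good_le hΛ (breakPts F I) l₀ L
  have h2 : 16 * ((breakPts F I).card : ℝ) ≤ 64 * k := by
    have := card_breakPts_le F I
    have : 16 * (breakPts F I).card ≤ 64 * k := by omega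
    exact_mod_cast this
  gcongr

theorem IsTriple.exists_isTameBlock (h : IsTriple f₀ q f) {k : ℕ} {I : Fin k → Set ℝ}
    (hI : ∀ r, (I r).OrdConnected) (hI0 : ∀ x : ℝ, x ∉ ⋃ r, I r → q x = 0)
    (hIa : ∀ r, ∃ a b : ℝ, ∀ x ∈ I r, q x = Real.exp (a * x + b)) {l₀ L : ℕ} {p : ℕ × ℤ}
    (hp : p ∈ goodCells f₀ q Λ (breakPts (distFn f₀) I) l₀ L) :
    ∃ a b, IsTameBlock f₀ q Λ p.1 p.2 a b := by
  have hF := distFn_mono h.dens₀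
  obtain ⟨hw, hkl⟩ := Finset.mem_filter.1 hp
  obtain ⟨-, -, h0, h1, hadm, -⟩ := mem_whitney.1 hw
  obtain ⟨hlow, hup⟩ := hadm.bounds h0 h1
  obtain ⟨x, hx, hqx⟩ : ∃ x ∈ cell (distFn f₀) p.1 p.2, q x ≠ 0 := by
    by_contra hcon
    push Not at hcon
    have hz : ∫ x in cell (distFn f₀) p.1 p.2, f₀ x = 0 := by
      refine (setIntegral_congr_ae (g := fun _ => (0 : ℝ)) (measurableSet_cell hF _ _) ?_).trans
        (by simp)
      filter_upwards [h.ac] with x hx hxc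
      exact hx (hcon x hxc)
    rw [← h.dens₀.real_densMeas (measurableSet_cell hF _ _), real_densMeas_cell h.dens₀ h0 h1] at hz
    exact absurd hz (by positivity)
  obtain ⟨r, hr⟩ : ∃ r, x ∈ I r := by
    by_contra hcon
    exact hqx (hI0 x (by simpa using hcon))
  obtain ⟨a, b, hab⟩ := hIa r
  refine ⟨a, b, ⟨hlow, hup, fun i hi y hy => hab y ?_⟩, hkl⟩
  exact hadm.subset_piece hF hI (i := 0) (by decide) hi (by rwa [add_zero]) hr hy

/-- Indices of the extreme cells of level `L`. -/
def edgeCells (L : ℕ) : Finset ℤ := {0, 1, 2 ^ L - 2, 2 ^ L - 1}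

/-- The random variable that dominates the empirical divergence of the estimator. -/
def majorant {n : ℕ} (D₁ D₂ : ℝ) (f₀ q : ℝ → ℝ) (S : ℝ) (G : Finset (ℕ × ℤ)) (L : ℕ)
    (xs : Fin n → ℝ) : ℝ :=
  -(∑ p ∈ G, (∫ x in cell (distFn f₀) p.1 p.2, Real.log (f₀ x / q x) ∂(empMeas xs) -
      ∫ x in cell (distFn f₀) p.1 p.2, Real.log (f₀ x / q x) ∂(densMeas f₀))) +
    (27 / 32 * (∫ x, klFn (f₀ x) (q x)) + 13 / 10 * ((leaves G L).card / 2 ^ L) + G.card / n) +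
    D₁ * (∑ p ∈ G, fluct (densMeas f₀) (distFn f₀) xs L p.1 p.2) +
    D₂ * (∑ e ∈ leaves G L, fluct (densMeas f₀) (distFn f₀) xs L L e) +
    52 * spacing S xs +
    (3 + 12 * Real.log n) * (∑ e ∈ edgeCells L, (empMeas xs).real (cell (distFn f₀) L e)) +
    2 * ((n : ℝ) ^ 2)⁻¹ * ∫ x, edgeWeight f₀ x ∂(empMeas xs)

theorem mem_edgeCells {L : ℕ} {e : ℤ} (h0 : 0 ≤ e) (h1 : e < 2 ^ L)
    (h : ¬ (2 ≤ e ∧ e + 3 ≤ 2 ^ L)) : e ∈ edgeCells L := by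
  simp only [edgeCells, Finset.mem_insert, Finset.mem_singleton]
  omega

theorem IsTriple.integrableOn_log_mix (h : IsTriple f₀ q f) {l : ℕ} {j : ℤ} {a b : ℝ}
    (hB : IsTameBlock f₀ q Λ l j a b) (hΛ : 0 < Λ) {S M : ℝ} (hS0 : 0 < S)
    (hS : ∀ x, S * min (distFn f₀ x) (1 - distFn f₀ x) ≤ f₀ x) (hM : 0 ≤ M)
    (hfM : ∀ x, f x ≤ S * Real.exp M) :
    IntegrableOn (fun x => f₀ x * Real.log (mixFn (q x) (f x) / q x)) (cell (distFn f₀) l j) := by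
  have hm := measurableSet_cell (distFn_mono h.dens₀) l j
  refine Integrable.mono' (h.dens₀.integrable.mul_const
    (Real.log 3 + (M + (4 * Λ + 2) + l))).integrableOn
    (h.dens₀.2.1.mul h.measurable_log_mix).aestronglyMeasurable ?_
  filter_upwards [ae_restrict_mem hm] with x hx
  have h1 := hB.log_mem_Icc h hΛ hS0 hS hM hfM hx
  have h3 : 0 ≤ Real.log 3 := Real.log_nonneg (by norm_num)
  have hl : (0 : ℝ) ≤ l := Nat.cast_nonneg l
  rw [norm_mul, Real.norm_of_nonneg (h.dens₀.1 x), Real.norm_eq_abs]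
  refine mul_le_mul_of_nonneg_left (abs_le.2 ⟨?_, ?_⟩) (h.dens₀.1 x) <;> linarith [h1.1, h1.2]

end Majorant

theorem exists_majorant : ∃ D₂ : ℝ, 0 ≤ D₂ ∧ ∀ {Λ : ℝ}, 0 < Λ → ∃ D₁ : ℝ, 0 ≤ D₁ ∧
    ∀ {n k l₀ L : ℕ}, 2 ≤ n → 6 ≤ l₀ → l₀ ≤ L → (2 : ℝ) ^ L ≤ 64 * n →
      ∀ {f₀ q f : ℝ → ℝ} {I : Fin k → Set ℝ} {S : ℝ} {xs : Fin n → ℝ}, IsTriple f₀ q f →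
      (∀ r, (I r).OrdConnected) → (∀ x : ℝ, x ∉ ⋃ r, I r → q x = 0) →
      (∀ r, ∃ a b : ℝ, ∀ x ∈ I r, q x = Real.exp (a * x + b)) →
      0 < S → (∀ x, S * min (distFn f₀ x) (1 - distFn f₀ x) ≤ f₀ x) →
      IsMLE1 xs f → Function.Injective xs → (∀ i, 0 < f (xs i)) →
      (∀ i, 0 < f₀ (xs i) ∧ 0 < q (xs i) ∧ distFn f₀ (xs i) ∈ Ioo (0 : ℝ) 1) →
      (n : ℝ)⁻¹ * ∑ i, Real.log (f (xs i) / f₀ (xs i)) ≤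
        majorant D₁ D₂ f₀ q S (goodCells f₀ q Λ (breakPts (distFn f₀) I) l₀ L) L xs := by
  obtain ⟨D₂, hD₂, hleaf⟩ := exists_leaf_const
  refine ⟨D₂, hD₂, fun {Λ} hΛ => ?_⟩
  obtain ⟨D₁, hD₁, hblock⟩ := exists_block_const hΛ
  refine ⟨D₁, hD₁, ?_⟩
  intro n k l₀ L hn hl₀ hL hLn f₀ q f I S xs h hI hI0 hIa hS0 hS hf hinj hpos hx
  have hn0 : 0 < n := by omega
  have hn0' : (0 : ℝ) < n := by exact_mod_cast hn0
  have hlog : 0 ≤ Real.log n := Real.log_nonneg (by exact_mod_cast hn0)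
  have hF := distFn_mono h.dens₀
  set G := goodCells f₀ q Λ (breakPts (distFn f₀) I) l₀ L with hGdef
  have hG : G ⊆ whitney (breakPts (distFn f₀) I) l₀ L := goodCells_subset _ _ _ _ _ _
  set ζ := spacing S xs with hζdef
  have hζ : 0 ≤ ζ := spacing_nonneg hS0 xs
  have hbd : ∀ i, Real.log (f (xs i) / f₀ (xs i)) ≤ 3 + 12 * Real.log n + ζ +
      2 * ((n : ℝ) ^ 2)⁻¹ * edgeWeight f₀ (xs i) := fun i =>
    hf.log_div_le hn hpos hinj hS0 hS (hpos i) (hx i).1 (hx i).2.2.1 (hx i).2.2.2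
  have hfM : ∀ x, f x ≤ S * Real.exp (3 + 8 * Real.log n + ζ) :=
    hf.le_height hn hpos hinj hS0
  set J : ℕ × ℤ → Set ℝ := fun p => cell (distFn f₀) p.1 p.2 with hJ
  have hJm : ∀ p, MeasurableSet (J p) := fun p => measurableSet_cell hF _ _
  set g : ℝ → ℝ := fun x => Real.log (mixFn (q x) (f x) / q x) with hg
  set φ : ℝ → ℝ := fun x => Real.log (f₀ x / q x) with hφ
  set u : ℝ → ℝ := fun x => Real.log (f x / f₀ x) with hu
  set K := ∫ x, klFn (f₀ x) (q x) with hK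
  set Δ := ∫ x, hellFn (q x) (f x) with hΔ
  have hK0 : 0 ≤ K := integral_nonneg_of_ae h.klFn_nonneg
  have hΔ0 : 0 ≤ Δ := integral_nonneg fun _ => hellFn_nonneg _ _
  set Y := (Δ + 2 * K) / 1024 + 3 / 2 * ζ with hY
  have hY0 : 0 ≤ Y := by positivity
  have split : (n : ℝ)⁻¹ * ∑ i, u (xs i) =
      ∑ p ∈ G, ∫ x in J p, u x ∂(empMeas xs) +
        ∑ e ∈ leaves G L, ∫ x in cell (distFn f₀) L e, u x ∂(empMeas xs) := by
    simp only [hJ, setIntegral_empMeas xs u (measurableSet_cell hF _ _)]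
    rw [← Finset.mul_sum, ← Finset.mul_sum, ← mul_add, Finset.sum_comm,
      Finset.sum_comm (s := leaves G L), ← Finset.sum_add_distrib]
    congr 1
    exact Finset.sum_congr rfl fun i _ =>
      (sum_indicator_cells hG ⟨(hx i).2.2.1, (hx i).2.2.2.le⟩ u).symm
  have hgood : ∀ p ∈ G, ∫ x in J p, u x ∂(empMeas xs) ≤
      (1 / 672 * (1 / n + hellAround f₀ q f p.1 p.2) +
        D₁ * fluct (densMeas f₀) (distFn f₀) xs L p.1 p.2 +
        4 / 3 * Y * ∫ y in cell3 (distFn f₀) p.1 p.2, f y) +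
      (3 / 2 * (∫ x in J p, g x ∂(densMeas f₀)) - ∫ x in J p, φ x ∂(densMeas f₀)) -
      (∫ x in J p, φ x ∂(empMeas xs) - ∫ x in J p, φ x ∂(densMeas f₀)) := by
    intro p hp
    obtain ⟨a, b, hB⟩ := h.exists_isTameBlock hI hI0 hIa hp
    have hw := mem_whitney.1 (hG hp)
    have h1 := hblock hn xs hB h hS0 hζ hS hfM hw.2.1 hLn
    have h2 := h.spike_term_le (hl₀.trans hw.1) p.2 hζ (c := 3 / 2) (by norm_num) le_rfl
    have h3 : ∫ x in J p, u x ∂(empMeas xs) ≤ ∫ x in J p, (3 / 2 * g x - φ x) ∂(empMeas xs) := by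
      refine setIntegral_empMeas_mono xs (hJm p) fun i _ => ?_
      have h4 := log_div_le_log_mix (hx i).2.1 (hpos i)
      have e : u (xs i) = Real.log (f (xs i) / q (xs i)) - φ (xs i) := by
        simp only [hu, hφ]
        rw [Real.log_div (hpos i).ne' (hx i).1.ne', Real.log_div (hpos i).ne' (hx i).2.1.ne',
          Real.log_div (hx i).1.ne' (hx i).2.1.ne']
        ring
      rw [e]
      exact sub_le_sub_right h4 _
    rw [integral_sub (integrable_empMeas xs _).integrableOn (integrable_empMeas xs _).integrableOn,
      integral_const_mul] at h3
    have h12 : 3 / 2 * ((∫ x in J p, g x ∂(empMeas xs)) - ∫ x in J p, g x ∂(densMeas f₀)) ≤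
        1 / 672 * (1 / n + hellAround f₀ q f p.1 p.2) +
          D₁ * fluct (densMeas f₀) (distFn f₀) xs L p.1 p.2 +
          4 / 3 * Y * ∫ y in cell3 (distFn f₀) p.1 p.2, f y :=
      h1.trans (add_le_add le_rfl h2)
    linarith
  set E : ℤ → ℝ := fun e => ∫ x in cell (distFn f₀) L e, edgeWeight f₀ x ∂(empMeas xs) with hE
  have hE0 : ∀ e, 0 ≤ E e := fun e => integral_nonneg fun x => edgeWeight_nonneg h.dens₀ x
  have hleaves : ∀ e ∈ leaves G L, ∫ x in cell (distFn f₀) L e, u x ∂(empMeas xs) ≤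
      1 / 640 * ((∫ x in cell (distFn f₀) L (e + (-1)), f x) +
          ∫ x in cell (distFn f₀) L (e + 1), f x) +
        D₂ * fluct (densMeas f₀) (distFn f₀) xs L L e +
        4 / 3 * Y * (∫ y in cell3 (distFn f₀) L e, f y) +
        2 * ((n : ℝ) ^ 2)⁻¹ * E e +
        (if e ∈ edgeCells L then
          (3 + 12 * Real.log n) * (empMeas xs).real (cell (distFn f₀) L e) + ζ else 0) := by
    intro e he
    have h0 := Finset.mem_Ico.1 (Finset.mem_filter.1 he).1
    have hm := measurableSet_cell hF L e
    have hsp := h.spike_term_le (hl₀.trans hL) e hζ (c := 1) (by norm_num) (by norm_num)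
    have hedge : 0 ≤ (if e ∈ edgeCells L then
          (3 + 12 * Real.log n) * (empMeas xs).real (cell (distFn f₀) L e) + ζ else 0) := by
      split_ifs
      · have : 0 ≤ (empMeas xs).real (cell (distFn f₀) L e) := measureReal_nonneg
        positivity
      · exact le_rfl
    rw [one_mul] at hsp
    by_cases hin : 2 ≤ e ∧ e + 3 ≤ 2 ^ L
    · have : ∫ x in cell (distFn f₀) L e, u x ∂(empMeas xs) ≤
          1 / 640 * ((∫ x in cell (distFn f₀) L (e + (-1)), f x) +
            ∫ x in cell (distFn f₀) L (e + 1), f x) +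
          D₂ * fluct (densMeas f₀) (distFn f₀) xs L L e +
          4 / 3 * Y * (∫ y in cell3 (distFn f₀) L e, f y) + 2 * ((n : ℝ) ^ 2)⁻¹ * E e :=
        (hleaf hn xs h.dens₀ h.lc₀ h.dens h.lc hζ (fun i => (hx i).1) hpos hbd hin.1 hin.2).trans
          (add_le_add (add_le_add le_rfl hsp) le_rfl)
      linarith
    · have h1 := leaf_le_of_edge hn0 hm xs hζ hbd
      rw [if_pos (mem_edgeCells h0.1 h0.2 hin)]
      have h2 : 0 ≤ ∫ y in cell3 (distFn f₀) L e, f y := h.dens.setIntegral_nonneg _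
      have h3 : 0 ≤ ∫ x in cell (distFn f₀) L (e + (-1)), f x := h.dens.setIntegral_nonneg _
      have h4 : 0 ≤ ∫ x in cell (distFn f₀) L (e + 1), f x := h.dens.setIntegral_nonneg _
      have h5 := fluct_nonneg (densMeas f₀) (distFn f₀) xs L L e
      have h6 : 0 ≤ D₂ * fluct (densMeas f₀) (distFn f₀) xs L L e := by positivity
      have h7 : 0 ≤ 4 / 3 * Y * ∫ y in cell3 (distFn f₀) L e, f y := by positivity
      simp only [hE]
      linarith
  have sG := Finset.sum_le_sum hgood
  have sR := Finset.sum_le_sum hleaves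
  simp only [Finset.sum_sub_distrib _, Finset.sum_add_distrib, ← Finset.mul_sum,
    Finset.sum_const, nsmul_eq_mul] at sG sR
  have b1 := h.sum_good_integral_le hG fun p hp => by
    obtain ⟨a, b, hB⟩ := h.exists_isTameBlock hI hI0 hIa hp
    exact h.integrableOn_log_mix hB hΛ hS0 hS (by positivity) hfM
  have b2 := h.sum_hellAround_le hG
  have b3 := h.sum_cell3_good_le hG
  have b4 := h.sum_cell3_leaves_le (leaves G L) L
  have b5 := h.sum_shift_le (leaves G L) L (-1)
  have b6 := h.sum_shift_le (leaves G L) L 1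
  have b7 : ∑ e ∈ leaves G L, E e ≤ ∫ x, edgeWeight f₀ x ∂(empMeas xs) := by
    have := sum_leaves_shift_le hF (integrable_empMeas xs (edgeWeight f₀))
      (ae_of_all _ fun x => edgeWeight_nonneg h.dens₀ x) (leaves G L) L 0
    simpa only [add_zero] using this
  have b8 : ∑ e ∈ leaves G L, (if e ∈ edgeCells L then
        (3 + 12 * Real.log n) * (empMeas xs).real (cell (distFn f₀) L e) + ζ else 0) ≤
      (3 + 12 * Real.log n) * (∑ e ∈ edgeCells L, (empMeas xs).real (cell (distFn f₀) L e)) +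
        4 * ζ := by
    have hnn : ∀ e, 0 ≤ (3 + 12 * Real.log n) * (empMeas xs).real (cell (distFn f₀) L e) + ζ := by
      intro e
      have : 0 ≤ (empMeas xs).real (cell (distFn f₀) L e) := measureReal_nonneg
      positivity
    rw [Finset.sum_ite_mem]
    refine (Finset.sum_le_sum_of_subset_of_nonneg Finset.inter_subset_right
      fun e _ _ => hnn e).trans ?_
    rw [Finset.sum_add_distrib, ← Finset.mul_sum, Finset.sum_const, nsmul_eq_mul]
    have : ((edgeCells L).card : ℝ) ≤ 4 := by exact_mod_cast Finset.card_le_four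
    gcongr
  have b3' := mul_le_mul_of_nonneg_left b3 hY0
  have b4' := mul_le_mul_of_nonneg_left b4 hY0
  have b7' := mul_le_mul_of_nonneg_left b7 (show 0 ≤ 2 * ((n : ℝ) ^ 2)⁻¹ by positivity)
  have b9 : (G.card : ℝ) * (1 / n) = G.card / n := by ring
  have b10 : (0 : ℝ) ≤ G.card / n := by positivity
  have b11 : (0 : ℝ) ≤ (leaves G L).card / 2 ^ L := by positivity
  rw [Finset.sum_sub_distrib, ← Finset.mul_sum] at b1
  rw [split, majorant, Finset.sum_sub_distrib]
  simp only [hJ] at *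
  rw [b9] at sG
  linarith

section Expectation

variable {P : Measure ℝ} [IsProbabilityMeasure P] {n : ℕ}

theorem integral_empMeas_pi (hn : 0 < n) {g : ℝ → ℝ} (hg : Integrable g P) :
    Integrable (fun xs => ∫ x, g x ∂(empMeas xs)) (Measure.pi fun _ : Fin n => P) ∧
      ∫ xs, ∫ x, g x ∂(empMeas xs) ∂(Measure.pi fun _ : Fin n => P) = ∫ x, g x ∂P := by
  have hi : ∀ i, Integrable (fun xs : Fin n → ℝ => g (xs i)) (Measure.pi fun _ : Fin n => P) :=
    fun i => integrable_comp_eval (μ := fun _ : Fin n => P) hg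
  have hn' : (n : ℝ) ≠ 0 := by exact_mod_cast hn.ne'
  simp only [integral_empMeas]
  refine ⟨(integrable_finsetSum _ fun i _ => hi i).const_mul _, ?_⟩
  rw [integral_const_mul, integral_finsetSum _ fun i _ => hi i]
  simp only [integral_comp_eval (μ := fun _ : Fin n => P) hg.aestronglyMeasurable,
    Finset.sum_const, Finset.card_univ, Fintype.card_fin, nsmul_eq_mul]
  field_simp

theorem setIntegral_empMeas_pi (hn : 0 < n) {g : ℝ → ℝ} (hg : Integrable g P) {A : Set ℝ}
    (hA : MeasurableSet A) :
    Integrable (fun xs => ∫ x in A, g x ∂(empMeas xs)) (Measure.pi fun _ : Fin n => P) ∧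
      ∫ xs, ∫ x in A, g x ∂(empMeas xs) ∂(Measure.pi fun _ : Fin n => P) = ∫ x in A, g x ∂P := by
  have := integral_empMeas_pi hn (hg.indicator hA)
  simpa only [integral_indicator hA] using this

theorem real_empMeas_pi (hn : 0 < n) {A : Set ℝ} (hA : MeasurableSet A) :
    Integrable (fun xs => (empMeas xs).real A) (Measure.pi fun _ : Fin n => P) ∧
      ∫ xs, (empMeas xs).real A ∂(Measure.pi fun _ : Fin n => P) = P.real A := by
  have h1 := integral_empMeas_pi (P := P) hn ((integrable_const (1 : ℝ)).indicator hA)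
  have e : ∀ xs : Fin n → ℝ, ∫ x, A.indicator (fun _ => (1 : ℝ)) x ∂(empMeas xs) =
      (empMeas xs).real A := fun xs => by rw [integral_empMeas, real_empMeas]; rfl
  simp only [e] at h1
  refine ⟨h1.1, h1.2.trans ?_⟩
  rw [integral_indicator hA]
  simp

theorem fluct_integral_le (hn : 0 < n) {F : ℝ → ℝ} (hF : Monotone F)
    (hP : ∀ l j, P.real (cell F l j) ≤ 1 / 2 ^ l) {l L : ℕ} (hl : l ≤ L) (j : ℤ)
    (h1 : (2 : ℝ) ^ L ≤ 64 * n) (h2 : (n : ℝ) ≤ 2 ^ L) :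
    Integrable (fun xs => fluct P F xs L l j) (Measure.pi fun _ : Fin n => P) ∧
      ∫ xs, fluct P F xs L l j ∂(Measure.pi fun _ : Fin n => P) ≤ 471859201 / n := by
  have hn' : (0 : ℝ) < n := by exact_mod_cast hn
  have e : l + (L - l) = L := by omega
  obtain ⟨hi, hb⟩ := chainBound_integral_le hn hF hP (L - l) l j (by rwa [e]) (by rwa [e])
  have hc : Integrable (fun _ : Fin n → ℝ => 1 / (n : ℝ)) (Measure.pi fun _ : Fin n => P) :=
    integrable_const _
  simp only [fluct]
  refine ⟨hc.add (hi.const_mul _), ?_⟩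
  rw [integral_add hc (hi.const_mul _), integral_const_mul, integral_const]
  have h3 := mul_le_mul_of_nonneg_left hb (show (0 : ℝ) ≤ n * (2 ^ l) ^ 2 by positivity)
  have e2 : (n : ℝ) * (2 ^ l) ^ 2 * (471859200 * (1 / 2 ^ l) ^ 2 / n ^ 2) = 471859200 / n := by
    have : (2 : ℝ) ^ l ≠ 0 := by positivity
    field_simp
  rw [e2] at h3
  simp only [probReal_univ, smul_eq_mul, one_mul]
  calc _ ≤ 1 / (n : ℝ) + 471859200 / n := by gcongr
    _ = _ := by ring

theorem map_pair_pi {i j : Fin n} (hij : i ≠ j) :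
    (Measure.pi fun _ : Fin n => P).map (fun xs => (xs i, xs j)) = P.prod P := by
  have h := (ProbabilityTheory.iIndepFun_pi (μ := fun _ : Fin n => P)
    (X := fun _ : Fin n => fun x : ℝ => x) fun _ => aemeasurable_id).indepFun hij
  rw [ProbabilityTheory.indepFun_iff_map_prod_eq_prod_map_map
    (measurable_pi_apply i).aemeasurable (measurable_pi_apply j).aemeasurable] at h
  have e : ∀ i : Fin n, (Measure.pi fun _ : Fin n => P).map (fun xs => xs i) = P := fun i =>
    (measurePreserving_eval (fun _ : Fin n => P) i).map_eq
  rw [e, e] at h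
  exact h

theorem ae_injective_pi (hP : P ≪ volume) :
    ∀ᵐ xs ∂(Measure.pi fun _ : Fin n => P), Function.Injective xs := by
  have : NullSingletonClass P := ⟨fun x => hP (by simp)⟩
  have h : ∀ i j : Fin n, i ≠ j → ∀ᵐ xs ∂(Measure.pi fun _ : Fin n => P), xs i ≠ xs j := by
    intro i j hij
    have h1 : ∀ᵐ p ∂(P.prod P), p.1 ≠ p.2 := by
      have hm : MeasurableSet {p : ℝ × ℝ | p.1 ≠ p.2} :=
        (measurableSet_eq_fun measurable_fst measurable_snd).compl
      rw [Measure.ae_prod_iff_ae_ae hm]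
      refine ae_of_all _ fun x => ?_
      have : ∀ᵐ y ∂P, y ≠ x := by simp [ae_iff]
      filter_upwards [this] with y hy using hy.symm
    rw [← map_pair_pi hij] at h1
    exact ae_of_ae_map (p := fun q : ℝ × ℝ => q.1 ≠ q.2)
      (f := fun xs : Fin n → ℝ => (xs i, xs j)) (by fun_prop) h1
  have h2 : ∀ᵐ xs ∂(Measure.pi fun _ : Fin n => P), ∀ i j : Fin n, i ≠ j → xs i ≠ xs j := by
    simp only [ae_all_iff]
    exact h
  filter_upwards [h2] with xs hxs i j hij
  by_contra hne
  exact hxs i j hne hij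

theorem ae_forall_eval_pi {p : ℝ → Prop} (hp : ∀ᵐ x ∂P, p x) :
    ∀ᵐ xs ∂(Measure.pi fun _ : Fin n => P), ∀ i, p (xs i) :=
  ae_all_iff.2 fun i => (measurePreserving_eval (fun _ : Fin n => P) i).quasiMeasurePreserving.ae hp

theorem spacing_integral_le (hn : 0 < n) {S : ℝ} (hS : 0 < S)
    (hP : ∀ x, ∫⁻ y, ENNReal.ofReal (pairKer S x y) ∂P ≤ 9) :
    Integrable (fun xs => spacing S xs) (Measure.pi fun _ : Fin n => P) ∧
      ∫ xs, spacing S xs ∂(Measure.pi fun _ : Fin n => P) ≤ 18 / n := by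
  have hn' : (1 : ℝ) ≤ n := by exact_mod_cast hn
  have hlin : ∀ i j : Fin n, i ≠ j →
      ∫⁻ xs, ENNReal.ofReal (pairKer S (xs i) (xs j)) ∂(Measure.pi fun _ : Fin n => P) ≤ 9 := by
    intro i j hij
    have hm : Measurable fun p : ℝ × ℝ => ENNReal.ofReal (pairKer S p.1 p.2) :=
      (measurable_pairKer S).ennreal_ofReal
    have e := lintegral_map (μ := Measure.pi fun _ : Fin n => P) hm
      (g := fun xs : Fin n → ℝ => (xs i, xs j)) (by fun_prop)
    rw [map_pair_pi hij, lintegral_prod _ hm.aemeasurable] at e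
    rw [← e]
    calc _ ≤ ∫⁻ _ : ℝ, 9 ∂P := lintegral_mono hP
      _ = 9 := by simp
  have hmeas : ∀ i j : Fin n, Measurable fun xs : Fin n → ℝ => pairKer S (xs i) (xs j) :=
    fun i j => (measurable_pairKer S).comp
      (by fun_prop : Measurable fun xs : Fin n → ℝ => (xs i, xs j))
  have hInt : ∀ i j : Fin n, i ≠ j →
      Integrable (fun xs : Fin n → ℝ => pairKer S (xs i) (xs j)) (Measure.pi fun _ : Fin n => P) ∧
      ∫ xs, pairKer S (xs i) (xs j) ∂(Measure.pi fun _ : Fin n => P) ≤ 9 := by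
    intro i j hij
    refine ⟨⟨(hmeas i j).aestronglyMeasurable, ?_⟩, ?_⟩
    · rw [hasFiniteIntegral_iff_ofReal (ae_of_all _ fun xs => pairKer_nonneg hS _ _)]
      exact (hlin i j hij).trans_lt (by simp)
    · rw [integral_eq_lintegral_of_nonneg_ae (ae_of_all _ fun xs => pairKer_nonneg hS _ _)
        (hmeas i j).aestronglyMeasurable]
      exact ENNReal.toReal_le_of_le_ofReal (by norm_num) ((hlin i j hij).trans (by simp))
  have hi : ∀ p ∈ (Finset.univ : Finset (Fin n)).offDiag,
      Integrable (fun xs : Fin n → ℝ => pairKer S (xs p.1) (xs p.2))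
        (Measure.pi fun _ : Fin n => P) := fun p hp => (hInt _ _ (Finset.mem_offDiag.1 hp).2.2).1
  simp only [spacing]
  refine ⟨(integrable_finsetSum _ hi).const_mul _, ?_⟩
  rw [integral_const_mul, integral_finsetSum _ hi]
  have h1 := Finset.sum_le_sum (s := (Finset.univ : Finset (Fin n)).offDiag) fun p hp =>
    (hInt p.1 p.2 (Finset.mem_offDiag.1 hp).2.2).2
  rw [Finset.sum_const, nsmul_eq_mul, Finset.offDiag_card, Finset.card_univ, Fintype.card_fin] at h1
  have h2 : ((n * n - n : ℕ) : ℝ) ≤ n ^ 2 := by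
    rw [sq]; exact_mod_cast Nat.sub_le _ _
  calc _ ≤ 2 * ((n : ℝ) ^ 4)⁻¹ * (n ^ 2 * 9) := by
        refine mul_le_mul_of_nonneg_left (h1.trans ?_) (by positivity)
        gcongr
    _ = 18 / n ^ 2 := by field_simp; norm_num
    _ ≤ 18 / n := by
        gcongr
        nlinarith

end Expectation

theorem majorant_integral_le {n : ℕ} (hn : 0 < n) {f₀ q f : ℝ → ℝ} (h : IsTriple f₀ q f)
    {S : ℝ} (hS : 0 < S) (hS2 : ∀ x, f₀ x ≤ 2 * S) {D₁ D₂ : ℝ} (hD₁ : 0 ≤ D₁) (hD₂ : 0 ≤ D₂)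
    {B : Finset ℝ} {l₀ L : ℕ} {G : Finset (ℕ × ℤ)} (hG : G ⊆ whitney B l₀ L)
    (h1 : (2 : ℝ) ^ L ≤ 64 * n) (h2 : (n : ℝ) ≤ 2 ^ L) :
    Integrable (fun xs => majorant D₁ D₂ f₀ q S G L xs)
        (Measure.pi fun _ : Fin n => densMeas f₀) ∧
      ∫ xs, majorant D₁ D₂ f₀ q S G L xs ∂(Measure.pi fun _ : Fin n => densMeas f₀) ≤
        (27 / 32 * (∫ x, klFn (f₀ x) (q x)) + 13 / 10 * ((leaves G L).card / 2 ^ L) +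
            G.card / n) +
          D₁ * (G.card * (471859201 / n)) + D₂ * ((leaves G L).card * (471859201 / n)) +
          52 * (18 / n) + (3 + 12 * Real.log n) * (4 / 2 ^ L) + 2 * ((n : ℝ) ^ 2)⁻¹ * 4 := by
  have hP := h.dens₀.isProbabilityMeasure
  have hF := distFn_mono h.dens₀
  have hlog : 0 ≤ Real.log n := Real.log_nonneg (by exact_mod_cast hn)
  have hcell := real_densMeas_cell_le h.dens₀
  have hφ := h.dens₀.integrable_densMeas_iff.2 h.int
  set Q := Measure.pi fun _ : Fin n => densMeas f₀ with hQ
  set K := ∫ x, klFn (f₀ x) (q x)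
  have a1 : ∀ p ∈ G, Integrable (fun xs : Fin n → ℝ =>
      ∫ x in cell (distFn f₀) p.1 p.2, Real.log (f₀ x / q x) ∂(empMeas xs) -
        ∫ x in cell (distFn f₀) p.1 p.2, Real.log (f₀ x / q x) ∂(densMeas f₀)) Q := fun p _ =>
    (setIntegral_empMeas_pi hn hφ (measurableSet_cell hF _ _)).1.sub (integrable_const _)
  have i1 := (integrable_finsetSum G a1).neg
  have e1 : ∫ xs : Fin n → ℝ, ∑ p ∈ G,
      (∫ x in cell (distFn f₀) p.1 p.2, Real.log (f₀ x / q x) ∂(empMeas xs) -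
        ∫ x in cell (distFn f₀) p.1 p.2, Real.log (f₀ x / q x) ∂(densMeas f₀)) ∂Q = 0 := by
    rw [integral_finsetSum G a1]
    refine Finset.sum_eq_zero fun p _ => ?_
    have h3 := setIntegral_empMeas_pi hn hφ (measurableSet_cell hF p.1 p.2)
    rw [integral_sub h3.1 (integrable_const _), h3.2, integral_const]
    simp
  have i2 : Integrable (fun _ : Fin n → ℝ =>
      27 / 32 * K + 13 / 10 * (((leaves G L).card : ℝ) / 2 ^ L) + G.card / n) Q :=
    integrable_const _
  have a3 : ∀ p ∈ G, Integrable (fun xs => fluct (densMeas f₀) (distFn f₀) xs L p.1 p.2) Q ∧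
      ∫ xs, fluct (densMeas f₀) (distFn f₀) xs L p.1 p.2 ∂Q ≤ 471859201 / n := fun p hp =>
    fluct_integral_le hn hF hcell (mem_whitney.1 (hG hp)).2.1 p.2 h1 h2
  have i3 := (integrable_finsetSum G fun p hp => (a3 p hp).1).const_mul D₁
  have e3 : ∫ xs, ∑ p ∈ G, fluct (densMeas f₀) (distFn f₀) xs L p.1 p.2 ∂Q ≤
      G.card * (471859201 / n) := by
    rw [integral_finsetSum G fun p hp => (a3 p hp).1]
    exact (Finset.sum_le_sum fun p hp => (a3 p hp).2).trans_eq (by simp)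
  have a4 : ∀ e ∈ leaves G L, Integrable (fun xs => fluct (densMeas f₀) (distFn f₀) xs L L e) Q ∧
      ∫ xs, fluct (densMeas f₀) (distFn f₀) xs L L e ∂Q ≤ 471859201 / n := fun e _ =>
    fluct_integral_le hn hF hcell le_rfl e h1 h2
  have i4 := (integrable_finsetSum (leaves G L) fun e he => (a4 e he).1).const_mul D₂
  have e4 : ∫ xs, ∑ e ∈ leaves G L, fluct (densMeas f₀) (distFn f₀) xs L L e ∂Q ≤
      (leaves G L).card * (471859201 / n) := by
    rw [integral_finsetSum (leaves G L) fun e he => (a4 e he).1]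
    exact (Finset.sum_le_sum fun e he => (a4 e he).2).trans_eq (by simp)
  obtain ⟨a5, e5⟩ := spacing_integral_le (P := densMeas f₀) hn hS
    (lintegral_pairKer_le h.dens₀ hS hS2)
  have i5 := a5.const_mul 52
  have a6 : ∀ e ∈ edgeCells L,
      Integrable (fun xs : Fin n → ℝ => (empMeas xs).real (cell (distFn f₀) L e)) Q := fun e _ =>
    (real_empMeas_pi hn (measurableSet_cell hF L e)).1
  have i6 := (integrable_finsetSum (edgeCells L) a6).const_mul (3 + 12 * Real.log n)
  have e6 : ∫ xs : Fin n → ℝ, ∑ e ∈ edgeCells L, (empMeas xs).real (cell (distFn f₀) L e) ∂Q ≤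
      4 / 2 ^ L := by
    rw [integral_finsetSum (edgeCells L) a6]
    calc _ ≤ ∑ _e ∈ edgeCells L, (1 / 2 ^ L : ℝ) := Finset.sum_le_sum fun e _ => by
          rw [(real_empMeas_pi hn (measurableSet_cell hF L e)).2]
          exact hcell L e
      _ ≤ 4 * (1 / 2 ^ L) := by
          rw [Finset.sum_const, nsmul_eq_mul]
          have : ((edgeCells L).card : ℝ) ≤ 4 := by exact_mod_cast Finset.card_le_four
          gcongr
      _ = _ := by ring
  obtain ⟨hw, hw4⟩ := edgeWeight_integral h.dens₀
  obtain ⟨a7, e7⟩ := integral_empMeas_pi (P := densMeas f₀) hn hw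
  have i7 := a7.const_mul (2 * ((n : ℝ) ^ 2)⁻¹)
  have i12 := i1.add i2
  have i13 := i12.add i3
  have i14 := i13.add i4
  have i15 := i14.add i5
  have i16 := i15.add i6
  refine ⟨i16.add i7, ?_⟩
  refine (integral_add i16 i7).trans_le ?_
  refine (congrArg (· + _) (integral_add i15 i6)).trans_le ?_
  refine (congrArg (· + _ + _) (integral_add i14 i5)).trans_le ?_
  refine (congrArg (· + _ + _ + _) (integral_add i13 i4)).trans_le ?_
  refine (congrArg (· + _ + _ + _ + _) (integral_add i12 i3)).trans_le ?_
  refine (congrArg (· + _ + _ + _ + _ + _) (integral_add i1 i2)).trans_le ?_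
  dsimp only [Pi.neg_apply]
  rw [integral_neg, e1, integral_const, integral_const_mul, integral_const_mul,
    integral_const_mul, integral_const_mul, integral_const_mul, e7, hw4]
  simp only [probReal_univ, smul_eq_mul, one_mul, neg_zero, zero_add]
  gcongr

section LogBounds

variable {n k : ℕ}

theorem log_exp_mul_div (hk : 1 ≤ k) (hkn : k ≤ n) :
    Real.log (Real.exp 1 * n / k) = 1 + (Real.log n - Real.log k) ∧
      1 ≤ Real.log (Real.exp 1 * n / k) := by
  have hk' : (0 : ℝ) < k := by exact_mod_cast hk
  have hn' : (0 : ℝ) < n := hk'.trans_le (by exact_mod_cast hkn)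
  have e : Real.log (Real.exp 1 * n / k) = 1 + (Real.log n - Real.log k) := by
    rw [Real.log_div (by positivity) (by positivity), Real.log_mul (by positivity) (by positivity),
      Real.log_exp]
    ring
  have : Real.log k ≤ Real.log n := Real.log_le_log hk' (by exact_mod_cast hkn)
  exact ⟨e, by rw [e]; linarith⟩

theorem log_le_mul_log (hk : 1 ≤ k) (hkn : k ≤ n) :
    Real.log n ≤ k * Real.log (Real.exp 1 * n / k) := by
  obtain ⟨e, h1⟩ := log_exp_mul_div hk hkn
  have hk' : (1 : ℝ) ≤ k := by exact_mod_cast hk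
  have h2 := Real.log_le_sub_one_of_pos (show (0 : ℝ) < k by linarith)
  nlinarith

theorem card_whitney_log_le (hk : 1 ≤ k) (hkn : k ≤ n) {B : Finset ℝ} (hB : B.card ≤ 2 * k + 2) :
    ((whitney B (Nat.log 2 k + 6) (Nat.log 2 n + 6)).card : ℝ) ≤
      320 * (k * Real.log (Real.exp 1 * n / k)) := by
  obtain ⟨e, h1⟩ := log_exp_mul_div hk hkn
  set lg := Real.log (Real.exp 1 * n / k)
  have hk' : (1 : ℝ) ≤ k := by exact_mod_cast hk
  have hn' : (1 : ℝ) ≤ n := hk'.trans (by exact_mod_cast hkn)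
  have hkl : (2 : ℝ) ^ Nat.log 2 k ≤ k := by exact_mod_cast Nat.pow_log_le_self 2 (by omega)
  have hku : (k : ℝ) < 2 ^ (Nat.log 2 k + 1) := by
    exact_mod_cast Nat.lt_pow_succ_log_self (by norm_num) k
  have hnl : (2 : ℝ) ^ Nat.log 2 n ≤ n := by exact_mod_cast Nat.pow_log_le_self 2 (by omega)
  have hmono : Nat.log 2 k ≤ Nat.log 2 n := Nat.log_mono_right hkn
  have hl2 := Real.log_two_gt_d9
  have g1 : Real.log k ≤ (Nat.log 2 k + 1) * Real.log 2 := by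
    have := Real.log_le_log (by linarith) hku.le
    rw [Real.log_pow] at this
    exact_mod_cast this
  have g2 : (Nat.log 2 n) * Real.log 2 ≤ Real.log n := by
    have := Real.log_le_log (by positivity) hnl
    rwa [Real.log_pow] at this
  have g3 : (Nat.log 2 k) * Real.log 2 ≤ Real.log k := by
    have := Real.log_le_log (by positivity) hkl
    rwa [Real.log_pow] at this
  have hlen : (Nat.log 2 n : ℝ) - Nat.log 2 k ≤ 2 * lg := by
    have hm : (Nat.log 2 k : ℝ) ≤ Nat.log 2 n := by exact_mod_cast hmono
    have hl2' := Real.log_two_lt_d9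
    nlinarith
  have hw : ((whitney B (Nat.log 2 k + 6) (Nat.log 2 n + 6)).card : ℝ) ≤
      2 ^ (Nat.log 2 k + 6) + ((Nat.log 2 n : ℝ) - Nat.log 2 k) * (32 * B.card) := by
    have h2 := card_whitney_le B (Nat.log 2 k + 6) (Nat.log 2 n + 6)
    have h3 : ((Nat.log 2 n + 6 - (Nat.log 2 k + 6) : ℕ) : ℝ) =
        (Nat.log 2 n : ℝ) - Nat.log 2 k := by
      rw [Nat.add_sub_add_right, Nat.cast_sub hmono]
    rw [← h3]
    exact_mod_cast h2
  have hB' : (B.card : ℝ) ≤ 2 * k + 2 := by exact_mod_cast hB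
  have h4 : ((Nat.log 2 n : ℝ) - Nat.log 2 k) * (32 * B.card) ≤ 2 * lg * (32 * (4 * k)) := by
    have hm : (0 : ℝ) ≤ Nat.log 2 n - Nat.log 2 k := by
      have : (Nat.log 2 k : ℝ) ≤ Nat.log 2 n := by exact_mod_cast hmono
      linarith
    gcongr
    linarith
  rw [pow_add] at hw
  nlinarith

theorem pow_log_add_le (hn : 1 ≤ n) :
    (2 : ℝ) ^ (Nat.log 2 n + 6) ≤ 64 * n ∧ 32 * (n : ℝ) ≤ 2 ^ (Nat.log 2 n + 6) := by
  have h1 : (2 : ℝ) ^ Nat.log 2 n ≤ n := by exact_mod_cast Nat.pow_log_le_self 2 (by omega)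
  have h2 : (n : ℝ) < 2 ^ (Nat.log 2 n + 1) := by
    exact_mod_cast Nat.lt_pow_succ_log_self (by norm_num) n
  rw [pow_add] at h2 ⊢
  constructor <;> linarith

end LogBounds

theorem majorant_bound_le {n k : ℕ} (hk : 1 ≤ k) (hkn : k ≤ n) {D₁ D₂ K g r N R Λ : ℝ}
    (hD₁ : 0 ≤ D₁) (hD₂ : 0 ≤ D₂) (hK : 0 ≤ K) (hN : N ≤ 64 * n) (hN' : 32 * n ≤ N)
    (hg : g ≤ 320 * (k * Real.log (Real.exp 1 * n / k))) (hr0 : 0 ≤ r)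
    (hr : r / N ≤ 64 * k / N + 21 * K / Λ) (hR : R = 13 / 10 + 64 * 471859201 * D₂)
    (hΛ : Λ = 135 * R) :
    (27 / 32 * K + 13 / 10 * (r / N) + g / n) + D₁ * (g * (471859201 / n)) +
      D₂ * (r * (471859201 / n)) + 52 * (18 / n) + (3 + 12 * Real.log n) * (4 / N) +
      2 * ((n : ℝ) ^ 2)⁻¹ * 4 ≤
    (2 * R + 320 + 320 * 471859201 * D₁ + 946) * k / n * Real.log (Real.exp 1 * n / k) + K := by
  obtain ⟨-, h1⟩ := log_exp_mul_div hk hkn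
  have h2 := log_le_mul_log hk hkn
  set lg := Real.log (Real.exp 1 * n / k)
  have hk' : (1 : ℝ) ≤ k := by exact_mod_cast hk
  have hn' : (1 : ℝ) ≤ n := hk'.trans (by exact_mod_cast hkn)
  have hlog : 0 ≤ Real.log n := Real.log_nonneg hn'
  have hn0 : (0 : ℝ) < n := by linarith
  have hN0 : 0 < N := by linarith
  have hR0 : 0 < R := by rw [hR]; positivity
  set T := (k * lg) / n with hT
  have hkl : 1 ≤ k * lg := one_le_mul_of_one_le_of_one_le hk' h1
  have hT1 : 1 / n ≤ T := div_le_div_of_nonneg_right hkl hn0.le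
  have hkT : k / n ≤ T := div_le_div_of_nonneg_right (by nlinarith) hn0.le
  have t1 : g / n ≤ 320 * T := by
    rw [hT, ← mul_div_assoc]
    exact div_le_div_of_nonneg_right hg hn0.le
  have t2 : D₁ * (g * (471859201 / n)) ≤ 320 * 471859201 * D₁ * T := by
    have := mul_le_mul_of_nonneg_left t1 (show 0 ≤ 471859201 * D₁ by positivity)
    calc _ = 471859201 * D₁ * (g / n) := by ring
      _ ≤ _ := this
      _ = _ := by ring
  have t3 : D₂ * (r * (471859201 / n)) ≤ 64 * 471859201 * D₂ * (r / N) := by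
    have : r / n ≤ 64 * (r / N) := by
      rw [← mul_div_assoc, div_le_div_iff₀ hn0 hN0]
      nlinarith
    calc _ = 471859201 * D₂ * (r / n) := by ring
      _ ≤ 471859201 * D₂ * (64 * (r / N)) := by gcongr
      _ = _ := by ring
  have t4 : R * (r / N) ≤ 2 * R * T + 5 / 32 * K := by
    have e1 : 64 * k / N ≤ 2 * T := by
      calc 64 * k / N ≤ 64 * k / (32 * n) := by gcongr
        _ = 2 * (k / n) := by ring
        _ ≤ _ := by linarith
    have e2 : R * (21 * K / Λ) = 21 / 135 * K := by rw [hΛ]; field_simp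
    calc R * (r / N) ≤ R * (2 * T + 21 * K / Λ) := by gcongr; linarith
      _ = 2 * R * T + R * (21 * K / Λ) := by ring
      _ ≤ _ := by rw [e2]; linarith
  have t5 : (3 + 12 * Real.log n) * (4 / N) ≤ 2 * T := by
    calc _ ≤ (15 * (k * lg)) * (4 / (32 * n)) := by gcongr; linarith
      _ = 15 / 8 * T := by rw [hT]; ring
      _ ≤ _ := by have : 0 ≤ T := le_trans (by positivity) hT1
                  linarith
  have t6 : 2 * ((n : ℝ) ^ 2)⁻¹ * 4 ≤ 8 * T := by
    have : ((n : ℝ) ^ 2)⁻¹ ≤ 1 / n := by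
      rw [one_div]; exact inv_anti₀ hn0 (by nlinarith)
    linarith
  have t7 : (52 : ℝ) * (18 / n) ≤ 936 * T := by
    calc (52 : ℝ) * (18 / n) = 936 * (1 / n) := by ring
      _ ≤ _ := by gcongr
  have e : (2 * R + 320 + 320 * 471859201 * D₁ + 946) * k / n * lg =
      (2 * R + 320 + 320 * 471859201 * D₁ + 946) * T := by rw [hT]; ring
  have e2 : R * (r / N) = 13 / 10 * (r / N) + 64 * 471859201 * D₂ * (r / N) := by rw [hR]; ring
  rw [e]
  linarith

theorem IsTriple.congr_right {f₀ q f g : ℝ → ℝ} (h : IsTriple f₀ q f) (hg : IsDensity g)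
    (hgl : IsLogConcaveFn g) : IsTriple f₀ q g :=
  ⟨h.dens₀, h.lc₀, h.densq, hg, hgl, h.ac, h.int⟩

/-- A bound with an explicit approximating density and without the extra power of the logarithm. -/
theorem exists_risk_const : ∃ C : ℝ, 0 < C ∧ ∀ {n k : ℕ}, 2 ≤ n → 1 ≤ k → k ≤ n →
    ∀ {f₀ q : ℝ → ℝ}, IsLCDensity f₀ → IsTriple f₀ q f₀ → IsKAffine k q →
    ∀ {fhat : (Fin n → ℝ) → ℝ → ℝ},
      (∀ xs : Fin n → ℝ, (∃ i j, xs i ≠ xs j) → IsMLE1 xs (fhat xs)) →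
      ∫⁻ xs, ENNReal.ofReal ((n : ℝ)⁻¹ * ∑ i, Real.log (fhat xs (xs i) / f₀ (xs i)))
          ∂(Measure.pi fun _ : Fin n => densMeas f₀) ≤
        ENNReal.ofReal (C * k / n * Real.log (Real.exp 1 * n / k) +
          ∫ x, klFn (f₀ x) (q x)) := by
  obtain ⟨D₂, hD₂, hmaj⟩ := exists_majorant
  set R : ℝ := 13 / 10 + 64 * 471859201 * D₂ with hR
  have hR0 : 0 < R := by positivity
  have hΛ : (0 : ℝ) < 135 * R := by positivity
  obtain ⟨D₁, hD₁, hmaj⟩ := hmaj hΛ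
  refine ⟨2 * R + 320 + 320 * 471859201 * D₁ + 946, by positivity, ?_⟩
  intro n k hn hk hkn f₀ q hf₀ h hq fhat hfhat
  obtain ⟨I, hI, hI0, hIa⟩ := hq
  have hP := h.dens₀.isProbabilityMeasure
  obtain ⟨S, hS0, hS2, hS⟩ := exists_height h.dens₀ h.lc₀
  obtain ⟨hN, hN'⟩ := pow_log_add_le (n := n) (by omega)
  have hn' : (0 : ℝ) < n := by exact_mod_cast (by omega : 0 < n)
  have hl : Nat.log 2 k + 6 ≤ Nat.log 2 n + 6 := Nat.add_le_add_right (Nat.log_mono_right hkn) 6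
  set l₀ := Nat.log 2 k + 6 with hl₀
  set L := Nat.log 2 n + 6 with hL
  set G := goodCells f₀ q (135 * R) (breakPts (distFn f₀) I) l₀ L with hGdef
  have hG : G ⊆ whitney (breakPts (distFn f₀) I) l₀ L := goodCells_subset _ _ _ _ _ _
  obtain ⟨hInt, hle⟩ := majorant_integral_le (n := n) (by omega) h hS0 hS2 hD₁ hD₂ hG hN
    (by linarith)
  have hbound := majorant_bound_le (n := n) (g := G.card) (r := (leaves G L).card) hk hkn hD₁ hD₂
    (integral_nonneg_of_ae h.klFn_nonneg) hN hN'
    ((Nat.cast_le.2 (Finset.card_le_card hG)).trans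
      (card_whitney_log_le hk hkn (card_breakPts_le _ I)))
    (Nat.cast_nonneg _) (h.card_leaves_good_le hΛ hk I hl) hR rfl
  have hqpos : ∀ᵐ x ∂(densMeas f₀), 0 < q x := by
    filter_upwards [h.dens₀.ae_pos, IsDensity.densMeas_absolutelyContinuous.ae_le h.ac]
      with x hx hx'
    exact lt_of_le_of_ne (h.densq.1 x) fun e => hx.ne' (hx' e.symm)
  have key : ∀ᵐ xs ∂(Measure.pi fun _ : Fin n => densMeas f₀),
      0 ≤ (n : ℝ)⁻¹ * ∑ i, Real.log (fhat xs (xs i) / f₀ (xs i)) ∧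
      (n : ℝ)⁻¹ * ∑ i, Real.log (fhat xs (xs i) / f₀ (xs i)) ≤
        majorant D₁ D₂ f₀ q S G L xs := by
    filter_upwards [ae_injective_pi (n := n) (P := densMeas f₀)
        IsDensity.densMeas_absolutelyContinuous,
      ae_forall_eval_pi (n := n) h.dens₀.ae_pos, ae_forall_eval_pi (n := n) hqpos,
      ae_forall_eval_pi (n := n) (distFn_mem_Ioo_ae h.dens₀)] with xs hinj hx1 hx2 hx3
    have hne : xs ⟨0, by omega⟩ ≠ xs ⟨1, by omega⟩ := hinj.ne (by simp)
    have hmle := hfhat xs ⟨_, _, hne⟩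
    have hpos := fun i => hmle.pos hf₀ hx1 i
    refine ⟨mul_nonneg (by positivity) ?_, ?_⟩
    · have e : ∀ i, Real.log (fhat xs (xs i) / f₀ (xs i)) =
          Real.log (fhat xs (xs i)) - Real.log (f₀ (xs i)) := fun i =>
        Real.log_div (hpos i).ne' (hx1 i).ne'
      simp only [e, Finset.sum_sub_distrib]
      exact sub_nonneg.2 (hmle.sum_log_le hf₀ hx1)
    · exact hmaj hn (Nat.le_add_left _ _) hl hN (h.congr_right hmle.1.1 hmle.1.2.2) hI hI0 hIa
        hS0 hS hmle hinj hpos fun i => ⟨hx1 i, hx2 i, hx3 i⟩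
  calc _ ≤ ∫⁻ xs, ENNReal.ofReal (majorant D₁ D₂ f₀ q S G L xs)
          ∂(Measure.pi fun _ : Fin n => densMeas f₀) :=
        lintegral_mono_ae (key.mono fun xs hxs => ENNReal.ofReal_le_ofReal hxs.2)
    _ = ENNReal.ofReal (∫ xs, majorant D₁ D₂ f₀ q S G L xs
          ∂(Measure.pi fun _ : Fin n => densMeas f₀)) :=
        (ofReal_integral_eq_lintegral_ofReal hInt (key.mono fun xs hxs => hxs.1.trans hxs.2)).symm
    _ ≤ _ := ENNReal.ofReal_le_ofReal (hle.trans hbound)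

/-- Sharp oracle inequality for the log-concave MLE on `ℝ` with respect to the empirical
divergence `d_X²`, with approximation by the classes `F^k` of log-concave densities with
`k`-affine logarithm. -/
theorem statement19 :
    ∃ C : ℝ, 0 < C ∧ ∀ n : ℕ, 2 ≤ n →
      ∀ f₀ : ℝ → ℝ, IsLCDensity f₀ →
        ∀ fhat : (Fin n → ℝ) → ℝ → ℝ,
          (∀ xs : Fin n → ℝ, (∃ i j, xs i ≠ xs j) → IsMLE1 xs (fhat xs)) →
          (∫⁻ xs, ENNReal.ofReal ((n : ℝ)⁻¹ * ∑ i, Real.log (fhat xs (xs i) / f₀ (xs i)))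
              ∂(Measure.pi fun _ : Fin n =>
                  volume.withDensity fun x => ENNReal.ofReal (f₀ x)))
            ≤ ⨅ (k : ℕ) (_ : k ∈ Finset.Icc 1 n),
                (ENNReal.ofReal
                    (C * k / n * (Real.log (Real.exp 1 * n / k)) ^ ((5 : ℝ)/4)) +
                  ⨅ (fk : ℝ → ℝ) (_ : IsLCDensity fk ∧ IsKAffine k fk), dKL f₀ fk) := by
  obtain ⟨C, hC, hmain⟩ := exists_risk_const
  refine ⟨C, hC, fun n hn f₀ hf₀ fhat hfhat => ?_⟩
  refine le_iInf₂ fun k hk => ?_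
  obtain ⟨hk1, hkn⟩ := Finset.mem_Icc.1 hk
  rw [ENNReal.add_iInf₂]
  refine le_iInf₂ fun q hq => ?_
  unfold dKL
  split_ifs with hd
  · have h : IsTriple f₀ q f₀ := ⟨hf₀.1, hf₀.2.2, hq.1.1, hf₀.1, hf₀.2.2, hd.1, hd.2⟩
    refine (hmain hn hk1 hkn hf₀ h hq.2 hfhat).trans ?_
    rw [h.integral_klFn]
    refine ENNReal.ofReal_add_le.trans ?_
    gcongr
    obtain ⟨-, h1⟩ := log_exp_mul_div hk1 hkn
    exact Real.self_le_rpow_of_one_le h1 (by norm_num)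
  · simp
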